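/- arXiv:1906.01691 — 6 statements merged into one kernel-verified Lean document; each statement's English description precedes it below -/
import Mathlib

section
/- Let A be a countably generated unital commutative real algebra with nonempty character space X(A), L : A → ℝ linear with L(1) = 1, and I the set of all finitely generated unital subalgebras of A. For each S ∈ I let K^(S) ⊆ X(S) be closed with π_{S,T}(K^(T)) ⊆ K^(S) for all T ∈ I containing S. Then there exists a (⋂_{S∈I} π_S⁻¹(K^(S)))-representing Radon measure ν for L on the Borel σ-algebra of X(A) if and only if for every S ∈ I there exists a K^(S)-representing Radon measure for L|_S. -/
open MeasureTheory
open scoped ENNReal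

namespace Stmt12

/-- The weak topology on the character space `B →ₐ[ℝ] ℝ`. -/
instance charTopology (B : Type*) [CommRing B] [Algebra ℝ B] :
    TopologicalSpace (B →ₐ[ℝ] ℝ) :=
  TopologicalSpace.induced (fun φ : B →ₐ[ℝ] ℝ => (φ : B → ℝ)) inferInstance

/-- The Borel σ-algebra of the weak topology on the character space. -/
instance charMeasurableSpace (B : Type*) [CommRing B] [Algebra ℝ B] :
    MeasurableSpace (B →ₐ[ℝ] ℝ) := borel _

instance charBorelSpace (B : Type*) [CommRing B] [Algebra ℝ B] :
    BorelSpace (B →ₐ[ℝ] ℝ) := ⟨rfl⟩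

/-- The restriction map `π_S : X(A) → X(S)` for a subalgebra `S` of `A`. -/
def resMap {A : Type*} [CommRing A] [Algebra ℝ A] (S : Subalgebra ℝ A) :
    (A →ₐ[ℝ] ℝ) → (S →ₐ[ℝ] ℝ) := fun φ => φ.comp S.val

/-- The restriction map `π_{S,T} : X(T) → X(S)` for subalgebras `S ≤ T` of `A`. -/
def resTrans {A : Type*} [CommRing A] [Algebra ℝ A] {S T : Subalgebra ℝ A} (h : S ≤ T) :
    (T →ₐ[ℝ] ℝ) → (S →ₐ[ℝ] ℝ) := fun φ => φ.comp (Subalgebra.inclusion h)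

/-- The restriction `L|_S` of a linear functional `L : A → ℝ` to a subalgebra `S`. -/
def resL {A : Type*} [CommRing A] [Algebra ℝ A] (L : A →ₗ[ℝ] ℝ) (S : Subalgebra ℝ A) :
    (↥S) →ₗ[ℝ] ℝ := L.comp (Subalgebra.val S).toLinearMap

/-- A Radon measure: locally finite and inner regular w.r.t. compact sets. -/
def IsRadon {α : Type*} [TopologicalSpace α] [MeasurableSpace α] (μ : Measure α) : Prop :=
  IsLocallyFiniteMeasure μ ∧ μ.InnerRegular

/-- `μ` is a `K`-representing Radon measure for the linear functional `L` on `B`. -/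
def IsRepr {B : Type*} [CommRing B] [Algebra ℝ B] (L : B →ₗ[ℝ] ℝ)
    (K : Set (B →ₐ[ℝ] ℝ)) (μ : Measure (B →ₐ[ℝ] ℝ)) : Prop :=
  IsRadon μ ∧ μ Kᶜ = 0 ∧
    ∀ b : B, Integrable (fun φ : B →ₐ[ℝ] ℝ => φ b) μ ∧
      L b = ∫ φ : B →ₐ[ℝ] ℝ, φ b ∂μ

/-- Prokhorov's condition for a family of measures indexed by the finitely generated
subalgebras of `A`. -/
def Prokh {A : Type*} [CommRing A] [Algebra ℝ A]
    (μf : ∀ S : Subalgebra ℝ A, Measure (↥S →ₐ[ℝ] ℝ)) : Prop :=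
  ∀ ε : ℝ≥0∞, 0 < ε → ∃ C : Set (A →ₐ[ℝ] ℝ), IsCompact C ∧
    ∀ S : Subalgebra ℝ A, S.FG → 1 - ε ≤ μf S (resMap S '' C)

section Coordinates

variable {B : Type*} [CommRing B] [Algebra ℝ B]

/-- The coordinates of a character with respect to a sequence of elements. -/
def coord (b : ℕ → B) : (B →ₐ[ℝ] ℝ) → (ℕ → ℝ) := fun φ i => φ (b i)

lemma continuous_eval (x : B) : Continuous (fun φ : B →ₐ[ℝ] ℝ => φ x) :=
  (continuous_apply x).comp continuous_induced_dom

lemma continuous_coord (b : ℕ → B) : Continuous (coord b) :=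
  continuous_pi fun i => continuous_eval (b i)

lemma eval_coord (b : ℕ → B) (φ : B →ₐ[ℝ] ℝ) (p : MvPolynomial ℕ ℝ) :
    MvPolynomial.eval (coord b φ) p = φ (MvPolynomial.aeval b p) := by
  rw [MvPolynomial.comp_aeval_apply]
  rfl

lemma range_coord {b : ℕ → B}
    (hb : Function.Surjective (MvPolynomial.aeval b : MvPolynomial ℕ ℝ →ₐ[ℝ] B)) :
    Set.range (coord b) =
      {x | ∀ p : MvPolynomial ℕ ℝ, MvPolynomial.aeval b p = 0 → MvPolynomial.eval x p = 0} := by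
  ext x
  refine ⟨?_, fun hx => ?_⟩
  · rintro ⟨φ, rfl⟩ p hp
    rw [eval_coord, hp, map_zero]
  · refine ⟨AlgHom.liftOfSurjective (MvPolynomial.aeval b) hb (MvPolynomial.aeval x) ?_, ?_⟩
    · intro p hp
      exact hx p hp
    · ext i
      have := AlgHom.liftOfSurjective_apply (MvPolynomial.aeval b) hb (MvPolynomial.aeval x)
        (fun p hp => hx p hp) (MvPolynomial.X i)
      simpa [coord] using this

lemma isClosedEmbedding_coord {b : ℕ → B}
    (hb : Function.Surjective (MvPolynomial.aeval b : MvPolynomial ℕ ℝ →ₐ[ℝ] B)) :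
    Topology.IsClosedEmbedding (coord b) := by
  have hind : Topology.IsInducing (coord b) := by
    refine Topology.IsInducing.of_comp (continuous_coord b)
      (continuous_pi fun y => MvPolynomial.continuous_eval (Function.surjInv hb y)) ?_
    convert! Topology.IsInducing.induced (fun φ : B →ₐ[ℝ] ℝ => (φ : B → ℝ)) using 1
    ext φ y
    simp [eval_coord, Function.surjInv_eq hb]
  refine ⟨⟨hind, fun φ ψ h => ?_⟩, ?_⟩
  · ext x
    obtain ⟨p, rfl⟩ := hb x
    rw [← eval_coord, ← eval_coord, h]
  · rw [range_coord hb]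
    simp only [Set.ofPred_forall]
    exact isClosed_iInter fun p => isClosed_iInter fun _ =>
      isClosed_eq (MvPolynomial.continuous_eval p) continuous_const

lemma isRadon_of_isClosedEmbedding {X Y : Type*} [TopologicalSpace X] [MeasurableSpace X]
    [BorelSpace X] [TopologicalSpace Y] [PolishSpace Y] {f : X → Y}
    (hf : Topology.IsClosedEmbedding f) (μ : Measure X) [IsFiniteMeasure μ] : IsRadon μ := by
  have := hf.polishSpace
  exact ⟨inferInstance, inferInstance⟩

end Coordinates

section WeakLimit

variable {Ω : Type*} [TopologicalSpace Ω] [MeasurableSpace Ω] [BorelSpace Ω]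

/-- Truncation of a real number to the interval `[-R, R]`. -/
def clamp (R x : ℝ) : ℝ := max (-R) (min x R)

lemma abs_clamp_le {R : ℝ} (hR : 0 ≤ R) (x : ℝ) : |clamp R x| ≤ R :=
  abs_le.2 ⟨le_max_left _ _, max_le (by linarith) (min_le_right _ _)⟩

lemma clamp_of_abs_le {R x : ℝ} (h : |x| ≤ R) : clamp R x = x := by
  rw [clamp, min_eq_left (abs_le.1 h).2, max_eq_right (abs_le.1 h).1]

lemma abs_clamp_le_abs {R : ℝ} (hR : 0 ≤ R) (x : ℝ) : |clamp R x| ≤ |x| := by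
  rcases le_total |x| R with h | h
  · rw [clamp_of_abs_le h]
  · exact (abs_clamp_le hR x).trans h

lemma abs_sub_clamp_le {R : ℝ} (hR : 0 < R) (x : ℝ) : |x - clamp R x| ≤ x ^ 2 / R := by
  rcases le_total |x| R with h | h
  · rw [clamp_of_abs_le h]
    simp only [sub_self, abs_zero]
    positivity
  · have h1 : |x - clamp R x| ≤ |x| := by
      unfold clamp
      rcases le_total 0 x with hx | hx
      · rw [abs_of_nonneg hx] at h ⊢
        rw [min_eq_right h, max_eq_right (by linarith), abs_of_nonneg (by linarith)]
        linarith
      · rw [abs_of_nonpos hx] at h ⊢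
        rw [min_eq_left (by linarith), max_eq_left (by linarith), abs_of_nonpos (by linarith)]
        linarith
    refine h1.trans ?_
    rw [le_div_iff₀ hR, ← sq_abs]
    nlinarith [abs_nonneg x]

lemma continuous_clamp (R : ℝ) : Continuous (clamp R) := by
  unfold clamp
  fun_prop

/-- Along a weakly convergent family of probability measures, uniformly bounded second moments
of a continuous function allow passing to the limit in its first moment. -/
lemma integral_eq_of_tendsto {ι : Type*} {l : Filter ι} [l.NeBot]
    {ρ : ι → ProbabilityMeasure Ω} {ρ' : ProbabilityMeasure Ω}
    (hρ : Filter.Tendsto ρ l (nhds ρ')) {f : Ω → ℝ} (hf : Continuous f) {c C : ℝ}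
    (hmom : ∀ᶠ n in l, Integrable f (ρ n : Measure Ω) ∧
      Integrable (fun x => f x ^ 2) (ρ n : Measure Ω) ∧
      ∫ x, f x ∂(ρ n : Measure Ω) = c ∧ ∫ x, f x ^ 2 ∂(ρ n : Measure Ω) ≤ C) :
    Integrable f (ρ' : Measure Ω) ∧ ∫ x, f x ∂(ρ' : Measure Ω) = c := by
  have hlim (g : ℝ → ℝ) (hg : Continuous g) (M : ℝ) (hM : ∀ x, |g x| ≤ M) :
      Filter.Tendsto (fun n => ∫ x, g (f x) ∂(ρ n : Measure Ω)) l
        (nhds (∫ x, g (f x) ∂(ρ' : Measure Ω))) :=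
    (ProbabilityMeasure.tendsto_iff_forall_integral_tendsto.1 hρ)
      (BoundedContinuousFunction.ofNormedAddCommGroup (fun x => g (f x)) (hg.comp hf) M
        fun x => hM _)
  have hint (μ : ProbabilityMeasure Ω) (g : ℝ → ℝ) (hg : Continuous g) (M : ℝ)
      (hM : ∀ x, |g x| ≤ M) : Integrable (fun x => g (f x)) (μ : Measure Ω) :=
    Integrable.of_bound (hg.comp hf).aestronglyMeasurable M (.of_forall fun x => hM _)
  have hnear (R : ℝ) (hR : 0 < R) : |∫ x, clamp R (f x) ∂(ρ' : Measure Ω) - c| ≤ C / R := by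
    refine le_of_tendsto ((hlim _ (continuous_clamp R) R (abs_clamp_le hR.le)).sub_const c).abs ?_
    filter_upwards [hmom] with n ⟨h1, h2, h3, h4⟩
    rw [← h3, ← integral_sub (hint _ _ (continuous_clamp R) R (abs_clamp_le hR.le)) h1]
    calc |∫ x, (clamp R (f x) - f x) ∂(ρ n : Measure Ω)|
        ≤ ∫ x, f x ^ 2 / R ∂(ρ n : Measure Ω) := by
          rw [← Real.norm_eq_abs]
          refine norm_integral_le_of_norm_le (h2.div_const R) (.of_forall fun x => ?_)
          rw [Real.norm_eq_abs, abs_sub_comm]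
          exact abs_sub_clamp_le hR _
      _ ≤ C / R := by
          rw [integral_div]
          gcongr
  have habs (R : ℝ) (hR : 0 < R) : ∫ x, |clamp R (f x)| ∂(ρ' : Measure Ω) ≤ 1 + C := by
    refine le_of_tendsto (hlim (fun x => |clamp R x|) (continuous_clamp R).abs R
      (by simpa using abs_clamp_le hR.le)) ?_
    filter_upwards [hmom] with n ⟨h1, h2, h3, h4⟩
    calc _ ≤ ∫ x, (1 + f x ^ 2) ∂(ρ n : Measure Ω) := by
          refine integral_mono (hint _ _ (continuous_clamp R) R (abs_clamp_le hR.le)).abs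
            ((integrable_const _).add h2) fun x => (abs_clamp_le_abs hR.le _).trans ?_
          change |f x| ≤ 1 + f x ^ 2
          rw [← sq_abs]
          nlinarith [sq_nonneg (|f x| - 1), abs_nonneg (f x)]
      _ ≤ 1 + C := by
          rw [integral_add (integrable_const _) h2]
          simpa using h4
  have hpt (x : Ω) : Filter.Tendsto (fun n : ℕ => clamp ((n : ℝ) + 1) (f x)) Filter.atTop
      (nhds (f x)) := by
    refine tendsto_const_nhds.congr' ?_
    filter_upwards [Filter.eventually_ge_atTop ⌈|f x|⌉₊] with n hn
    exact (clamp_of_abs_le (((Nat.le_ceil _).trans (Nat.cast_le.2 hn)).trans (by linarith))).symm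
  have hfi : Integrable f (ρ' : Measure Ω) := by
    refine ⟨hf.aestronglyMeasurable, ?_⟩
    have hle : ∫⁻ x, ‖f x‖ₑ ∂(ρ' : Measure Ω) ≤ ENNReal.ofReal (1 + C) := by
      calc _ = ∫⁻ x, Filter.liminf (fun n : ℕ => ‖clamp ((n : ℝ) + 1) (f x)‖ₑ) Filter.atTop
              ∂(ρ' : Measure Ω) :=
            lintegral_congr fun x => ((hpt x).enorm.liminf_eq).symm
        _ ≤ Filter.liminf (fun n : ℕ => ∫⁻ x, ‖clamp ((n : ℝ) + 1) (f x)‖ₑ ∂(ρ' : Measure Ω))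
              Filter.atTop :=
            lintegral_liminf_le fun n => ((continuous_clamp _).comp hf).measurable.enorm
        _ ≤ ENNReal.ofReal (1 + C) := by
            refine Filter.liminf_le_of_le (by isBoundedDefault) fun b hb => ?_
            obtain ⟨n, hn⟩ := hb.exists
            refine hn.trans ?_
            have hR : (0 : ℝ) < (n : ℝ) + 1 := by positivity
            rw [← ofReal_integral_norm_eq_lintegral_enorm
              (hint _ _ (continuous_clamp _) _ (abs_clamp_le hR.le))]
            exact ENNReal.ofReal_le_ofReal (habs _ hR)
    exact hle.trans_lt ENNReal.ofReal_lt_top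
  refine ⟨hfi, ?_⟩
  have hconv : Filter.Tendsto (fun n : ℕ => ∫ x, clamp ((n : ℝ) + 1) (f x) ∂(ρ' : Measure Ω))
      Filter.atTop (nhds (∫ x, f x ∂(ρ' : Measure Ω))) :=
    tendsto_integral_of_dominated_convergence (fun x => |f x|)
      (fun n => ((continuous_clamp _).comp hf).aestronglyMeasurable) hfi.abs
      (fun n => .of_forall fun x => abs_clamp_le_abs (by positivity) _)
      (.of_forall hpt)
  have hzero : Filter.Tendsto (fun n : ℕ => C / ((n : ℝ) + 1)) Filter.atTop (nhds 0) :=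
    tendsto_const_nhds.div_atTop
      (Filter.tendsto_atTop_add_const_right _ _ tendsto_natCast_atTop_atTop)
  have := le_of_tendsto_of_tendsto' (hconv.sub_const c).abs hzero
    fun n => hnear ((n : ℝ) + 1) (by positivity)
  exact sub_eq_zero.1 (abs_nonpos_iff.1 this)

/-- A family of probability measures on `ℕ → ℝ` whose coordinates have uniformly bounded second
moments is tight. -/
lemma isTightMeasureSet_of_sq_moment_le {ι : Type*} {ρ : ι → ProbabilityMeasure (ℕ → ℝ)}
    (c : ℕ → ℝ)
    (hint : ∀ k i, Integrable (fun x : ℕ → ℝ => x i ^ 2) (ρ k : Measure (ℕ → ℝ)))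
    (hc : ∀ k i, ∫ x, x i ^ 2 ∂(ρ k : Measure (ℕ → ℝ)) ≤ c i) :
    IsTightMeasureSet {((μ : ProbabilityMeasure (ℕ → ℝ)) : Measure (ℕ → ℝ)) |
      μ ∈ Set.range ρ} := by
  rw [isTightMeasureSet_iff_exists_isCompact_measure_compl_le]
  intro ε hε
  obtain ⟨δ, hδ, hsum⟩ := ENNReal.exists_pos_sum_of_countable' hε.ne' ℕ
  have hR (i : ℕ) : ∃ R : ℝ, 0 < R ∧ ENNReal.ofReal (c i / R ^ 2) ≤ δ i := by
    have : Filter.Tendsto (fun R : ℝ => ENNReal.ofReal (c i / R ^ 2)) Filter.atTop (nhds 0) := by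
      rw [← ENNReal.ofReal_zero]
      exact ENNReal.tendsto_ofReal
        (tendsto_const_nhds.div_atTop (Filter.tendsto_pow_atTop two_ne_zero))
    obtain ⟨R, h1, h2⟩ :=
      ((Filter.eventually_gt_atTop 0).and (this.eventually (ge_mem_nhds (hδ i)))).exists
    exact ⟨R, h1, h2⟩
  choose R hR0 hR using hR
  refine ⟨Set.univ.pi fun i => Set.Icc (-R i) (R i), isCompact_univ_pi fun i => isCompact_Icc, ?_⟩
  rintro _ ⟨_, ⟨k, rfl⟩, rfl⟩
  have hsub : (Set.univ.pi fun i => Set.Icc (-R i) (R i))ᶜ ⊆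
      ⋃ i, {x : ℕ → ℝ | R i ^ 2 ≤ x i ^ 2} := by
    intro x hx
    simp only [Set.mem_compl_iff, Set.mem_univ_pi, not_forall] at hx
    obtain ⟨i, hi⟩ := hx
    refine Set.mem_iUnion.2 ⟨i, ?_⟩
    rw [Set.mem_Icc, ← abs_le, not_le] at hi
    change R i ^ 2 ≤ x i ^ 2
    rw [← sq_abs (x i)]
    exact pow_le_pow_left₀ (hR0 i).le hi.le 2
  refine (measure_mono hsub).trans ((measure_iUnion_le _).trans (le_trans ?_ hsum.le))
  refine ENNReal.tsum_le_tsum fun i => le_trans ?_ (hR i)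
  have hmarkov := mul_meas_ge_le_integral_of_nonneg (.of_forall fun x => sq_nonneg _)
    (hint k i) (R i ^ 2)
  rw [← ENNReal.ofReal_toReal (measure_ne_top (ρ k : Measure (ℕ → ℝ)) _)]
  refine ENNReal.ofReal_le_ofReal ?_
  rw [le_div_iff₀' (pow_pos (hR0 i) 2)]
  exact hmarkov.trans (hc k i)

end WeakLimit

section Stages

variable {A : Type*} [CommRing A] [Algebra ℝ A]

/-- The sequence `a` with all entries from index `k` on replaced by zero. -/
def trunc (a : ℕ → A) (k : ℕ) : ℕ → A := fun i => if i < k then a i else 0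

lemma eventually_aeval_trunc (a : ℕ → A) (p : MvPolynomial ℕ ℝ) :
    ∀ᶠ k in Filter.atTop, MvPolynomial.aeval (trunc a k) p = MvPolynomial.aeval a p := by
  induction p using MvPolynomial.induction_on with
  | C r => simp
  | add p q hp hq =>
    filter_upwards [hp, hq] with k h1 h2
    rw [map_add, map_add, h1, h2]
  | mul_X p i hp =>
    filter_upwards [hp, Filter.eventually_gt_atTop i] with k h1 h2
    simp [h1, trunc, h2]

/-- The subalgebra generated by the first `k` entries of `a`. -/
def stage (a : ℕ → A) (k : ℕ) : Subalgebra ℝ A := Algebra.adjoin ℝ (Set.range (trunc a k))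

lemma stage_fg (a : ℕ → A) (k : ℕ) : (stage a k).FG := by
  have hfin : (Set.range (trunc a k)).Finite := by
    refine ((Set.finite_singleton (0 : A)).union ((Set.finite_Iio k).image a)).subset ?_
    rintro _ ⟨i, rfl⟩
    by_cases h : i < k
    · exact Or.inr ⟨i, h, by simp [trunc, h]⟩
    · exact Or.inl (by simp [trunc, h])
  exact ⟨hfin.toFinset, by rw [hfin.coe_toFinset]; rfl⟩

lemma stage_mono (a : ℕ → A) : Monotone (stage a) := by
  intro k m hkm
  refine Algebra.adjoin_le ?_
  rintro _ ⟨i, rfl⟩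
  by_cases h : i < k
  · exact Algebra.subset_adjoin ⟨i, by simp [trunc, h, h.trans_le hkm]⟩
  · simp [trunc, h]

/-- The truncated sequence, as a sequence of elements of the subalgebra it generates. -/
def gen (a : ℕ → A) (k : ℕ) : ℕ → stage a k :=
  fun i => ⟨trunc a k i, Algebra.subset_adjoin ⟨i, rfl⟩⟩

lemma coe_aeval_gen (a : ℕ → A) (k : ℕ) (p : MvPolynomial ℕ ℝ) :
    ((MvPolynomial.aeval (gen a k) p : stage a k) : A) = MvPolynomial.aeval (trunc a k) p :=
  MvPolynomial.comp_aeval_apply (gen a k) (stage a k).val p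

lemma aeval_gen_surjective (a : ℕ → A) (k : ℕ) :
    Function.Surjective (MvPolynomial.aeval (gen a k) : MvPolynomial ℕ ℝ →ₐ[ℝ] stage a k) := by
  rintro ⟨x, hx⟩
  have hx' := hx
  rw [stage, Algebra.adjoin_range_eq_range_aeval] at hx'
  obtain ⟨p, hp⟩ := hx'
  exact ⟨p, Subtype.ext ((coe_aeval_gen a k p).trans hp)⟩

lemma exists_le_stage {a : ℕ → A}
    (ha : Function.Surjective (MvPolynomial.aeval a : MvPolynomial ℕ ℝ →ₐ[ℝ] A))
    {S : Subalgebra ℝ A} (hS : S.FG) : ∃ k, S ≤ stage a k := by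
  obtain ⟨t, rfl⟩ := hS
  have : ∀ᶠ k in Filter.atTop, ∀ x ∈ t, x ∈ stage a k := by
    refine (Filter.eventually_all_finset t).2 fun x _ => ?_
    obtain ⟨p, rfl⟩ := ha x
    filter_upwards [eventually_aeval_trunc a p] with k hk
    rw [← hk, ← coe_aeval_gen]
    exact SetLike.coe_mem _
  obtain ⟨k, hk⟩ := this.exists
  exact ⟨k, Algebra.adjoin_le hk⟩

lemma trunc_coord_gen (a : ℕ → A) {m k : ℕ} (h : m ≤ k) (φ : stage a k →ₐ[ℝ] ℝ) :
    trunc (coord (gen a k) φ) m = coord (gen a m) (resTrans (stage_mono a h) φ) := by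
  ext i
  have : Subalgebra.inclusion (stage_mono a h) (gen a m i) = if i < m then gen a k i else 0 := by
    refine Subtype.ext ?_
    by_cases hi : i < m
    · simp [gen, trunc, hi, hi.trans_le h]
    · simp [gen, trunc, hi]
  simp only [coord, resTrans, AlgHom.comp_apply, this, trunc]
  split_ifs <;> simp

lemma trunc_coord (a : ℕ → A) (m : ℕ) (φ : A →ₐ[ℝ] ℝ) :
    trunc (coord a φ) m = coord (gen a m) (resMap (stage a m) φ) := by
  ext i
  by_cases hi : i < m <;> simp [coord, resMap, gen, trunc, hi]

lemma continuous_trunc (m : ℕ) : Continuous fun x : ℕ → ℝ => trunc x m := by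
  refine continuous_pi fun i => ?_
  unfold trunc
  split_ifs
  · exact continuous_apply i
  · exact continuous_const

lemma eval_trunc_coord (a : ℕ → A) {m : ℕ} {x : ℕ → ℝ} {φ : stage a m →ₐ[ℝ] ℝ}
    (h : coord (gen a m) φ = trunc x m) (p : MvPolynomial ℕ ℝ) :
    MvPolynomial.eval (trunc x m) p = φ (MvPolynomial.aeval (gen a m) p) := by
  rw [← h, eval_coord]

/-- A sequence all of whose truncations come from compatible sets of characters consists of the
coordinates of a character of the whole algebra. -/
lemma exists_coord_eq {a : ℕ → A}
    (ha : Function.Surjective (MvPolynomial.aeval a : MvPolynomial ℕ ℝ →ₐ[ℝ] A))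
    {K : ∀ S : Subalgebra ℝ A, Set (S →ₐ[ℝ] ℝ)}
    (hK : ∀ (S T : Subalgebra ℝ A), S.FG → T.FG → ∀ h : S ≤ T, resTrans h '' K T ⊆ K S)
    {x : ℕ → ℝ} (hx : ∀ m, trunc x m ∈ coord (gen a m) '' K (stage a m)) :
    ∃ φ ∈ ⋂ S ∈ {S : Subalgebra ℝ A | S.FG}, resMap S ⁻¹' K S, coord a φ = x := by
  have hrange : x ∈ Set.range (coord a) := by
    rw [range_coord ha]
    intro p hp
    obtain ⟨m, h1, h2⟩ :=
      ((eventually_aeval_trunc a p).and (eventually_aeval_trunc x p)).exists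
    obtain ⟨φ, -, hφ⟩ := hx m
    have h0 : MvPolynomial.aeval (gen a m) p = 0 :=
      Subtype.ext (by rw [coe_aeval_gen, h1, hp]; rfl)
    have h3 := eval_trunc_coord a hφ p
    rw [h0, map_zero] at h3
    exact h2.symm.trans h3
  obtain ⟨φ, rfl⟩ := hrange
  refine ⟨φ, Set.mem_iInter₂.2 fun S hS => ?_, rfl⟩
  obtain ⟨m, hm⟩ := exists_le_stage ha hS
  obtain ⟨ψ, hψ, hψφ⟩ := hx m
  rw [trunc_coord] at hψφ
  have hψ' := (isClosedEmbedding_coord (aeval_gen_surjective a m)).injective hψφ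
  exact hK S (stage a m) hS (stage_fg a m) hm ⟨ψ, hψ, by rw [hψ']; rfl⟩

end Stages

section Representing

variable {B : Type*} [CommRing B] [Algebra ℝ B] {L : B →ₗ[ℝ] ℝ} {K : Set (B →ₐ[ℝ] ℝ)}
  {μ : Measure (B →ₐ[ℝ] ℝ)}

lemma IsRepr.isFiniteMeasure (h : IsRepr L K μ) : IsFiniteMeasure μ := by
  have := (h.2.2 1).1
  simp only [map_one] at this
  exact (integrable_const_iff_isFiniteMeasure one_ne_zero).1 this

lemma IsRepr.isProbabilityMeasure (h : IsRepr L K μ) (hL : L 1 = 1) : IsProbabilityMeasure μ := by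
  have := h.isFiniteMeasure
  have h1 := (h.2.2 1).2
  simp only [map_one, hL, integral_const, smul_eq_mul, mul_one] at h1
  exact isProbabilityMeasure_iff_real.2 h1.symm

end Representing

section Extension

variable {A : Type*} [CommRing A] [Algebra ℝ A]

lemma continuous_resMap (S : Subalgebra ℝ A) : Continuous (resMap S) :=
  continuous_induced_rng.2 (continuous_pi fun x => continuous_eval (x : A))

/-- A representing measure restricts to every finitely generated subalgebra. -/
lemma IsRepr.map_resMap {L : A →ₗ[ℝ] ℝ} {K : ∀ S : Subalgebra ℝ A, Set (S →ₐ[ℝ] ℝ)}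
    {ν : Measure (A →ₐ[ℝ] ℝ)}
    (hν : IsRepr L (⋂ S ∈ {S : Subalgebra ℝ A | S.FG}, resMap S ⁻¹' K S) ν)
    {S : Subalgebra ℝ A} (hS : S.FG) (hK : IsClosed (K S)) :
    IsRepr (resL L S) (K S) (ν.map (resMap S)) := by
  have := hν.isFiniteMeasure
  have hc := continuous_resMap S
  have := hν.1.2
  have hfin : IsFiniteMeasure (ν.map (resMap S)) := Measure.isFiniteMeasure_map ν (resMap S)
  refine ⟨⟨IsFiniteMeasure.toIsLocallyFiniteMeasure _,
    Measure.InnerRegular.map_of_continuous hc⟩, ?_, fun b => ?_⟩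
  · rw [Measure.map_apply hc.measurable hK.measurableSet.compl]
    refine measure_mono_null ?_ hν.2.1
    exact fun φ hφ hφ' => hφ (Set.mem_iInter₂.1 hφ' S hS)
  · have hb := (continuous_eval b).aestronglyMeasurable (μ := ν.map (resMap S))
    rw [integrable_map_measure hb hc.aemeasurable, integral_map hc.aemeasurable hb]
    exact hν.2.2 b

/-- Representing measures on the stages, transported to `ℕ → ℝ`, have a limit with the moments
prescribed by `L` and carried by every closed set which eventually carries the stages. -/
lemma exists_limit {L : A →ₗ[ℝ] ℝ} (hL1 : L 1 = 1)
    {K : ∀ S : Subalgebra ℝ A, Set (S →ₐ[ℝ] ℝ)} (a : ℕ → A)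
    {μ : ∀ k, Measure (stage a k →ₐ[ℝ] ℝ)}
    (hμ : ∀ k, IsRepr (resL L (stage a k)) (K (stage a k)) (μ k)) :
    ∃ ρ : ProbabilityMeasure (ℕ → ℝ),
      (∀ p : MvPolynomial ℕ ℝ,
        Integrable (fun x => MvPolynomial.eval x p) (ρ : Measure (ℕ → ℝ)) ∧
        ∫ x, MvPolynomial.eval x p ∂(ρ : Measure (ℕ → ℝ)) = L (MvPolynomial.aeval a p)) ∧
      ∀ F : Set (ℕ → ℝ), IsClosed F →
        (∀ᶠ k in Filter.atTop, ∀ φ ∈ K (stage a k), coord (gen a k) φ ∈ F) →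
        (ρ : Measure (ℕ → ℝ)) Fᶜ = 0 := by
  have hprob (k : ℕ) : IsProbabilityMeasure (μ k) := (hμ k).isProbabilityMeasure hL1
  have hmeas (k : ℕ) : Measurable (coord (gen a k)) := (continuous_coord _).measurable
  let ρ (k : ℕ) : ProbabilityMeasure (ℕ → ℝ) :=
    ⟨(μ k).map (coord (gen a k)), Measure.isProbabilityMeasure_map (hmeas k).aemeasurable⟩
  have hmom (k : ℕ) (p : MvPolynomial ℕ ℝ) :
      Integrable (fun x => MvPolynomial.eval x p) (ρ k : Measure (ℕ → ℝ)) ∧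
      ∫ x, MvPolynomial.eval x p ∂(ρ k : Measure (ℕ → ℝ)) =
        L (MvPolynomial.aeval (trunc a k) p) := by
    have hp := (MvPolynomial.continuous_eval p).aestronglyMeasurable
      (μ := (μ k).map (coord (gen a k)))
    change Integrable _ ((μ k).map (coord (gen a k))) ∧
      ∫ x, MvPolynomial.eval x p ∂((μ k).map (coord (gen a k))) = _
    rw [integrable_map_measure hp (hmeas k).aemeasurable,
      integral_map (hmeas k).aemeasurable hp]
    have := (hμ k).2.2 (MvPolynomial.aeval (gen a k) p)
    simp only [Function.comp_def, eval_coord]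
    refine ⟨this.1, this.2.symm.trans ?_⟩
    rw [← coe_aeval_gen]
    rfl
  have htight : IsTightMeasureSet {((μ : ProbabilityMeasure (ℕ → ℝ)) : Measure (ℕ → ℝ)) |
      μ ∈ Set.range ρ} := by
    have hsq (k i : ℕ) := hmom k (MvPolynomial.X i ^ 2)
    simp only [map_pow, MvPolynomial.eval_X, MvPolynomial.aeval_X] at hsq
    refine isTightMeasureSet_of_sq_moment_le (fun i => |L (a i ^ 2)|) (fun k i => (hsq k i).1)
      fun k i => (hsq k i).2.trans_le ?_
    by_cases h : i < k
    · simpa [trunc, h] using le_abs_self _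
    · simp [trunc, h]
  obtain ⟨ρ', -, hρ'⟩ := (isCompact_closure_of_isTightMeasureSet htight).ultrafilter_le_nhds
    ((Filter.hyperfilter ℕ).map ρ) (by
      rw [Filter.le_principal_iff]
      exact Filter.mem_of_superset (Filter.range_mem_map) subset_closure)
  have hl : (Filter.hyperfilter ℕ : Filter ℕ) ≤ Filter.atTop := by
    rw [← Nat.cofinite_eq_atTop]
    exact Filter.hyperfilter_le_cofinite
  have hlim : Filter.Tendsto ρ (Filter.hyperfilter ℕ : Filter ℕ) (nhds ρ') := hρ'
  refine ⟨ρ', fun p => ?_, fun F hF hFK => ?_⟩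
  · refine integral_eq_of_tendsto (C := L (MvPolynomial.aeval a (p ^ 2))) hlim
      (MvPolynomial.continuous_eval p) ?_
    filter_upwards [hl (eventually_aeval_trunc a p), hl (eventually_aeval_trunc a (p ^ 2))]
      with k h1 h2
    have hsq := hmom k (p ^ 2)
    simp only [h2] at hsq
    simp only [map_pow (MvPolynomial.eval _)] at hsq
    exact ⟨(hmom k p).1, hsq.1, (hmom k p).2.trans (by rw [h1]), hsq.2.le⟩
  · rw [prob_compl_eq_zero_iff hF.measurableSet]
    refine le_antisymm prob_le_one ?_
    refine le_trans ?_ (ProbabilityMeasure.limsup_measure_closed_le_of_tendsto hlim hF)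
    refine le_trans (Filter.limsup_const (1 : ℝ≥0∞)).ge (Filter.limsup_le_limsup ?_)
    filter_upwards [hl hFK] with k hk
    have : (ρ k : Measure (ℕ → ℝ)) Fᶜ = 0 := by
      change ((μ k).map (coord (gen a k))) Fᶜ = 0
      rw [Measure.map_apply (hmeas k) hF.measurableSet.compl]
      exact measure_mono_null (fun φ hφ hφ' => hφ (hk φ hφ')) (hμ k).2.1
    exact ((prob_compl_eq_zero_iff hF.measurableSet).1 this).ge

/-- Representing measures on all finitely generated subalgebras yield a global one. -/
lemma exists_isRepr {a : ℕ → A}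
    (ha : Function.Surjective (MvPolynomial.aeval a : MvPolynomial ℕ ℝ →ₐ[ℝ] A))
    {L : A →ₗ[ℝ] ℝ} (hL1 : L 1 = 1) {K : ∀ S : Subalgebra ℝ A, Set (S →ₐ[ℝ] ℝ)}
    (hKclosed : ∀ S : Subalgebra ℝ A, S.FG → IsClosed (K S))
    (hKcompat : ∀ (S T : Subalgebra ℝ A), S.FG → T.FG → ∀ h : S ≤ T, resTrans h '' K T ⊆ K S)
    (h : ∀ S : Subalgebra ℝ A, S.FG →
      ∃ μS : Measure (S →ₐ[ℝ] ℝ), IsRepr (resL L S) (K S) μS) :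
    ∃ ν : Measure (A →ₐ[ℝ] ℝ),
      IsRepr L (⋂ S ∈ {S : Subalgebra ℝ A | S.FG}, resMap S ⁻¹' K S) ν := by
  choose μ hμ using fun k => h (stage a k) (stage_fg a k)
  obtain ⟨ρ, hmom, hsupp⟩ := exists_limit hL1 a hμ
  have hemb := isClosedEmbedding_coord ha
  have hmemb := hemb.measurableEmbedding
  let F (m : ℕ) : Set (ℕ → ℝ) :=
    (fun x => trunc x m) ⁻¹' (coord (gen a m) '' K (stage a m))
  have hnull : (ρ : Measure (ℕ → ℝ)) (⋃ m, (F m)ᶜ) = 0 := by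
    refine measure_iUnion_null fun m => hsupp (F m) ?_ ?_
    · exact (((isClosedEmbedding_coord (aeval_gen_surjective a m)).isClosedMap _
        (hKclosed _ (stage_fg a m))).preimage (continuous_trunc m))
    · filter_upwards [Filter.eventually_ge_atTop m] with k hk φ hφ
      refine ⟨resTrans (stage_mono a hk) φ, ?_, (trunc_coord_gen a hk φ).symm⟩
      exact hKcompat _ _ (stage_fg a m) (stage_fg a k) _ ⟨φ, hφ, rfl⟩
  have hmem {x : ℕ → ℝ} (hx : x ∉ ⋃ m, (F m)ᶜ) := exists_coord_eq ha hKcompat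
    fun m => not_not.1 fun hm => hx (Set.mem_iUnion.2 ⟨m, hm⟩)
  have hmap : ((ρ : Measure (ℕ → ℝ)).comap (coord a)).map (coord a) = ρ := by
    rw [hmemb.map_comap]
    refine Measure.restrict_eq_self_of_ae_mem ?_
    refine measure_mono_null (fun x hx => ?_) hnull
    by_contra hx'
    obtain ⟨φ, -, hφ⟩ := hmem hx'
    exact hx ⟨φ, hφ⟩
  have hfin : IsFiniteMeasure ((ρ : Measure (ℕ → ℝ)).comap (coord a)) :=
    ⟨by rw [hmemb.comap_apply]; exact measure_lt_top _ _⟩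
  refine ⟨(ρ : Measure (ℕ → ℝ)).comap (coord a), isRadon_of_isClosedEmbedding hemb _, ?_,
    fun b => ?_⟩
  · rw [hmemb.comap_apply]
    refine measure_mono_null ?_ hnull
    rintro _ ⟨φ, hφ, rfl⟩
    by_contra hx'
    obtain ⟨φ', hφ', heq⟩ := hmem hx'
    exact hφ (hemb.injective heq ▸ hφ')
  · obtain ⟨p, rfl⟩ := ha b
    have hp := hmom p
    rw [← hmap, hmemb.integrable_map_iff, hmemb.integral_map] at hp
    simp only [Function.comp_def, eval_coord] at hp
    exact ⟨hp.1, hp.2.symm⟩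

end Extension

lemma exists_aeval_surjective {A : Type*} [CommRing A] [Algebra ℝ A] {s : Set A}
    (hs : s.Countable) (hA : Algebra.adjoin ℝ s = ⊤) :
    ∃ a : ℕ → A, Function.Surjective (MvPolynomial.aeval a : MvPolynomial ℕ ℝ →ₐ[ℝ] A) := by
  obtain ⟨a, ha⟩ := (hs.insert 0).exists_eq_range (Set.insert_nonempty 0 s)
  refine ⟨a, AlgHom.range_eq_top _ |>.1 ?_⟩
  rw [← Algebra.adjoin_range_eq_range_aeval, ← ha, eq_top_iff, ← hA]
  exact Algebra.adjoin_mono (Set.subset_insert 0 s)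

/-- For a countably generated algebra `A`, `L` has a representing Radon measure supported
in `⋂_{S ∈ I} π_S⁻¹(K S)` iff each `L|_S` has a `K S`-representing Radon measure. -/
theorem countably_generated_representing_iff
    (A : Type*) [CommRing A] [Algebra ℝ A] [Nonempty (A →ₐ[ℝ] ℝ)]
    (hA : ∃ s : Set A, s.Countable ∧ Algebra.adjoin ℝ s = (⊤ : Subalgebra ℝ A))
    (L : A →ₗ[ℝ] ℝ) (hL1 : L 1 = 1)
    (K : ∀ S : Subalgebra ℝ A, Set (↥S →ₐ[ℝ] ℝ))
    (hKclosed : ∀ S : Subalgebra ℝ A, S.FG → IsClosed (K S))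
    (hKcompat : ∀ (S T : Subalgebra ℝ A), S.FG → T.FG → ∀ h : S ≤ T,
      resTrans h '' K T ⊆ K S) :
    (∃ ν : Measure (A →ₐ[ℝ] ℝ),
        IsRepr L (⋂ S ∈ {S : Subalgebra ℝ A | S.FG}, resMap S ⁻¹' K S) ν) ↔
      (∀ S : Subalgebra ℝ A, S.FG →
        ∃ μS : Measure (↥S →ₐ[ℝ] ℝ), IsRepr (resL L S) (K S) μS) := by
  obtain ⟨s, hs, hsA⟩ := hA
  obtain ⟨a, ha⟩ := exists_aeval_surjective hs hsA
  exact ⟨fun ⟨ν, hν⟩ S hS => ⟨_, hν.map_resMap hS (hKclosed S hS)⟩,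
    exists_isRepr ha hL1 hKclosed hKcompat⟩

end Stmt12
end

section
/- Let A be a unital commutative real algebra with nonempty character space X(A), L : A → ℝ linear with L(1) = 1, I the set of all finitely generated unital subalgebras of A, and Λ the set of all countably generated unital subalgebras of A. For each S ∈ I let K^(S) ⊆ X(S) be closed with π_{S,T}(K^(T)) ⊆ K^(S) for all T ∈ I containing S. Then there exists an X(A)-representing measure μ for L on the cylinder σ-algebra Σ_I with μ(X(A) \ π_S⁻¹(K^(S))) = 0 for every S ∈ I, if and only if there exists an exact projective system {μ_S : S ∈ I} such that each μ_S is a K^(S)-representing Radon measure for L|_S and such that, for each T ∈ Λ, the unique Radon probability measure μ_T on X(T) with (π_{S,T})_# μ_T = μ_S for all S ∈ I with S ⊆ T is thick, i.e. μ_T(M) = 0 for every Borel M ⊆ X(T) with M ∩ π_T(X(A)) = ∅. -/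
open MeasureTheory
open scoped ENNReal

namespace Stmt13

/-- The weak topology on the character space `B →ₐ[ℝ] ℝ`. -/
instance charTopology (B : Type*) [CommRing B] [Algebra ℝ B] :
    TopologicalSpace (B →ₐ[ℝ] ℝ) :=
  TopologicalSpace.induced (fun φ : B →ₐ[ℝ] ℝ => (φ : B → ℝ)) inferInstance

/-- The Borel σ-algebra of the weak topology on the character space. -/
instance charMeasurableSpace (B : Type*) [CommRing B] [Algebra ℝ B] :
    MeasurableSpace (B →ₐ[ℝ] ℝ) := borel _

instance charBorelSpace (B : Type*) [CommRing B] [Algebra ℝ B] :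
    BorelSpace (B →ₐ[ℝ] ℝ) := ⟨rfl⟩

/-- The restriction map `π_S : X(A) → X(S)` for a subalgebra `S` of `A`. -/
def resMap {A : Type*} [CommRing A] [Algebra ℝ A] (S : Subalgebra ℝ A) :
    (A →ₐ[ℝ] ℝ) → (S →ₐ[ℝ] ℝ) := fun φ => φ.comp S.val

/-- The restriction map `π_{S,T} : X(T) → X(S)` for subalgebras `S ≤ T` of `A`. -/
def resTrans {A : Type*} [CommRing A] [Algebra ℝ A] {S T : Subalgebra ℝ A} (h : S ≤ T) :
    (T →ₐ[ℝ] ℝ) → (S →ₐ[ℝ] ℝ) := fun φ => φ.comp (Subalgebra.inclusion h)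

/-- The restriction `L|_S` of a linear functional `L : A → ℝ` to a subalgebra `S`. -/
def resL {A : Type*} [CommRing A] [Algebra ℝ A] (L : A →ₗ[ℝ] ℝ) (S : Subalgebra ℝ A) :
    (↥S) →ₗ[ℝ] ℝ := L.comp (Subalgebra.val S).toLinearMap

/-- A Radon measure: locally finite and inner regular w.r.t. compact sets. -/
def IsRadon {α : Type*} [TopologicalSpace α] [MeasurableSpace α] (μ : Measure α) : Prop :=
  IsLocallyFiniteMeasure μ ∧ μ.InnerRegular

/-- `μ` is a `K`-representing Radon measure for the linear functional `L` on `B`. -/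
def IsRepr {B : Type*} [CommRing B] [Algebra ℝ B] (L : B →ₗ[ℝ] ℝ)
    (K : Set (B →ₐ[ℝ] ℝ)) (μ : Measure (B →ₐ[ℝ] ℝ)) : Prop :=
  IsRadon μ ∧ μ Kᶜ = 0 ∧
    ∀ b : B, Integrable (fun φ : B →ₐ[ℝ] ℝ => φ b) μ ∧
      L b = ∫ φ : B →ₐ[ℝ] ℝ, φ b ∂μ

/-- Prokhorov's condition for a family of measures indexed by the finitely generated
subalgebras of `A`. -/
def Prokh {A : Type*} [CommRing A] [Algebra ℝ A]
    (μf : ∀ S : Subalgebra ℝ A, Measure (↥S →ₐ[ℝ] ℝ)) : Prop :=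
  ∀ ε : ℝ≥0∞, 0 < ε → ∃ C : Set (A →ₐ[ℝ] ℝ), IsCompact C ∧
    ∀ S : Subalgebra ℝ A, S.FG → 1 - ε ≤ μf S (resMap S '' C)


/-- The cylinder σ-algebra `Σ_I` on `X(A)`: the smallest σ-algebra making the restriction
map to every finitely generated subalgebra measurable. -/
def cylSigma (A : Type*) [CommRing A] [Algebra ℝ A] : MeasurableSpace (A →ₐ[ℝ] ℝ) :=
  ⨆ S ∈ {S : Subalgebra ℝ A | S.FG},
    MeasurableSpace.comap (resMap S) (charMeasurableSpace ↥S)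

section Extension

variable {Ω ι : Type*} {X : ι → Type*} [∀ i, MeasurableSpace (X i)]
  {f : ∀ i, Ω → X i} {ν : ∀ i, Measure (X i)}

/-- The measure `ν k` of a set pulled back from `X i` only depends on its preimage in `Ω`. -/
theorem measure_eq_of_preimage_eq
    (hdir : ∀ c : ℕ → ι, ∃ j, ∀ n, ∃ p : X j → X (c n),
      Measurable p ∧ p ∘ f j = f (c n) ∧ (ν j).map p = ν (c n))
    (hthick : ∀ i B, MeasurableSet B → B ∩ Set.range (f i) = ∅ → ν i B = 0)
    {i j : ι} {B : Set (X i)} {C : Set (X j)} (hB : MeasurableSet B) (hC : MeasurableSet C)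
    (h : f i ⁻¹' B = f j ⁻¹' C) : ν i B = ν j C := by
  obtain ⟨k, hk⟩ := hdir (fun n => Nat.casesOn n i fun _ => j)
  obtain ⟨(p : X k → X i), hp, (hpf : p ∘ f k = f i), (hpν : (ν k).map p = ν i)⟩ := hk 0
  obtain ⟨(q : X k → X j), hq, (hqf : q ∘ f k = f j), (hqν : (ν k).map q = ν j)⟩ := hk 1
  have hmem : ∀ ω, p (f k ω) ∈ B ↔ q (f k ω) ∈ C := fun ω => by
    have h1 : p (f k ω) = f i ω := congrFun hpf ω
    have h2 : q (f k ω) = f j ω := congrFun hqf ω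
    rw [h1, h2]
    exact Set.ext_iff.1 h ω
  replace hp : Measurable p := hp
  replace hq : Measurable q := hq
  rw [← hpν, ← hqν, Measure.map_apply hp hB, Measure.map_apply hq hC]
  refine measure_congr (ae_eq_set.2 ⟨?_, ?_⟩)
  · refine hthick k _ ((hp hB).diff (hq hC)) ?_
    rw [Set.eq_empty_iff_forall_notMem]
    rintro _ ⟨⟨h1, h2⟩, ω, rfl⟩
    exact h2 ((hmem ω).1 h1)
  · refine hthick k _ ((hq hC).diff (hp hB)) ?_
    rw [Set.eq_empty_iff_forall_notMem]
    rintro _ ⟨⟨h1, h2⟩, ω, rfl⟩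
    exact h2 ((hmem ω).2 h1)

/-- A countably directed projective system of thick measures extends to the σ-algebra of
cylinder sets. -/
theorem exists_measure_map_eq [MeasurableSpace Ω]
    (hf : ∀ i, Measurable (f i))
    (hgen : ∀ E : Set Ω, MeasurableSet E → ∃ i B, MeasurableSet B ∧ f i ⁻¹' B = E)
    (hdir : ∀ c : ℕ → ι, ∃ j, ∀ n, ∃ p : X j → X (c n),
      Measurable p ∧ p ∘ f j = f (c n) ∧ (ν j).map p = ν (c n))
    (hthick : ∀ i B, MeasurableSet B → B ∩ Set.range (f i) = ∅ → ν i B = 0) :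
    ∃ μ : Measure Ω, ∀ i, μ.map (f i) = ν i := by
  choose i B hB hBE using hgen
  have key : ∀ (E : Set Ω) (hE : MeasurableSet E) (j : ι) (C : Set (X j)), MeasurableSet C →
      f j ⁻¹' C = E → ν (i E hE) (B E hE) = ν j C := fun E hE j C hC h =>
    measure_eq_of_preimage_eq hdir hthick (hB E hE) hC ((hBE E hE).trans h.symm)
  refine ⟨Measure.ofMeasurable (fun E hE => ν (i E hE) (B E hE)) ?_ ?_, fun j => ?_⟩
  · rw [key ∅ _ (i ∅ .empty) ∅ .empty rfl, measure_empty]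
  · intro E hE hdisj
    obtain ⟨j, hj⟩ := hdir (fun n => i (E n) (hE n))
    choose p hp hpf hpν using hj
    have hpre : ∀ n, f j ⁻¹' (p n ⁻¹' B (E n) (hE n)) = E n := fun n => by
      rw [← Set.preimage_comp, hpf, hBE]
    have hmeas : ∀ n, MeasurableSet (p n ⁻¹' B (E n) (hE n)) := fun n => hp n (hB _ _)
    rw [key _ _ j (⋃ n, p n ⁻¹' B (E n) (hE n)) (.iUnion hmeas)
      (by simp only [Set.preimage_iUnion, hpre]), measure_iUnion₀ _
      (fun n => (hmeas n).nullMeasurableSet)]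
    · exact tsum_congr fun n => (key _ _ j _ (hmeas n) (hpre n)).symm
    · intro m n hmn
      refine hthick j _ ((hmeas m).inter (hmeas n)) ?_
      rw [Set.eq_empty_iff_forall_notMem]
      rintro _ ⟨⟨h1, h2⟩, ω, rfl⟩
      have h1' : ω ∈ E m := by rw [← hpre m]; exact h1
      have h2' : ω ∈ E n := by rw [← hpre n]; exact h2
      exact Set.disjoint_left.1 (hdisj hmn) h1' h2'
  · ext C hC
    rw [Measure.map_apply (hf j) hC, Measure.ofMeasurable_apply _ (hf j hC)]
    exact key _ _ j C hC rfl

end Extension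

section Characters

variable {B : Type*} [CommRing B] [Algebra ℝ B]

theorem continuous_eval (b : B) : Continuous fun φ : B →ₐ[ℝ] ℝ => φ b :=
  (continuous_apply b).comp continuous_induced_dom

theorem continuous_of_eval {Y : Type*} [TopologicalSpace Y] {g : Y → B →ₐ[ℝ] ℝ}
    (h : ∀ b, Continuous fun y => g y b) : Continuous g :=
  continuous_induced_rng.2 (continuous_pi h)

/-- A character is determined by its values on a generating family, and the resulting map into
a product of lines is a closed embedding. -/
theorem isClosedEmbedding_eval {σ : Type*} {g : σ → B}
    (hg : Algebra.adjoin ℝ (Set.range g) = ⊤) :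
    Topology.IsClosedEmbedding fun (φ : B →ₐ[ℝ] ℝ) (i : σ) => φ (g i) := by
  have hsurj : Function.Surjective (MvPolynomial.aeval (R := ℝ) g) := by
    rw [← AlgHom.range_eq_top, ← Algebra.adjoin_range_eq_range_aeval, hg]
  have heval : ∀ (φ : B →ₐ[ℝ] ℝ) (p : MvPolynomial σ ℝ),
      φ (MvPolynomial.aeval g p) = MvPolynomial.eval (fun i => φ (g i)) p := fun φ p => by
    exact MvPolynomial.comp_aeval_apply (f := g) φ p
  refine ⟨⟨⟨le_antisymm ?_ ?_⟩, fun φ ψ h => ?_⟩, ?_⟩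
  · exact continuous_iff_le_induced.1 (continuous_pi fun i => continuous_eval (g i))
  · let t : TopologicalSpace (B →ₐ[ℝ] ℝ) :=
      TopologicalSpace.induced (fun φ (i : σ) => φ (g i)) inferInstance
    refine continuous_iff_le_induced.1 (continuous_pi fun b => ?_)
    obtain ⟨p, rfl⟩ := hsurj b
    simp only [heval]
    exact (MvPolynomial.continuous_eval p).comp continuous_induced_dom
  · ext b
    obtain ⟨p, rfl⟩ := hsurj b
    rw [heval, heval]
    exact congrArg (fun x => MvPolynomial.eval x p) h
  · have hrange : Set.range (fun (φ : B →ₐ[ℝ] ℝ) (i : σ) => φ (g i)) =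
        ⋂ p ∈ {p : MvPolynomial σ ℝ | MvPolynomial.aeval g p = 0},
          {x | MvPolynomial.eval x p = 0} := by
      ext x
      simp only [Set.mem_range, Set.mem_iInter, Set.mem_ofPred_eq]
      constructor
      · rintro ⟨φ, rfl⟩ p hp
        rw [← heval, hp, map_zero]
      · intro hx
        refine ⟨AlgHom.liftOfSurjective (MvPolynomial.aeval g) hsurj (MvPolynomial.aeval x)
          fun p hp => ?_, ?_⟩
        · exact hx p hp
        · funext i
          have := AlgHom.liftOfSurjective_apply (MvPolynomial.aeval g) hsurj
            (MvPolynomial.aeval x) (fun p hp => hx p hp) (MvPolynomial.X i)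
          simpa using this
    rw [hrange]
    exact isClosed_biInter fun p _ =>
      isClosed_eq (MvPolynomial.continuous_eval p) continuous_const

end Characters

section Restriction

variable {A : Type*} [CommRing A] [Algebra ℝ A]

/-- A subalgebra generated by a countable set. -/
def CountablyGenerated (T : Subalgebra ℝ A) : Prop :=
  ∃ s : Set A, s.Countable ∧ Algebra.adjoin ℝ s = T

theorem CountablyGenerated.of_fg {T : Subalgebra ℝ A} (h : T.FG) : CountablyGenerated T := by
  obtain ⟨t, ht⟩ := h
  exact ⟨t, t.countable_toSet, ht⟩

theorem CountablyGenerated.iSup {T : ℕ → Subalgebra ℝ A}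
    (h : ∀ n, CountablyGenerated (T n)) : CountablyGenerated (⨆ n, T n) := by
  choose s hs hsT using h
  exact ⟨⋃ n, s n, Set.countable_iUnion hs, by rw [Algebra.adjoin_iUnion]; simp only [hsT]⟩

theorem CountablyGenerated.exists_generators {T : Subalgebra ℝ A} (h : CountablyGenerated T) :
    ∃ t : Set T, t.Countable ∧ Algebra.adjoin ℝ (Set.range ((↑) : t → T)) = ⊤ := by
  obtain ⟨s, hs, rfl⟩ := h
  refine ⟨(↑) ⁻¹' s, hs.preimage Subtype.val_injective, ?_⟩
  rw [Subtype.range_coe]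
  exact Algebra.adjoin_adjoin_coe_preimage

theorem CountablyGenerated.polishSpace {T : Subalgebra ℝ A} (h : CountablyGenerated T) :
    PolishSpace (T →ₐ[ℝ] ℝ) := by
  obtain ⟨t, ht, htop⟩ := h.exists_generators
  have := ht.to_subtype
  exact (isClosedEmbedding_eval htop).polishSpace

theorem CountablyGenerated.isRadon {T : Subalgebra ℝ A} (h : CountablyGenerated T)
    (μ : Measure (T →ₐ[ℝ] ℝ)) [IsFiniteMeasure μ] : IsRadon μ := by
  have := h.polishSpace
  exact ⟨IsFiniteMeasure.toIsLocallyFiniteMeasure μ, inferInstance⟩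

theorem CountablyGenerated.measurable_of_eval {Ω : Type*} [MeasurableSpace Ω]
    {T : Subalgebra ℝ A} (h : CountablyGenerated T) {g : Ω → T →ₐ[ℝ] ℝ}
    (hg : ∀ b, Measurable fun ω => g ω b) : Measurable g := by
  obtain ⟨t, ht, htop⟩ := h.exists_generators
  have := ht.to_subtype
  exact (isClosedEmbedding_eval htop).measurableEmbedding.measurable_comp_iff.1
    (measurable_pi_lambda _ fun i => hg i)

theorem measurable_resTrans {S T : Subalgebra ℝ A} (h : S ≤ T) : Measurable (resTrans h) :=
  (continuous_of_eval fun b => continuous_eval (Subalgebra.inclusion h b)).measurable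

theorem fg_adjoin_singleton (a : A) : (Algebra.adjoin ℝ {a}).FG :=
  ⟨{a}, by rw [Finset.coe_singleton]⟩

theorem measurable_resMap_of_fg {S : Subalgebra ℝ A} (h : S.FG) :
    Measurable[cylSigma A] (resMap S) :=
  Measurable.of_comap_le (le_iSup₂_of_le S h le_rfl)

theorem measurable_eval_cylSigma (a : A) :
    Measurable[cylSigma A] fun φ : A →ₐ[ℝ] ℝ => φ a :=
  (continuous_eval (⟨a, Algebra.self_mem_adjoin_singleton ℝ a⟩ :
    Algebra.adjoin ℝ {a})).measurable.comp (measurable_resMap_of_fg (fg_adjoin_singleton a))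

theorem CountablyGenerated.measurable_resMap {T : Subalgebra ℝ A} (h : CountablyGenerated T) :
    Measurable[cylSigma A] (resMap T) :=
  @CountablyGenerated.measurable_of_eval A _ _ _ (cylSigma A) T h _
    fun b => measurable_eval_cylSigma (b : A)

/-- Every set in the cylinder σ-algebra comes from a countably generated subalgebra. -/
theorem exists_preimage_eq_of_cylSigma {E : Set (A →ₐ[ℝ] ℝ)} (hE : MeasurableSet[cylSigma A] E) :
    ∃ T : {T : Subalgebra ℝ A // CountablyGenerated T}, ∃ B : Set (T.1 →ₐ[ℝ] ℝ),
      MeasurableSet B ∧ resMap T.1 ⁻¹' B = E := by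
  let m : MeasurableSpace (A →ₐ[ℝ] ℝ) :=
    { MeasurableSet' := fun E => ∃ T : {T : Subalgebra ℝ A // CountablyGenerated T},
        ∃ B : Set (T.1 →ₐ[ℝ] ℝ), MeasurableSet B ∧ resMap T.1 ⁻¹' B = E
      measurableSet_empty := ⟨⟨⊥, .of_fg Subalgebra.fg_bot⟩, ∅, .empty, rfl⟩
      measurableSet_compl := by
        rintro _ ⟨T, B, hB, rfl⟩
        exact ⟨T, Bᶜ, hB.compl, rfl⟩
      measurableSet_iUnion := by
        intro E hE
        choose T B hB hBE using hE
        refine ⟨⟨⨆ n, (T n).1, .iSup fun n => (T n).2⟩,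
          ⋃ n, resTrans (le_iSup (fun n => (T n).1) n) ⁻¹' B n,
          .iUnion fun n => measurable_resTrans _ (hB n), ?_⟩
        rw [Set.preimage_iUnion]
        exact Set.iUnion_congr hBE }
  have hle : cylSigma A ≤ m := iSup₂_le fun S hS => by
    rintro _ ⟨B, hB, rfl⟩
    exact ⟨⟨S, .of_fg hS⟩, B, hB, rfl⟩
  exact hle E hE

/-- A finite measure on the characters of a countably generated subalgebra is determined by its
images on the finitely generated subalgebras. -/
theorem CountablyGenerated.measure_ext {T : Subalgebra ℝ A} (h : CountablyGenerated T)
    {μ ν : Measure (T →ₐ[ℝ] ℝ)} [IsFiniteMeasure ν]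
    (hμν : ∀ S : Subalgebra ℝ A, S.FG → ∀ hS : S ≤ T, μ.map (resTrans hS) = ν.map (resTrans hS)) :
    μ = ν := by
  obtain ⟨t, ht, htop⟩ := h.exists_generators
  have := ht.to_subtype
  set e := fun (φ : T →ₐ[ℝ] ℝ) (i : t) => φ i
  have he : MeasurableEmbedding e := (isClosedEmbedding_eval htop).measurableEmbedding
  have hmap : μ.map e = ν.map e := by
    refine IsProjectiveLimit.unique (P := fun I => (ν.map e).map I.restrict)
      (fun I => ?_) fun I => rfl
    let S : Subalgebra ℝ A := Algebra.adjoin ℝ ((fun i : t => ((i : T) : A)) '' I)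
    have hS : S ≤ T := Algebra.adjoin_le (by rintro _ ⟨i, -, rfl⟩; exact (i : T).2)
    have hfg : S.FG := Subalgebra.fg_def.2 ⟨_, I.finite_toSet.image _, rfl⟩
    let g : (S →ₐ[ℝ] ℝ) → I → ℝ := fun φ i =>
      φ ⟨((i : t) : T), Algebra.subset_adjoin ⟨i, i.2, rfl⟩⟩
    have hg : Measurable g := measurable_pi_lambda _ fun i => (continuous_eval _).measurable
    have hcomp : I.restrict ∘ e = g ∘ resTrans hS := rfl
    have hI : Measurable (I.restrict (π := fun _ : t => ℝ)) := Finset.measurable_restrict I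
    beta_reduce
    rw [Measure.map_map hI he.measurable, Measure.map_map hI he.measurable, hcomp,
      ← Measure.map_map hg (measurable_resTrans hS), ← Measure.map_map hg (measurable_resTrans hS),
      hμν S hfg hS]
  rw [← he.comap_map μ, hmap, he.comap_map]

end Restriction

/-- There is an `X(A)`-representing measure for `L` on the cylinder σ-algebra `Σ_I`
supported in each `π_S⁻¹(K S)` iff there is an exact projective system of `K S`-representing
Radon measures for the `L|_S` whose induced measures `μ_T` on the countably generated
subalgebras `T` are thick. -/
theorem representing_on_cylinder_iff_exact_thick
    (A : Type*) [CommRing A] [Algebra ℝ A] [Nonempty (A →ₐ[ℝ] ℝ)]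
    (L : A →ₗ[ℝ] ℝ) (hL1 : L 1 = 1)
    (K : ∀ S : Subalgebra ℝ A, Set (↥S →ₐ[ℝ] ℝ))
    (hKclosed : ∀ S : Subalgebra ℝ A, S.FG → IsClosed (K S))
    (hKcompat : ∀ (S T : Subalgebra ℝ A), S.FG → T.FG → ∀ h : S ≤ T,
      resTrans h '' K T ⊆ K S) :
    (∃ μ : @Measure (A →ₐ[ℝ] ℝ) (cylSigma A),
        (∀ a : A, Integrable (fun φ : A →ₐ[ℝ] ℝ => φ a) μ ∧
          L a = ∫ φ : A →ₐ[ℝ] ℝ, φ a ∂μ) ∧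
        (∀ S : Subalgebra ℝ A, S.FG → μ ((resMap S ⁻¹' K S)ᶜ) = 0)) ↔
      (∃ μf : ∀ S : Subalgebra ℝ A, Measure (↥S →ₐ[ℝ] ℝ),
        (∀ S : Subalgebra ℝ A, S.FG → IsRepr (resL L S) (K S) (μf S)) ∧
        (∀ (S T : Subalgebra ℝ A), S.FG → T.FG → ∀ h : S ≤ T,
          (μf T).map (resTrans h) = μf S) ∧
        (∀ T : Subalgebra ℝ A, (∃ s : Set A, s.Countable ∧ Algebra.adjoin ℝ s = T) →
          ∃ μT : Measure (↥T →ₐ[ℝ] ℝ),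
            IsProbabilityMeasure μT ∧ IsRadon μT ∧
            (∀ S : Subalgebra ℝ A, S.FG → ∀ h : S ≤ T, μT.map (resTrans h) = μf S) ∧
            (∀ M : Set (↥T →ₐ[ℝ] ℝ), MeasurableSet M →
              M ∩ Set.range (resMap T) = ∅ → μT M = 0))) := by
  constructor
  · rintro ⟨μ, hμL, hμK⟩
    have hprob : @IsProbabilityMeasure _ (cylSigma A) μ := by
      obtain ⟨hint, h1⟩ := hμL 1
      simp only [map_one] at hint h1
      have hfin : @IsFiniteMeasure _ (cylSigma A) μ :=
        (integrable_const_iff_isFiniteMeasure one_ne_zero).1 hint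
      rw [hL1, integral_const, smul_eq_mul, mul_one] at h1
      exact ⟨by rw [← ENNReal.toReal_eq_one_iff]; exact h1.symm⟩
    have hmap : ∀ T : Subalgebra ℝ A, CountablyGenerated T →
        IsProbabilityMeasure (@Measure.map _ _ (cylSigma A) _ (resMap T) μ) := fun T hT =>
      @Measure.isProbabilityMeasure_map _ _ (cylSigma A) _ _ hprob _
        (@Measurable.aemeasurable _ _ (cylSigma A) _ _ _ hT.measurable_resMap)
    have hcomp : ∀ (S T : Subalgebra ℝ A), CountablyGenerated T → ∀ h : S ≤ T,
        (@Measure.map _ _ (cylSigma A) _ (resMap T) μ).map (resTrans h) =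
          @Measure.map _ _ (cylSigma A) _ (resMap S) μ := fun S T hT h =>
      Measure.map_map (measurable_resTrans h) hT.measurable_resMap
    refine ⟨fun S => @Measure.map _ _ (cylSigma A) _ (resMap S) μ, fun S hS => ?_,
      fun S T _ hT h => hcomp S T (CountablyGenerated.of_fg hT) h, fun T hT => ?_⟩
    · have hm := measurable_resMap_of_fg hS
      have := hmap S (CountablyGenerated.of_fg hS)
      refine ⟨CountablyGenerated.isRadon (.of_fg hS) _, ?_, fun b => ⟨?_, ?_⟩⟩
      · rw [Measure.map_apply hm (hKclosed S hS).measurableSet.compl]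
        exact hμK S hS
      · rw [integrable_map_measure (continuous_eval b).measurable.aestronglyMeasurable
          hm.aemeasurable]
        exact (hμL b).1
      · rw [integral_map hm.aemeasurable (continuous_eval b).measurable.aestronglyMeasurable]
        exact (hμL b).2
    · have := hmap T hT
      refine ⟨_, this, CountablyGenerated.isRadon hT _, fun S _ h => hcomp S T hT h,
        fun M hM hdisj => ?_⟩
      have hempty : resMap T ⁻¹' M = ∅ := by
        rw [Set.eq_empty_iff_forall_notMem] at hdisj ⊢
        exact fun φ hφ => hdisj _ ⟨hφ, φ, rfl⟩
      rw [Measure.map_apply (CountablyGenerated.measurable_resMap hT) hM, hempty, measure_empty]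
  · rintro ⟨μf, hrepr, -, hthick⟩
    choose! ν hνp _ hνmap hνthick using hthick
    have hνf : ∀ S : Subalgebra ℝ A, S.FG → ν S = μf S := fun S hS =>
      (Measure.map_id (μ := ν S)).symm.trans (hνmap S (CountablyGenerated.of_fg hS) S hS le_rfl)
    obtain ⟨μ, hμ⟩ := @exists_measure_map_eq (A →ₐ[ℝ] ℝ)
      {T : Subalgebra ℝ A // CountablyGenerated T} (fun T => T.1 →ₐ[ℝ] ℝ) _
      (fun T => resMap T.1) (fun T => ν T.1) (cylSigma A) (fun T => T.2.measurable_resMap)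
      (fun E hE => exists_preimage_eq_of_cylSigma hE)
      (fun c => by
        refine ⟨⟨⨆ n, (c n).1, .iSup fun n => (c n).2⟩, fun n =>
          ⟨resTrans (le_iSup (fun n => (c n).1) n), measurable_resTrans _, rfl, ?_⟩⟩
        have := hνp _ (c n).2
        refine (c n).2.measure_ext fun S hS h => ?_
        rw [Measure.map_map (measurable_resTrans _) (measurable_resTrans _)]
        exact (hνmap _ (CountablyGenerated.iSup fun n => (c n).2) S hS (h.trans (le_iSup (fun n => (c n).1) n))).trans
          (hνmap _ (c n).2 S hS h).symm)
      (fun T => hνthick T.1 T.2)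
    have hμf : ∀ S : Subalgebra ℝ A, S.FG →
        @Measure.map _ _ (cylSigma A) _ (resMap S) μ = μf S := fun S hS =>
      (hμ ⟨S, .of_fg hS⟩).trans (hνf S hS)
    refine ⟨μ, fun a => ?_, fun S hS => ?_⟩
    · have hfg := fg_adjoin_singleton a
      have hm := measurable_resMap_of_fg hfg
      let b : Algebra.adjoin ℝ {a} := ⟨a, Algebra.self_mem_adjoin_singleton ℝ a⟩
      obtain ⟨hint, heq⟩ := (hrepr _ hfg).2.2 b
      rw [← hμf _ hfg] at hint heq
      rw [integrable_map_measure (continuous_eval b).measurable.aestronglyMeasurable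
        hm.aemeasurable] at hint
      rw [integral_map hm.aemeasurable
        (continuous_eval b).measurable.aestronglyMeasurable] at heq
      exact ⟨hint, heq⟩
    · have := (hrepr S hS).2.1
      rwa [← hμf S hS, Measure.map_apply (measurable_resMap_of_fg hS)
        (hKclosed S hS).measurableSet.compl] at this

end Stmt13
end

section
/- Let A be a unital commutative real algebra with nonempty character space X(A), L : A → ℝ linear with L(1) = 1, and I the set of all finitely generated unital subalgebras of A. For each S ∈ I let K^(S) ⊆ X(S) be closed with π_{S,T}(K^(T)) ⊆ K^(S) for all T ∈ I containing S. Then there exists a (⋂_{S∈I} π_S⁻¹(K^(S)))-representing Radon measure ν for L on the Borel σ-algebra of X(A) if and only if there exists a family {μ_S : S ∈ I} such that each μ_S is a K^(S)-representing Radon measure for L|_S and {μ_S : S ∈ I} fulfills Prokhorov's condition: for every ε > 0 there exists a compact C_ε ⊆ X(A) with μ_S(π_S(C_ε)) ≥ 1 − ε for all S ∈ I. -/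
open MeasureTheory
open scoped ENNReal

namespace Stmt14

/-- The weak topology on the character space `B →ₐ[ℝ] ℝ`. -/
instance charTopology (B : Type*) [CommRing B] [Algebra ℝ B] :
    TopologicalSpace (B →ₐ[ℝ] ℝ) :=
  TopologicalSpace.induced (fun φ : B →ₐ[ℝ] ℝ => (φ : B → ℝ)) inferInstance

/-- The Borel σ-algebra of the weak topology on the character space. -/
instance charMeasurableSpace (B : Type*) [CommRing B] [Algebra ℝ B] :
    MeasurableSpace (B →ₐ[ℝ] ℝ) := borel _

instance charBorelSpace (B : Type*) [CommRing B] [Algebra ℝ B] :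
    BorelSpace (B →ₐ[ℝ] ℝ) := ⟨rfl⟩

/-- The restriction map `π_S : X(A) → X(S)` for a subalgebra `S` of `A`. -/
def resMap {A : Type*} [CommRing A] [Algebra ℝ A] (S : Subalgebra ℝ A) :
    (A →ₐ[ℝ] ℝ) → (S →ₐ[ℝ] ℝ) := fun φ => φ.comp S.val

/-- The restriction map `π_{S,T} : X(T) → X(S)` for subalgebras `S ≤ T` of `A`. -/
def resTrans {A : Type*} [CommRing A] [Algebra ℝ A] {S T : Subalgebra ℝ A} (h : S ≤ T) :
    (T →ₐ[ℝ] ℝ) → (S →ₐ[ℝ] ℝ) := fun φ => φ.comp (Subalgebra.inclusion h)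

/-- The restriction `L|_S` of a linear functional `L : A → ℝ` to a subalgebra `S`. -/
def resL {A : Type*} [CommRing A] [Algebra ℝ A] (L : A →ₗ[ℝ] ℝ) (S : Subalgebra ℝ A) :
    (↥S) →ₗ[ℝ] ℝ := L.comp (Subalgebra.val S).toLinearMap

/-- A Radon measure: locally finite and inner regular w.r.t. compact sets. -/
def IsRadon {α : Type*} [TopologicalSpace α] [MeasurableSpace α] (μ : Measure α) : Prop :=
  IsLocallyFiniteMeasure μ ∧ μ.InnerRegular

/-- `μ` is a `K`-representing Radon measure for the linear functional `L` on `B`. -/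
def IsRepr {B : Type*} [CommRing B] [Algebra ℝ B] (L : B →ₗ[ℝ] ℝ)
    (K : Set (B →ₐ[ℝ] ℝ)) (μ : Measure (B →ₐ[ℝ] ℝ)) : Prop :=
  IsRadon μ ∧ μ Kᶜ = 0 ∧
    ∀ b : B, Integrable (fun φ : B →ₐ[ℝ] ℝ => φ b) μ ∧
      L b = ∫ φ : B →ₐ[ℝ] ℝ, φ b ∂μ

/-- Prokhorov's condition for a family of measures indexed by the finitely generated
subalgebras of `A`. -/
def Prokh {A : Type*} [CommRing A] [Algebra ℝ A]
    (μf : ∀ S : Subalgebra ℝ A, Measure (↥S →ₐ[ℝ] ℝ)) : Prop :=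
  ∀ ε : ℝ≥0∞, 0 < ε → ∃ C : Set (A →ₐ[ℝ] ℝ), IsCompact C ∧
    ∀ S : Subalgebra ℝ A, S.FG → 1 - ε ≤ μf S (resMap S '' C)

section WeakLimits

open Filter Set Topology
open scoped NNReal BoundedContinuousFunction

variable {E : Type*} [TopologicalSpace E] [MeasurableSpace E] [BorelSpace E]

/-- A finite measure carried by a countable union of compact sets integrates bounded continuous
functions in the same way as some inner regular finite measure. -/
lemma exists_innerRegular_integral_eq [T2Space E] (μ : Measure E) [IsFiniteMeasure μ] {C : ℕ → Set E}
    (hC : ∀ n, IsCompact (C n)) (hμ : μ (⋃ n, C n)ᶜ = 0) :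
    ∃ ν : Measure E, ν.InnerRegular ∧ IsFiniteMeasure ν ∧
      ∀ g : E →ᵇ ℝ, ∫ x, g x ∂μ = ∫ x, g x ∂ν := by
  have hmeas : ∀ n, MeasurableSet (disjointed C n) :=
    fun n => MeasurableSet.disjointed (fun i => (hC i).measurableSet) n
  have key : ∀ n, ∃ ν : Measure E, ν.InnerRegular ∧ IsFiniteMeasure ν ∧ ν (C n)ᶜ = 0 ∧
      ∀ g : E →ᵇ ℝ, ∫ x, g x ∂(μ.restrict (disjointed C n)) = ∫ x, g x ∂ν := by
    intro n
    refine Measure.exists_innerRegular_eq_of_isCompact _ (hC n) ?_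
    rw [Measure.restrict_apply (hC n).measurableSet.compl]
    have : (C n)ᶜ ∩ disjointed C n = ∅ := by
      rw [← Set.disjoint_iff_inter_eq_empty]
      exact disjoint_compl_left.mono_right (disjointed_subset C n)
    simp [this]
  choose ν hreg hfin _ hint using key
  have hsum : μ = Measure.sum fun n => μ.restrict (disjointed C n) := by
    rw [← Measure.restrict_iUnion (disjoint_disjointed C) hmeas, iUnion_disjointed]
    exact (Measure.restrict_eq_self_of_ae_mem (mem_ae_iff.2 hμ)).symm
  have hmass : ∀ n, ν n univ = μ.restrict (disjointed C n) univ := by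
    intro n
    have h := hint n (BoundedContinuousFunction.const E 1)
    simp only [BoundedContinuousFunction.const_apply, integral_const, smul_eq_mul,
      mul_one] at h
    exact ((measureReal_eq_measureReal_iff).1 h).symm
  have hνfin : IsFiniteMeasure (Measure.sum ν) := by
    constructor
    rw [Measure.sum_apply _ MeasurableSet.univ]
    simp_rw [hmass]
    rw [← Measure.sum_apply _ MeasurableSet.univ, ← hsum]
    exact measure_lt_top μ _
  refine ⟨Measure.sum ν, inferInstance, hνfin, fun g => ?_⟩
  have h1 := hasSum_integral_measure (μ := fun n => μ.restrict (disjointed C n)) (f := g)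
    (by rw [← hsum]; exact g.integrable μ)
  rw [← hsum] at h1
  have h2 := hasSum_integral_measure (μ := ν) (f := g) (g.integrable _)
  simp_rw [hint] at h1
  exact h1.unique h2

/-- A uniformly tight net of probability measures has an inner regular weak limit along some
ultrafilter. -/
lemma exists_innerRegular_tendsto_of_tight [T2Space E] {ι : Type*} (F : Filter ι)
    [F.NeBot] (P : ι → Measure E) [∀ i, IsProbabilityMeasure (P i)]
    (hP : ∀ ε : ℝ≥0∞, 0 < ε → ∃ C : Set E, IsCompact C ∧ ∀ i, P i Cᶜ ≤ ε) :
    ∃ (U : Ultrafilter ι) (ν : Measure E), ↑U ≤ F ∧ ν.InnerRegular ∧ IsProbabilityMeasure ν ∧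
      ∀ g : E →ᵇ ℝ, Tendsto (fun i => ∫ x, g x ∂(P i)) U (𝓝 (∫ x, g x ∂ν)) := by
  obtain ⟨u, -, u_pos, u_lim⟩ :
      ∃ u : ℕ → ℝ≥0, StrictAnti u ∧ (∀ n, 0 < u n) ∧ Tendsto u atTop (𝓝 0) :=
    exists_seq_strictAnti_tendsto 0
  choose C hC hCP using fun n => hP (u n) (by exact_mod_cast u_pos n)
  have hcomp : IsCompact {μ : ProbabilityMeasure E | ∀ n, μ (accumulate C n)ᶜ ≤ u n} :=
    isCompact_setOfPred_probabilityMeasure_mass_eq_compl_isCompact_le u_lim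
      (isCompact_accumulate hC) (Or.inr monotone_accumulate)
  let Q : ι → ProbabilityMeasure E := fun i => ⟨P i, inferInstance⟩
  have hQ : ∀ i, Q i ∈ {μ : ProbabilityMeasure E | ∀ n, μ (accumulate C n)ᶜ ≤ u n} := by
    intro i n
    rw [← ENNReal.coe_le_coe, ProbabilityMeasure.ennreal_coeFn_eq_coeFn_toMeasure]
    exact (measure_mono (compl_subset_compl.2 subset_accumulate)).trans (hCP n i)
  obtain ⟨μ, hμ, hlim⟩ := hcomp.ultrafilter_le_nhds' ((Ultrafilter.of F).map Q)
    (by rw [Ultrafilter.mem_map]; exact Filter.Eventually.of_forall hQ)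
  have hμ0 : (μ : Measure E) (⋃ n, accumulate C n)ᶜ = 0 := by
    refine le_antisymm (ge_of_tendsto' (x := atTop) (f := fun n => (u n : ℝ≥0∞)) ?_ fun n => ?_)
      bot_le
    · simpa using ENNReal.tendsto_coe.2 u_lim
    · refine (measure_mono (compl_subset_compl.2 (subset_iUnion _ n))).trans ?_
      rw [← ProbabilityMeasure.ennreal_coeFn_eq_coeFn_toMeasure]
      exact ENNReal.coe_le_coe.2 (hμ n)
  obtain ⟨ν, hreg, hfin, hint⟩ := exists_innerRegular_integral_eq (μ : Measure E)
    (isCompact_accumulate hC) hμ0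
  refine ⟨Ultrafilter.of F, ν, Ultrafilter.of_le F, hreg, ?_, fun g => ?_⟩
  · rw [isProbabilityMeasure_iff_real]
    simpa using (hint (BoundedContinuousFunction.const E 1)).symm
  · rw [← hint g]
    have : Tendsto Q (Ultrafilter.of F) (𝓝 μ) := hlim
    exact ProbabilityMeasure.tendsto_iff_forall_integral_tendsto.1 this g

/-- Second moments bounded along a weakly convergent net yield integrability in the limit and
convergence of first moments. -/
lemma integrable_and_tendsto_integral_of_sq_le {ι : Type*} {F : Filter ι} [F.NeBot]
    {P : ι → Measure E} [∀ i, IsProbabilityMeasure (P i)] {ν : Measure E}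
    [IsProbabilityMeasure ν]
    (hlim : ∀ g : E →ᵇ ℝ, Tendsto (fun i => ∫ x, g x ∂(P i)) F (𝓝 (∫ x, g x ∂ν)))
    {h : E → ℝ} (hh : Continuous h) {c M : ℝ}
    (hP : ∀ᶠ i in F, Integrable h (P i) ∧ Integrable (fun x => h x ^ 2) (P i) ∧
      ∫ x, h x ∂(P i) = c ∧ ∫ x, h x ^ 2 ∂(P i) ≤ M) :
    Integrable h ν ∧ ∫ x, h x ∂ν = c := by
  let k : ℕ → ℝ → ℝ := fun n t => t / (1 + ((n : ℝ) + 1)⁻¹ * |t|)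
  have hδ : ∀ n : ℕ, 0 < ((n : ℝ) + 1)⁻¹ := fun n => by positivity
  have hden : ∀ (n : ℕ) (t : ℝ), 1 ≤ 1 + ((n : ℝ) + 1)⁻¹ * |t| := fun n t => by
    have := mul_nonneg (hδ n).le (abs_nonneg t); linarith
  have hkc : ∀ n, Continuous (k n) := fun n =>
    continuous_id.div (by fun_prop) fun t => (zero_lt_one.trans_le (hden n t)).ne'
  have hkle : ∀ n t, |k n t| ≤ |t| := fun n t => by
    simp only [k]
    rw [abs_div, abs_of_pos (zero_lt_one.trans_le (hden n t))]
    exact div_le_self (abs_nonneg t) (hden n t)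
  have hkbd : ∀ n t, |k n t| ≤ (n : ℝ) + 1 := fun n t => by
    simp only [k]
    rw [abs_div, abs_of_pos (zero_lt_one.trans_le (hden n t)),
      div_le_iff₀ (zero_lt_one.trans_le (hden n t)), mul_add, ← mul_assoc,
      mul_inv_cancel₀ (by positivity)]
    have : (0 : ℝ) ≤ n := n.cast_nonneg
    linarith
  have hkerr : ∀ n t, |t - k n t| ≤ ((n : ℝ) + 1)⁻¹ * t ^ 2 := fun n t => by
    have hpos := zero_lt_one.trans_le (hden n t)
    have : t - k n t = (((n : ℝ) + 1)⁻¹ * |t| * t) / (1 + ((n : ℝ) + 1)⁻¹ * |t|) := by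
      simp only [k]
      rw [eq_div_iff hpos.ne', sub_mul, div_mul_cancel₀ _ hpos.ne']
      ring
    rw [this, abs_div, abs_of_pos hpos, abs_mul, abs_mul, abs_abs, abs_of_pos (hδ n), mul_assoc,
      abs_mul_abs_self, ← sq]
    exact div_le_self (mul_nonneg (hδ n).le (sq_nonneg t)) (hden n t)
  have hklim : ∀ t, Tendsto (fun n => k n t) atTop (𝓝 t) := fun t => by
    rw [tendsto_iff_dist_tendsto_zero]
    have h0 : Tendsto (fun n : ℕ => ((n : ℝ) + 1)⁻¹ * t ^ 2) atTop (𝓝 0) := by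
      simpa [one_div] using (tendsto_one_div_add_atTop_nhds_zero_nat (𝕜 := ℝ)).mul_const (t ^ 2)
    refine squeeze_zero (fun _ => dist_nonneg) (fun n => ?_) h0
    rw [dist_comm, Real.dist_eq]
    exact hkerr n t
  let g : ℕ → E →ᵇ ℝ := fun n => BoundedContinuousFunction.ofNormedAddCommGroup
    (fun x => k n (h x)) ((hkc n).comp hh) ((n : ℝ) + 1) fun x => hkbd n _
  let g' : ℕ → E →ᵇ ℝ := fun n => BoundedContinuousFunction.ofNormedAddCommGroup
    (fun x => |k n (h x)|) ((hkc n).comp hh).abs ((n : ℝ) + 1)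
    fun x => by rw [Real.norm_eq_abs, abs_abs]; exact hkbd n _
  have habs : ∀ n, ∫ x, |k n (h x)| ∂ν ≤ 1 + M := by
    intro n
    refine le_of_tendsto (hlim (g' n)) (hP.mono fun i hi => ?_)
    obtain ⟨-, h2, -, h4⟩ := hi
    calc ∫ x, |k n (h x)| ∂(P i) ≤ ∫ x, (1 + h x ^ 2) ∂(P i) := by
          refine integral_mono ((g' n).integrable _) ((integrable_const 1).add h2) fun x => ?_
          refine (hkle n (h x)).trans ?_
          show |h x| ≤ 1 + h x ^ 2
          nlinarith [sq_nonneg (|h x| - 1), sq_abs (h x), abs_nonneg (h x)]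
      _ = 1 + ∫ x, h x ^ 2 ∂(P i) := by
          rw [integral_add (integrable_const 1) h2]; simp
      _ ≤ 1 + M := by linarith
  have hint : Integrable h ν := by
    refine ⟨hh.aestronglyMeasurable, ?_⟩
    have hle : ∫⁻ x, ‖h x‖ₑ ∂ν ≤ liminf (fun n => ∫⁻ x, ‖k n (h x)‖ₑ ∂ν) atTop := by
      calc ∫⁻ x, ‖h x‖ₑ ∂ν = ∫⁻ x, liminf (fun n => ‖k n (h x)‖ₑ) atTop ∂ν :=
            lintegral_congr fun x => ((hklim (h x)).enorm.liminf_eq).symm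
        _ ≤ _ := lintegral_liminf_le fun n => ((hkc n).comp hh).measurable.enorm
    have hbd : ∀ n, ∫⁻ x, ‖k n (h x)‖ₑ ∂ν ≤ ENNReal.ofReal (1 + M) := by
      intro n
      exact (ofReal_integral_norm_eq_lintegral_enorm ((g n).integrable ν)).ge.trans
        (ENNReal.ofReal_le_ofReal (habs n))
    exact lt_of_le_of_lt (hle.trans (liminf_le_of_frequently_le' (Frequently.of_forall hbd)))
      ENNReal.ofReal_lt_top
  refine ⟨hint, ?_⟩
  have hdom : Tendsto (fun n => ∫ x, k n (h x) ∂ν) atTop (𝓝 (∫ x, h x ∂ν)) :=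
    tendsto_integral_of_dominated_convergence (fun x => |h x|)
      (fun n => ((hkc n).comp hh).aestronglyMeasurable) hint.abs
      (fun n => Eventually.of_forall fun x => hkle n _)
      (Eventually.of_forall fun x => hklim _)
  have herr : ∀ n, |∫ x, k n (h x) ∂ν - c| ≤ ((n : ℝ) + 1)⁻¹ * M := by
    intro n
    refine le_of_tendsto ((hlim (g n)).sub_const c).abs (hP.mono fun i hi => ?_)
    obtain ⟨h1, h2, h3, h4⟩ := hi
    calc |∫ x, k n (h x) ∂(P i) - c| = |∫ x, (h x - k n (h x)) ∂(P i)| := by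
          have hs := integral_sub h1 ((g n).integrable (P i))
          rw [h3] at hs
          exact (abs_sub_comm _ _).trans (congrArg abs hs.symm)
      _ ≤ ∫ x, |h x - k n (h x)| ∂(P i) := abs_integral_le_integral_abs
      _ ≤ ∫ x, ((n : ℝ) + 1)⁻¹ * h x ^ 2 ∂(P i) :=
          integral_mono (h1.sub ((g n).integrable _)).abs (h2.const_mul _) fun x => hkerr n _
      _ ≤ ((n : ℝ) + 1)⁻¹ * M := by
          rw [integral_const_mul]; exact mul_le_mul_of_nonneg_left h4 (hδ n).le
  refine tendsto_nhds_unique hdom ?_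
  rw [tendsto_iff_dist_tendsto_zero]
  have h0 : Tendsto (fun n : ℕ => ((n : ℝ) + 1)⁻¹ * M) atTop (𝓝 0) := by
    simpa [one_div] using (tendsto_one_div_add_atTop_nhds_zero_nat (𝕜 := ℝ)).mul_const M
  exact squeeze_zero (fun _ => dist_nonneg) (fun n => by rw [Real.dist_eq]; exact herr n) h0

/-- If every point of a measurable set `W` lies in the non-vanishing locus of a nonnegative
bounded continuous function with zero integral, then `W` is null. -/
lemma measure_eq_zero_of_forall_exists_integral_eq_zero {ν : Measure E} [IsFiniteMeasure ν]
    (hν : ν.InnerRegular) {W : Set E} (hW : MeasurableSet W)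
    (h : ∀ x ∈ W, ∃ g : E →ᵇ ℝ, (∀ y, 0 ≤ g y) ∧ g x ≠ 0 ∧ ∫ y, g y ∂ν = 0) : ν W = 0 := by
  by_contra hne
  obtain ⟨Q, hQW, hQ, hpos⟩ := hW.exists_lt_isCompact (pos_iff_ne_zero.2 hne)
  refine hpos.ne' (hQ.measure_zero_of_nhdsWithin fun x hx => ?_)
  obtain ⟨g, hg0, hgx, hgint⟩ := h x (hQW hx)
  refine ⟨{y | g y ≠ 0}, mem_nhdsWithin_of_mem_nhds
    ((isOpen_ne_fun g.continuous continuous_const).mem_nhds hgx), ?_⟩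
  exact ae_iff.1 ((integral_eq_zero_iff_of_nonneg hg0 (g.integrable ν)).1 hgint)

end WeakLimits

section FunctionSpace

open Filter Set Topology
open scoped BoundedContinuousFunction

/-- Real functions on `B`, with the product topology and its Borel σ-algebra (rather than the
product σ-algebra). -/
def Functions (B : Type*) : Type _ := B → ℝ

instance (B : Type*) : TopologicalSpace (Functions B) := Pi.topologicalSpace

instance (B : Type*) : T2Space (Functions B) := inferInstanceAs (T2Space (B → ℝ))

instance (B : Type*) : CompletelyRegularSpace (Functions B) :=
  inferInstanceAs (CompletelyRegularSpace (B → ℝ))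

instance (B : Type*) : MeasurableSpace (Functions B) := borel _

instance (B : Type*) : BorelSpace (Functions B) := ⟨rfl⟩

lemma continuous_functions_apply {B : Type*} (b : B) :
    Continuous fun y : Functions B => (y b : ℝ) := continuous_apply (A := fun _ : B => ℝ) b

lemma continuous_functions_iff {X B : Type*} [TopologicalSpace X] {f : X → Functions B} :
    Continuous f ↔ ∀ b, Continuous fun x => (f x b : ℝ) :=
  continuous_pi_iff (A := fun _ : B => ℝ)

variable {B : Type*} [CommRing B] [Algebra ℝ B]

/-- A character regarded as a real function. -/
def charFun (φ : B →ₐ[ℝ] ℝ) : Functions B := (φ : B → ℝ)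

lemma charFun_injective : Function.Injective (charFun (B := B)) := DFunLike.coe_injective

lemma mem_range_charFun_iff {y : Functions B} : y ∈ range (charFun (B := B)) ↔
    (∀ a b, y (a * b) = y a * y b) ∧ (∀ a b, y (a + b) = y a + y b) ∧
      ∀ r : ℝ, y (algebraMap ℝ B r) = r := by
  constructor
  · rintro ⟨φ, rfl⟩
    exact ⟨map_mul φ, map_add φ, φ.commutes⟩
  · rintro ⟨hmul, hadd, halg⟩
    refine ⟨{ toFun := y, map_one' := ?_, map_mul' := hmul, map_zero' := ?_, map_add' := hadd,
              commutes' := halg }, rfl⟩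
    · simpa using halg 1
    · simpa using halg 0

lemma isClosedEmbedding_charFun : IsClosedEmbedding (charFun (B := B)) := by
  refine ⟨⟨⟨rfl⟩, charFun_injective⟩, ?_⟩
  have : range (charFun (B := B)) = {y : Functions B | (∀ a b, y (a * b) = y a * y b) ∧
      (∀ a b, y (a + b) = y a + y b) ∧ ∀ r : ℝ, y (algebraMap ℝ B r) = r} := by
    ext y; exact mem_range_charFun_iff
  rw [this]
  have hc := continuous_functions_apply (B := B)
  refine IsClosed.and ?_ (IsClosed.and ?_ ?_)
  · simp only [ofPred_forall]
    exact isClosed_iInter fun a => isClosed_iInter fun b => isClosed_eq (hc _) ((hc a).mul (hc b))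
  · simp only [ofPred_forall]
    exact isClosed_iInter fun a => isClosed_iInter fun b => isClosed_eq (hc _) ((hc a).add (hc b))
  · simp only [ofPred_forall]
    exact isClosed_iInter fun r => isClosed_eq (hc _) continuous_const

instance : T2Space (B →ₐ[ℝ] ℝ) := isClosedEmbedding_charFun.isEmbedding.t2Space

lemma continuous_char_apply (b : B) : Continuous fun φ : B →ₐ[ℝ] ℝ => φ b :=
  (continuous_functions_apply b).comp isClosedEmbedding_charFun.continuous

lemma continuous_to_char_iff {X : Type*} [TopologicalSpace X] {f : X → (B →ₐ[ℝ] ℝ)} :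
    Continuous f ↔ ∀ b, Continuous fun x => f x b :=
  isClosedEmbedding_charFun.isInducing.continuous_iff.trans continuous_functions_iff

lemma IsRepr.isProbabilityMeasure {L : B →ₗ[ℝ] ℝ} {K : Set (B →ₐ[ℝ] ℝ)}
    {μ : Measure (B →ₐ[ℝ] ℝ)} (h : IsRepr L K μ) (hL : L 1 = 1) : IsProbabilityMeasure μ := by
  rw [isProbabilityMeasure_iff_real]
  simpa [hL] using (h.2.2 1).2.symm

end FunctionSpace

section Restriction

open Filter Set Topology
open scoped BoundedContinuousFunction

variable {A : Type*} [CommRing A] [Algebra ℝ A]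

lemma continuous_resMap (S : Subalgebra ℝ A) : Continuous (resMap S) :=
  continuous_to_char_iff.2 fun s => continuous_char_apply (s : A)

/-- Restriction of real functions to a subalgebra. -/
def restrictFun (S : Subalgebra ℝ A) (y : Functions A) : Functions S := fun s => y s

lemma continuous_restrictFun (S : Subalgebra ℝ A) : Continuous (restrictFun S) :=
  continuous_functions_iff.2 fun s => continuous_functions_apply (s : A)

open Classical in
/-- The extension by zero of a character of a subalgebra. -/
noncomputable def extendZero (T : Subalgebra ℝ A) (ψ : T →ₐ[ℝ] ℝ) : Functions A :=
  fun a => if h : a ∈ T then ψ ⟨a, h⟩ else 0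

lemma extendZero_of_mem {T : Subalgebra ℝ A} (ψ : T →ₐ[ℝ] ℝ) {a : A} (h : a ∈ T) :
    extendZero T ψ a = ψ ⟨a, h⟩ := dif_pos h

lemma extendZero_of_notMem {T : Subalgebra ℝ A} (ψ : T →ₐ[ℝ] ℝ) {a : A} (h : a ∉ T) :
    extendZero T ψ a = (0 : ℝ) := dif_neg h

lemma continuous_extendZero (T : Subalgebra ℝ A) : Continuous (extendZero T) := by
  refine continuous_functions_iff.2 fun a => ?_
  by_cases h : a ∈ T
  · simp_rw [extendZero_of_mem _ h]
    exact continuous_char_apply _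
  · simp_rw [extendZero_of_notMem _ h]
    exact continuous_const

lemma restrictFun_extendZero {S T : Subalgebra ℝ A} (h : S ≤ T) (ψ : T →ₐ[ℝ] ℝ) :
    restrictFun S (extendZero T ψ) = charFun (resTrans h ψ) := by
  funext s
  exact extendZero_of_mem ψ (h s.2)

lemma fg_adjoin_pair (a b : A) : (Algebra.adjoin ℝ {a, b}).FG :=
  Subalgebra.fg_def.2 ⟨{a, b}, by simp, rfl⟩

/-- A function on `A` is a character whose restrictions lie in all `K S` as soon as its
restriction to every finitely generated subalgebra is a character in `K S`. -/
lemma mem_image_charFun_of_forall_restrictFun_mem {K : ∀ S : Subalgebra ℝ A, Set (↥S →ₐ[ℝ] ℝ)}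
    {y : Functions A} (hy : ∀ S : Subalgebra ℝ A, S.FG → restrictFun S y ∈ charFun '' K S) :
    y ∈ charFun '' (⋂ S ∈ {S : Subalgebra ℝ A | S.FG}, resMap S ⁻¹' K S) := by
  have hrange : y ∈ range (charFun (B := A)) := by
    refine mem_range_charFun_iff.2 ⟨fun a b => ?_, fun a b => ?_, fun r => ?_⟩
    · obtain ⟨ψ, -, hψ⟩ := hy _ (fg_adjoin_pair a b)
      have ha : a ∈ Algebra.adjoin ℝ {a, b} := Algebra.subset_adjoin (by simp)
      have hb : b ∈ Algebra.adjoin ℝ {a, b} := Algebra.subset_adjoin (by simp)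
      have := (mem_range_charFun_iff.1 ⟨ψ, hψ⟩).1 ⟨a, ha⟩ ⟨b, hb⟩
      exact this
    · obtain ⟨ψ, -, hψ⟩ := hy _ (fg_adjoin_pair a b)
      have ha : a ∈ Algebra.adjoin ℝ {a, b} := Algebra.subset_adjoin (by simp)
      have hb : b ∈ Algebra.adjoin ℝ {a, b} := Algebra.subset_adjoin (by simp)
      have := (mem_range_charFun_iff.1 ⟨ψ, hψ⟩).2.1 ⟨a, ha⟩ ⟨b, hb⟩
      exact this
    · obtain ⟨ψ, -, hψ⟩ := hy _ Subalgebra.fg_bot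
      exact (mem_range_charFun_iff.1 ⟨ψ, hψ⟩).2.2 r
  obtain ⟨φ, rfl⟩ := hrange
  refine ⟨φ, mem_iInter₂.2 fun S hS => ?_, rfl⟩
  obtain ⟨ψ, hψ, heq⟩ := hy S hS
  have : resMap S φ = ψ := charFun_injective heq.symm
  rwa [mem_preimage, this]

end Restriction

section Prokhorov

open Filter Set Topology
open scoped BoundedContinuousFunction

variable {A : Type*} [CommRing A] [Algebra ℝ A]

lemma IsRepr.map_resMap {L : A →ₗ[ℝ] ℝ} {K : ∀ S : Subalgebra ℝ A, Set (↥S →ₐ[ℝ] ℝ)}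
    {ν : Measure (A →ₐ[ℝ] ℝ)} [IsFiniteMeasure ν]
    (hν : IsRepr L (⋂ S ∈ {S : Subalgebra ℝ A | S.FG}, resMap S ⁻¹' K S) ν)
    {S : Subalgebra ℝ A} (hS : S.FG) (hK : IsClosed (K S)) :
    IsRepr (resL L S) (K S) (ν.map (resMap S)) := by
  obtain ⟨⟨-, hreg⟩, hsupp, hrep⟩ := hν
  have hmeas := (continuous_resMap S).measurable
  have hfin : IsFiniteMeasure (ν.map (resMap S)) := Measure.isFiniteMeasure_map ν _
  refine ⟨⟨hfin.toIsLocallyFiniteMeasure, Measure.InnerRegular.map_of_continuous (continuous_resMap S)⟩, ?_,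
    fun b => ⟨?_, ?_⟩⟩
  · rw [Measure.map_apply hmeas hK.measurableSet.compl]
    refine measure_mono_null (compl_subset_compl.2 (biInter_subset_of_mem
      (s := {S : Subalgebra ℝ A | S.FG}) (t := fun S => resMap S ⁻¹' K S) hS)) hsupp
  · rw [integrable_map_measure (continuous_char_apply b).aestronglyMeasurable hmeas.aemeasurable]
    exact (hrep b).1
  · rw [integral_map hmeas.aemeasurable (continuous_char_apply b).aestronglyMeasurable]
    exact (hrep b).2

lemma prokh_map_resMap {ν : Measure (A →ₐ[ℝ] ℝ)} [IsProbabilityMeasure ν]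
    (hν : ν.InnerRegular) : Prokh fun S : Subalgebra ℝ A => ν.map (resMap S) := by
  intro ε hε
  obtain ⟨C, -, hC, hlt⟩ := MeasurableSet.univ.exists_isCompact_lt_add
    (measure_ne_top ν univ) hε.ne'
  refine ⟨C, hC, fun S _ => ?_⟩
  rw [measure_univ] at hlt
  calc 1 - ε ≤ ν C := tsub_le_iff_right.2 hlt.le
    _ ≤ ν (resMap S ⁻¹' (resMap S '' C)) := measure_mono (subset_preimage_image _ _)
    _ ≤ _ := Measure.le_map_apply (continuous_resMap S).measurable.aemeasurable _

/-- Prokhorov's condition makes the extensions by zero of the `μf S` uniformly tight. -/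
lemma exists_isCompact_map_extendZero_compl_le
    {μf : ∀ S : Subalgebra ℝ A, Measure (↥S →ₐ[ℝ] ℝ)} (hμ : Prokh μf)
    (hprob : ∀ S : Subalgebra ℝ A, S.FG → IsProbabilityMeasure (μf S)) {ε : ℝ≥0∞} (hε : 0 < ε) :
    ∃ Q : Set (Functions A), IsCompact Q ∧
      ∀ S : Subalgebra ℝ A, S.FG → (μf S).map (extendZero S) Qᶜ ≤ ε := by
  obtain ⟨C, hC, hCS⟩ := hμ ε hε
  have hbd : ∀ a : A, ∃ M : ℝ, 0 ≤ M ∧ ∀ φ ∈ C, |φ a| ≤ M := by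
    intro a
    obtain ⟨M, hM⟩ := hC.exists_bound_of_continuousOn (continuous_char_apply a).continuousOn
    exact ⟨max M 0, le_max_right _ _, fun φ hφ => (hM φ hφ).trans (le_max_left _ _)⟩
  choose M hM0 hM using hbd
  let Q : Set (Functions A) := Set.pi univ fun a => Icc (-M a) (M a)
  have hQ : IsCompact Q := isCompact_univ_pi fun a => isCompact_Icc
  refine ⟨Q, hQ, fun S hS => ?_⟩
  have := hprob S hS
  have hmeas := (continuous_extendZero S).measurable
  rw [Measure.map_apply hmeas hQ.measurableSet.compl, preimage_compl,
    prob_compl_eq_one_sub (hmeas hQ.measurableSet)]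
  refine tsub_le_iff_tsub_le.1 ((hCS S hS).trans (measure_mono ?_))
  rintro - ⟨φ, hφ, rfl⟩ a -
  by_cases ha : a ∈ S
  · rw [extendZero_of_mem _ ha]
    exact abs_le.1 (hM a φ hφ)
  · rw [extendZero_of_notMem _ ha]
    exact ⟨neg_nonpos.2 (hM0 a), hM0 a⟩

/-- The sets of functions that are characters in `K S` on all of the finitely generated
subalgebras carry the weak limits of the extensions by zero of measures carried by the `K S`. -/
lemma measure_compl_image_charFun_eq_zero {K : ∀ S : Subalgebra ℝ A, Set (↥S →ₐ[ℝ] ℝ)}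
    (hKclosed : ∀ S : Subalgebra ℝ A, S.FG → IsClosed (K S))
    (hKcompat : ∀ (S T : Subalgebra ℝ A), S.FG → T.FG → ∀ h : S ≤ T,
      resTrans h '' K T ⊆ K S)
    {μf : ∀ S : Subalgebra ℝ A, Measure (↥S →ₐ[ℝ] ℝ)}
    (hμK : ∀ S : Subalgebra ℝ A, S.FG → μf S (K S)ᶜ = 0)
    {F : Filter {S : Subalgebra ℝ A // S.FG}} [F.NeBot] (hF : F ≤ atTop)
    {ν : Measure (Functions A)} [IsFiniteMeasure ν] (hreg : ν.InnerRegular)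
    (hlim : ∀ g : Functions A →ᵇ ℝ,
      Tendsto (fun S => ∫ y, g y ∂((μf S.1).map (extendZero S.1))) F (𝓝 (∫ y, g y ∂ν))) :
    ν (charFun '' (⋂ S ∈ {S : Subalgebra ℝ A | S.FG}, resMap S ⁻¹' K S))ᶜ = 0 := by
  have hclosed : IsClosed (⋂ S ∈ {S : Subalgebra ℝ A | S.FG}, resMap S ⁻¹' K S) :=
    isClosed_biInter fun S hS => (hKclosed S hS).preimage (continuous_resMap S)
  refine measure_eq_zero_of_forall_exists_integral_eq_zero hreg
    (isClosedEmbedding_charFun.isClosedMap _ hclosed).measurableSet.compl fun y hy => ?_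
  obtain ⟨S, hS, hyS⟩ : ∃ S : Subalgebra ℝ A, S.FG ∧ restrictFun S y ∉ charFun '' K S := by
    by_contra! hcon
    exact hy (mem_image_charFun_of_forall_restrictFun_mem hcon)
  obtain ⟨f, hf, hfy, hfK⟩ := CompletelyRegularSpace.completely_regular (restrictFun S y)
    (charFun '' K S) (isClosedEmbedding_charFun.isClosedMap _ (hKclosed S hS)) hyS
  let g : Functions A →ᵇ ℝ := BoundedContinuousFunction.ofNormedAddCommGroup
    (fun z => 1 - (f (restrictFun S z) : ℝ))
    (continuous_const.sub (continuous_subtype_val.comp (hf.comp (continuous_restrictFun S)))) 1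
    (fun z => by
      rw [Real.norm_eq_abs, abs_of_nonneg (sub_nonneg.2 (f _).2.2)]
      exact sub_le_self _ (f _).2.1)
  refine ⟨g, fun z => sub_nonneg.2 (f _).2.2, ?_, ?_⟩
  · show 1 - (f (restrictFun S y) : ℝ) ≠ 0
    simp [hfy]
  refine tendsto_nhds_unique (hlim g) (tendsto_const_nhds.congr' ?_)
  filter_upwards [hF (mem_atTop (⟨S, hS⟩ : {S : Subalgebra ℝ A // S.FG}))] with T hT
  have hST : S ≤ T.1 := hT
  rw [integral_map (continuous_extendZero T.1).measurable.aemeasurable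
    g.continuous.aestronglyMeasurable]
  refine (integral_eq_zero_of_ae ?_).symm
  filter_upwards [mem_ae_iff.2 (hμK T.1 T.2)] with ψ hψ
  show 1 - (f (restrictFun S (extendZero T.1 ψ)) : ℝ) = 0
  rw [restrictFun_extendZero hST,
    hfK (mem_image_of_mem _ (hKcompat S T.1 hS T.2 hST (mem_image_of_mem _ hψ)))]
  simp

/-- Weak limits of the extensions by zero of representing measures have the moments prescribed
by `L`. -/
lemma integrable_and_integral_eq_of_tendsto {L : A →ₗ[ℝ] ℝ} (hL1 : L 1 = 1)
    {K : ∀ S : Subalgebra ℝ A, Set (↥S →ₐ[ℝ] ℝ)}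
    {μf : ∀ S : Subalgebra ℝ A, Measure (↥S →ₐ[ℝ] ℝ)}
    (hμ : ∀ S : Subalgebra ℝ A, S.FG → IsRepr (resL L S) (K S) (μf S))
    {F : Filter {S : Subalgebra ℝ A // S.FG}} [F.NeBot] (hF : F ≤ atTop)
    {ν : Measure (Functions A)} [IsProbabilityMeasure ν]
    (hlim : ∀ g : Functions A →ᵇ ℝ,
      Tendsto (fun S => ∫ y, g y ∂((μf S.1).map (extendZero S.1))) F (𝓝 (∫ y, g y ∂ν)))
    (a : A) : Integrable (fun y : Functions A => (y a : ℝ)) ν ∧ ∫ y : Functions A, y a ∂ν = L a := by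
  have hmeas := fun S : Subalgebra ℝ A => (continuous_extendZero S).measurable.aemeasurable
    (μ := μf S)
  have hprob : ∀ S : {S : Subalgebra ℝ A // S.FG},
      IsProbabilityMeasure ((μf S.1).map (extendZero S.1)) := fun S =>
    have := (hμ S.1 S.2).isProbabilityMeasure hL1
    Measure.isProbabilityMeasure_map (hmeas S.1)
  have hca := continuous_functions_apply a
  have hca2 : Continuous fun y : Functions A => (y a : ℝ) ^ 2 := hca.pow 2
  refine integrable_and_tendsto_integral_of_sq_le hlim hca (M := L (a ^ 2)) ?_
  filter_upwards [hF (mem_atTop (⟨_, fg_adjoin_pair a a⟩ : {S : Subalgebra ℝ A // S.FG}))]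
    with T hT
  have haT : a ∈ T.1 := hT (Algebra.subset_adjoin (by simp))
  have h1 := (hμ T.1 T.2).2.2 ⟨a, haT⟩
  have h2 := (hμ T.1 T.2).2.2 (⟨a, haT⟩ ^ 2)
  simp_rw [map_pow] at h2
  rw [integrable_map_measure hca.aestronglyMeasurable (hmeas _),
    integrable_map_measure hca2.aestronglyMeasurable (hmeas _),
    integral_map (hmeas _) hca.aestronglyMeasurable,
    integral_map (hmeas _) hca2.aestronglyMeasurable]
  simp only [Function.comp_def, extendZero_of_mem _ haT]
  exact ⟨h1.1, h2.1, h1.2.symm, h2.2.ge⟩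

/-- An inner regular probability measure on the space of functions that is carried by the
characters in `D` and has the moments of `L` restricts to a representing measure. -/
lemma isRepr_comap_charFun {L : A →ₗ[ℝ] ℝ} {D : Set (A →ₐ[ℝ] ℝ)}
    {ν : Measure (Functions A)} [IsFiniteMeasure ν] (hreg : ν.InnerRegular)
    (hD : ν (charFun '' D)ᶜ = 0)
    (hL : ∀ a : A, Integrable (fun y : Functions A => (y a : ℝ)) ν ∧
      ∫ y : Functions A, y a ∂ν = L a) :
    IsRepr L D (ν.comap charFun) := by
  have hemb : MeasurableEmbedding (charFun (B := A)) :=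
    isClosedEmbedding_charFun.measurableEmbedding
  have hmap : (ν.comap charFun).map (charFun (B := A)) = ν := by
    rw [hemb.map_comap]
    exact Measure.restrict_eq_self_of_ae_mem
      (measure_mono_null (compl_subset_compl.2 (image_subset_range _ D)) hD)
  have hfin : IsFiniteMeasure (ν.comap (charFun (B := A))) :=
    ⟨by rw [hemb.comap_apply]; exact measure_lt_top ν _⟩
  refine ⟨⟨inferInstance, ⟨?_⟩⟩, ?_, fun a => ?_⟩
  · intro U hU r hr
    rw [hemb.comap_apply] at hr
    obtain ⟨Q, hQU, hQ, hrQ⟩ := (hemb.measurableSet_image.2 hU).exists_lt_isCompact hr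
    refine ⟨charFun ⁻¹' Q, ?_, isClosedEmbedding_charFun.isCompact_preimage hQ, ?_⟩
    · rw [← preimage_image_eq U charFun_injective]
      exact preimage_mono hQU
    · rwa [hemb.comap_apply,
        image_preimage_eq_of_subset (hQU.trans (image_subset_range _ _))]
  · rw [hemb.comap_apply]
    exact measure_mono_null (subset_compl_iff_disjoint_right.2
      (disjoint_image_of_injective charFun_injective disjoint_compl_left)) hD
  · have h := hL a
    rw [← hmap, hemb.integrable_map_iff, hemb.integral_map] at h
    exact ⟨h.1, h.2.symm⟩

end Prokhorov

/-- `L` has a `(⋂_{S ∈ I} π_S⁻¹(K S))`-representing Radon measure iff there is a family of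
`K S`-representing Radon measures for the `L|_S` fulfilling Prokhorov's condition. -/
theorem representing_radon_iff_prokhorov
    (A : Type*) [CommRing A] [Algebra ℝ A] [Nonempty (A →ₐ[ℝ] ℝ)]
    (L : A →ₗ[ℝ] ℝ) (hL1 : L 1 = 1)
    (K : ∀ S : Subalgebra ℝ A, Set (↥S →ₐ[ℝ] ℝ))
    (hKclosed : ∀ S : Subalgebra ℝ A, S.FG → IsClosed (K S))
    (hKcompat : ∀ (S T : Subalgebra ℝ A), S.FG → T.FG → ∀ h : S ≤ T,
      resTrans h '' K T ⊆ K S) :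
    (∃ ν : Measure (A →ₐ[ℝ] ℝ),
        IsRepr L (⋂ S ∈ {S : Subalgebra ℝ A | S.FG}, resMap S ⁻¹' K S) ν) ↔
      (∃ μf : ∀ S : Subalgebra ℝ A, Measure (↥S →ₐ[ℝ] ℝ),
        (∀ S : Subalgebra ℝ A, S.FG → IsRepr (resL L S) (K S) (μf S)) ∧ Prokh μf) := by
  constructor
  · rintro ⟨ν, hν⟩
    have := hν.isProbabilityMeasure hL1
    exact ⟨fun S => ν.map (resMap S), fun S hS => hν.map_resMap hS (hKclosed S hS),
      prokh_map_resMap hν.1.2⟩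
  · rintro ⟨μf, hμ, hprokh⟩
    have hprob : ∀ S : Subalgebra ℝ A, S.FG → IsProbabilityMeasure (μf S) :=
      fun S hS => (hμ S hS).isProbabilityMeasure hL1
    have hprob' : ∀ S : {S : Subalgebra ℝ A // S.FG},
        IsProbabilityMeasure ((μf S.1).map (extendZero S.1)) := fun S =>
      have := hprob S.1 S.2
      Measure.isProbabilityMeasure_map (continuous_extendZero S.1).measurable.aemeasurable
    have : Nonempty {S : Subalgebra ℝ A // S.FG} := ⟨⟨⊥, Subalgebra.fg_bot⟩⟩
    have : IsDirectedOrder {S : Subalgebra ℝ A // S.FG} :=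
      ⟨fun S T => ⟨⟨S.1 ⊔ T.1, S.2.sup T.2⟩, le_sup_left (a := S.1), le_sup_right (a := S.1)⟩⟩
    obtain ⟨U, ν, hU, hreg, hν, hlim⟩ := exists_innerRegular_tendsto_of_tight Filter.atTop
      (fun S : {S : Subalgebra ℝ A // S.FG} => (μf S.1).map (extendZero S.1)) fun ε hε => by
        obtain ⟨Q, hQ, hQS⟩ := exists_isCompact_map_extendZero_compl_le hprokh hprob hε
        exact ⟨Q, hQ, fun S => hQS S.1 S.2⟩
    exact ⟨ν.comap charFun, isRepr_comap_charFun hreg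
      (measure_compl_image_charFun_eq_zero hKclosed hKcompat (fun S hS => (hμ S hS).2.1) hU
        hreg hlim)
      fun a => integrable_and_integral_eq_of_tendsto hL1 hμ hU hlim a⟩

end Stmt14
end

section
/- Let A be a finitely generated unital commutative real algebra with nonempty character space X(A), L : A → ℝ linear with L(1) = 1, and K a closed subset of X(A). If L(a) ≥ 0 for every a ∈ A with â(α) ≥ 0 for all α ∈ K (i.e. L is non-negative on Pos_A(K)), then there exists a K-representing Radon measure for L on the Borel σ-algebra of X(A). -/
open MeasureTheory
open scoped ENNReal

namespace Stmt15

/-- The weak topology on the character space `B →ₐ[ℝ] ℝ`. -/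
instance charTopology (B : Type*) [CommRing B] [Algebra ℝ B] :
    TopologicalSpace (B →ₐ[ℝ] ℝ) :=
  TopologicalSpace.induced (fun φ : B →ₐ[ℝ] ℝ => (φ : B → ℝ)) inferInstance

/-- The Borel σ-algebra of the weak topology on the character space. -/
instance charMeasurableSpace (B : Type*) [CommRing B] [Algebra ℝ B] :
    MeasurableSpace (B →ₐ[ℝ] ℝ) := borel _

instance charBorelSpace (B : Type*) [CommRing B] [Algebra ℝ B] :
    BorelSpace (B →ₐ[ℝ] ℝ) := ⟨rfl⟩

/-- The restriction map `π_S : X(A) → X(S)` for a subalgebra `S` of `A`. -/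
def resMap {A : Type*} [CommRing A] [Algebra ℝ A] (S : Subalgebra ℝ A) :
    (A →ₐ[ℝ] ℝ) → (S →ₐ[ℝ] ℝ) := fun φ => φ.comp S.val

/-- The restriction map `π_{S,T} : X(T) → X(S)` for subalgebras `S ≤ T` of `A`. -/
def resTrans {A : Type*} [CommRing A] [Algebra ℝ A] {S T : Subalgebra ℝ A} (h : S ≤ T) :
    (T →ₐ[ℝ] ℝ) → (S →ₐ[ℝ] ℝ) := fun φ => φ.comp (Subalgebra.inclusion h)

/-- The restriction `L|_S` of a linear functional `L : A → ℝ` to a subalgebra `S`. -/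
def resL {A : Type*} [CommRing A] [Algebra ℝ A] (L : A →ₗ[ℝ] ℝ) (S : Subalgebra ℝ A) :
    (↥S) →ₗ[ℝ] ℝ := L.comp (Subalgebra.val S).toLinearMap

/-- A Radon measure: locally finite and inner regular w.r.t. compact sets. -/
def IsRadon {α : Type*} [TopologicalSpace α] [MeasurableSpace α] (μ : Measure α) : Prop :=
  IsLocallyFiniteMeasure μ ∧ μ.InnerRegular

/-- `μ` is a `K`-representing Radon measure for the linear functional `L` on `B`. -/
def IsRepr {B : Type*} [CommRing B] [Algebra ℝ B] (L : B →ₗ[ℝ] ℝ)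
    (K : Set (B →ₐ[ℝ] ℝ)) (μ : Measure (B →ₐ[ℝ] ℝ)) : Prop :=
  IsRadon μ ∧ μ Kᶜ = 0 ∧
    ∀ b : B, Integrable (fun φ : B →ₐ[ℝ] ℝ => φ b) μ ∧
      L b = ∫ φ : B →ₐ[ℝ] ℝ, φ b ∂μ

/-- Prokhorov's condition for a family of measures indexed by the finitely generated
subalgebras of `A`. -/
def Prokh {A : Type*} [CommRing A] [Algebra ℝ A]
    (μf : ∀ S : Subalgebra ℝ A, Measure (↥S →ₐ[ℝ] ℝ)) : Prop :=
  ∀ ε : ℝ≥0∞, 0 < ε → ∃ C : Set (A →ₐ[ℝ] ℝ), IsCompact C ∧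
    ∀ S : Subalgebra ℝ A, S.FG → 1 - ε ≤ μf S (resMap S '' C)

open Filter Topology
open scoped CompactlySupported

section CharacterSpace

variable {A : Type*} [CommRing A] [Algebra ℝ A]

lemma continuous_eval (a : A) : Continuous (fun φ : A →ₐ[ℝ] ℝ => φ a) :=
  (continuous_apply a).comp continuous_induced_dom

lemma isClosedEmbedding_coe :
    IsClosedEmbedding (fun φ : A →ₐ[ℝ] ℝ => (φ : A → ℝ)) := by
  refine ⟨⟨⟨rfl⟩, DFunLike.coe_injective⟩, ?_⟩
  have hrange : Set.range (fun φ : A →ₐ[ℝ] ℝ => (φ : A → ℝ)) =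
      (⋂ r : ℝ, {f : A → ℝ | f (algebraMap ℝ A r) = r}) ∩
      ((⋂ a : A, ⋂ b : A, {f : A → ℝ | f (a + b) = f a + f b}) ∩
      (⋂ a : A, ⋂ b : A, {f : A → ℝ | f (a * b) = f a * f b})) := by
    ext f
    simp only [Set.mem_range, Set.mem_inter_iff, Set.mem_iInter, Set.mem_ofPred_eq]
    constructor
    · rintro ⟨φ, rfl⟩
      exact ⟨fun r => φ.commutes r, map_add φ, map_mul φ⟩
    · rintro ⟨hc, hadd, hmul⟩
      exact ⟨{ toFun := f
               map_one' := by simpa using hc 1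
               map_mul' := hmul
               map_zero' := by simpa using hc 0
               map_add' := hadd
               commutes' := hc }, rfl⟩
  rw [hrange]
  refine (isClosed_iInter fun r => isClosed_eq (by fun_prop) (by fun_prop)).inter
    ((isClosed_iInter fun a => isClosed_iInter fun b => ?_).inter
      (isClosed_iInter fun a => isClosed_iInter fun b => ?_)) <;>
  exact isClosed_eq (by fun_prop) (by fun_prop)

instance charT2Space : T2Space (A →ₐ[ℝ] ℝ) :=
  isClosedEmbedding_coe.isEmbedding.t2Space

/-- A set of characters on which generators of the algebra are bounded is bounded at every
element of the algebra. -/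
lemma exists_bound_of_adjoin_eq_top {s : Set A} (hs : Algebra.adjoin ℝ s = ⊤)
    {C : Set (A →ₐ[ℝ] ℝ)} (hC : ∀ x ∈ s, ∃ M, ∀ φ ∈ C, |φ x| ≤ M) (a : A) :
    ∃ M, ∀ φ ∈ C, |φ a| ≤ M := by
  have ha : a ∈ Algebra.adjoin ℝ s := hs ▸ Algebra.mem_top
  induction ha using Algebra.adjoin_induction with
  | mem x hx => exact hC x hx
  | algebraMap r => exact ⟨|r|, fun φ _ => by simp⟩
  | add x y _ _ hx hy =>
    obtain ⟨M, hM⟩ := hx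
    obtain ⟨N, hN⟩ := hy
    refine ⟨M + N, fun φ hφ => ?_⟩
    rw [map_add]
    exact (abs_add_le _ _).trans (add_le_add (hM φ hφ) (hN φ hφ))
  | mul x y _ _ hx hy =>
    obtain ⟨M, hM⟩ := hx
    obtain ⟨N, hN⟩ := hy
    refine ⟨M * N, fun φ hφ => ?_⟩
    rw [map_mul, abs_mul]
    exact mul_le_mul (hM φ hφ) (hN φ hφ) (abs_nonneg _) ((abs_nonneg _).trans (hM φ hφ))

/-- On the character space of a finitely generated algebra some element of the algebra is
a non-negative function with compact sublevel sets. -/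
lemma exists_nonneg_isCompact_sublevel (hfg : (⊤ : Subalgebra ℝ A).FG) :
    ∃ p : A, (∀ φ : A →ₐ[ℝ] ℝ, 0 ≤ φ p) ∧
      ∀ R : ℝ, IsCompact {φ : A →ₐ[ℝ] ℝ | φ p ≤ R} := by
  obtain ⟨s, hs⟩ := hfg
  have hp (φ : A →ₐ[ℝ] ℝ) : φ (∑ x ∈ s, x ^ 2) = ∑ x ∈ s, φ x ^ 2 := by simp
  refine ⟨∑ x ∈ s, x ^ 2, fun φ => ?_, fun R => ?_⟩
  · rw [hp]
    exact Finset.sum_nonneg fun x _ => sq_nonneg _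
  · choose M hM using exists_bound_of_adjoin_eq_top hs
      (C := {φ : A →ₐ[ℝ] ℝ | φ (∑ x ∈ s, x ^ 2) ≤ R}) fun x hx => ⟨√R, fun φ hφ => by
        refine Real.abs_le_sqrt (le_trans ?_ hφ)
        rw [hp]
        exact Finset.single_le_sum (f := fun x => φ x ^ 2) (fun x _ => sq_nonneg _) hx⟩
    refine (isClosedEmbedding_coe.isCompact_preimage
      (isCompact_univ_pi fun a => isCompact_Icc (a := -M a) (b := M a))).of_isClosed_subset
      (isClosed_le (continuous_eval _) continuous_const) fun φ hφ a _ => ?_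
    exact abs_le.mp (hM a φ hφ)

lemma locallyCompactSpace_of_isCompact_sublevel {p : A}
    (hp : ∀ R : ℝ, IsCompact {φ : A →ₐ[ℝ] ℝ | φ p ≤ R}) :
    LocallyCompactSpace (A →ₐ[ℝ] ℝ) := by
  have : WeaklyLocallyCompactSpace (A →ₐ[ℝ] ℝ) :=
    ⟨fun φ => ⟨_, hp (φ p + 1), ((continuous_eval p).continuousAt.eventually_lt
      continuousAt_const (lt_add_one _)).mono fun _ h => le_of_lt h⟩⟩
  infer_instance

/-- The function `c` times evaluation at `a`, where `c` is the cutoff which is `1` for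
`φ p ≤ n` and `0` for `φ p ≥ n + 1`. -/
noncomputable def cutoff {p : A} (hp : ∀ R : ℝ, IsCompact {φ : A →ₐ[ℝ] ℝ | φ p ≤ R})
    (n : ℕ) (a : A) : C_c(A →ₐ[ℝ] ℝ, ℝ) where
  toFun φ := max 0 (min 1 (n + 1 - φ p)) * φ a
  continuous_toFun := (continuous_const.max (continuous_const.min
    (continuous_const.sub (continuous_eval p)))).mul (continuous_eval a)
  hasCompactSupport' := by
    refine HasCompactSupport.intro (hp (n + 1)) fun φ hφ => ?_
    simp only [Set.mem_ofPred_eq, not_le] at hφ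
    have : max 0 (min 1 ((n : ℝ) + 1 - φ p)) = 0 :=
      max_eq_left ((min_le_right _ _).trans (by linarith))
    simp [this]

lemma cutoff_apply {p : A} (hp : ∀ R : ℝ, IsCompact {φ : A →ₐ[ℝ] ℝ | φ p ≤ R})
    (n : ℕ) (a : A) (φ : A →ₐ[ℝ] ℝ) :
    cutoff hp n a φ = max 0 (min 1 (n + 1 - φ p)) * φ a := rfl

lemma cutoff_apply_of_le {p : A} (hp : ∀ R : ℝ, IsCompact {φ : A →ₐ[ℝ] ℝ | φ p ≤ R})
    {n : ℕ} (a : A) {φ : A →ₐ[ℝ] ℝ} (h : φ p ≤ n) : cutoff hp n a φ = φ a := by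
  have : max 0 (min 1 ((n : ℝ) + 1 - φ p)) = 1 := by
    rw [min_eq_left (by linarith), max_eq_right zero_le_one]
  rw [cutoff_apply, this, one_mul]

lemma abs_cutoff_le {p : A} (hp : ∀ R : ℝ, IsCompact {φ : A →ₐ[ℝ] ℝ | φ p ≤ R})
    (n : ℕ) (a : A) (φ : A →ₐ[ℝ] ℝ) : |cutoff hp n a φ| ≤ |φ a| := by
  rw [cutoff_apply, abs_mul, abs_of_nonneg (le_max_left _ _)]
  exact mul_le_of_le_one_left (abs_nonneg _) (max_le zero_le_one (min_le_left _ _))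

lemma cutoff_nonneg {p : A} (hp : ∀ R : ℝ, IsCompact {φ : A →ₐ[ℝ] ℝ | φ p ≤ R})
    (n : ℕ) {a : A} {φ : A →ₐ[ℝ] ℝ} (h : 0 ≤ φ a) : 0 ≤ cutoff hp n a φ :=
  mul_nonneg (le_max_left _ _) h

lemma tendsto_cutoff {p : A} (hp : ∀ R : ℝ, IsCompact {φ : A →ₐ[ℝ] ℝ | φ p ≤ R})
    (a : A) (φ : A →ₐ[ℝ] ℝ) :
    Tendsto (fun n => cutoff hp n a φ) atTop (𝓝 (φ a)) := by
  obtain ⟨N, hN⟩ := exists_nat_ge (φ p)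
  refine tendsto_const_nhds.congr' ?_
  filter_upwards [eventually_ge_atTop N] with n hn
  exact (cutoff_apply_of_le hp a (hN.trans (by exact_mod_cast hn))).symm

/-- The error of the cutoff is controlled by `(1 + a ^ 2) * p`. -/
lemma mul_sub_cutoff_le {p : A} (hp : ∀ R : ℝ, IsCompact {φ : A →ₐ[ℝ] ℝ | φ p ≤ R})
    (hp0 : ∀ φ : A →ₐ[ℝ] ℝ, 0 ≤ φ p) (n : ℕ) (a : A) (φ : A →ₐ[ℝ] ℝ) :
    n * |φ a - cutoff hp n a φ| ≤ φ ((1 + a ^ 2) * p) := by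
  have hr : φ ((1 + a ^ 2) * p) = (1 + φ a ^ 2) * φ p := by simp
  rw [hr]
  rcases le_total (φ p) n with h | h
  · rw [cutoff_apply_of_le hp a h, sub_self, abs_zero, mul_zero]
    exact mul_nonneg (by positivity) (hp0 φ)
  · have hc : |φ a - cutoff hp n a φ| ≤ 1 + φ a ^ 2 := by
      have hle : |φ a - cutoff hp n a φ| ≤ |φ a| := by
        have h0 : 0 ≤ max 0 (min 1 ((n : ℝ) + 1 - φ p)) := le_max_left _ _
        have h1 : max 0 (min 1 ((n : ℝ) + 1 - φ p)) ≤ 1 :=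
          max_le zero_le_one (min_le_left _ _)
        rw [cutoff_apply, ← one_sub_mul, abs_mul, abs_of_nonneg (by linarith)]
        exact mul_le_of_le_one_left (abs_nonneg _) (by linarith)
      nlinarith [sq_nonneg (|φ a| - 1), sq_abs (φ a), abs_nonneg (φ a)]
    rw [mul_comm]
    exact mul_le_mul hc h (Nat.cast_nonneg n) (by positivity)

/-- A functional which is non-negative on the elements that are non-negative on `K` extends to
the pairs of an element of the algebra and a compactly supported continuous function. -/
lemma exists_extension (L : A →ₗ[ℝ] ℝ) (K : Set (A →ₐ[ℝ] ℝ))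
    (hpos : ∀ a : A, (∀ α ∈ K, 0 ≤ α a) → 0 ≤ L a) :
    ∃ Λ : C_c(A →ₐ[ℝ] ℝ, ℝ) →ₗ[ℝ] ℝ, ∀ (a : A) (f : C_c(A →ₐ[ℝ] ℝ, ℝ)),
      (∀ α ∈ K, 0 ≤ α a + f α) → 0 ≤ L a + Λ f := by
  let s : PointedCone ℝ (A × C_c(A →ₐ[ℝ] ℝ, ℝ)) :=
    { carrier := {x | ∀ α ∈ K, 0 ≤ α x.1 + x.2 α}
      zero_mem' := fun α _ => by simp
      add_mem' := fun {x y} hx hy α hα => by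
        have := add_nonneg (hx α hα) (hy α hα)
        simp only [Prod.fst_add, Prod.snd_add, map_add,
          CompactlySupportedContinuousMap.add_apply]
        linarith
      smul_mem' := fun c x hx α hα => by
        have h : α (c.1 • x.1) + (c.1 • x.2) α = c.1 * (α x.1 + x.2 α) := by
          change α ((c : ℝ) • x.1) + (c : ℝ) * x.2 α = _
          rw [map_smul, smul_eq_mul, mul_add]
        exact h ▸ mul_nonneg c.2 (hx α hα) }
  let f : (A × C_c(A →ₐ[ℝ] ℝ, ℝ)) →ₗ.[ℝ] ℝ :=
    { domain := LinearMap.ker (LinearMap.snd ℝ A C_c(A →ₐ[ℝ] ℝ, ℝ))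
      toFun := (L.comp (LinearMap.fst ℝ A C_c(A →ₐ[ℝ] ℝ, ℝ))).comp (Submodule.subtype _) }
  obtain ⟨g, hgf, hgs⟩ := riesz_extension s f
    (by
      rintro ⟨⟨a, h⟩, hx⟩ hs
      obtain rfl : h = 0 := hx
      exact hpos a fun α hα => by simpa using hs α hα)
    (by
      rintro ⟨a, h⟩
      obtain ⟨M, hM⟩ := h.hasCompactSupport.exists_bound_of_continuous h.continuous
      refine ⟨⟨(algebraMap ℝ A M - a, 0), rfl⟩, fun α _ => ?_⟩
      have := neg_le_of_abs_le (hM α)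
      simp only [Prod.fst_add, Prod.snd_add, sub_add_cancel, zero_add, AlgHom.commutes,
        Algebra.algebraMap_self, RingHom.id_apply]
      linarith)
  refine ⟨g.comp (LinearMap.inr ℝ A _), fun a h hs => ?_⟩
  have hL : g (a, 0) = L a := hgf ⟨(a, 0), rfl⟩
  have hsum : g (a, h) = L a + g (0, h) := by
    rw [← hL, ← map_add]
    simp
  exact hsum ▸ hgs (a, h) hs

/-- A measure representing the extension of `L` to compactly supported continuous functions
also represents `L`. -/
lemma integrable_and_eq_integral {p : A}
    (hp : ∀ R : ℝ, IsCompact {φ : A →ₐ[ℝ] ℝ | φ p ≤ R}) (hp0 : ∀ φ : A →ₐ[ℝ] ℝ, 0 ≤ φ p)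
    {L : A →ₗ[ℝ] ℝ} {K : Set (A →ₐ[ℝ] ℝ)} {Λ : C_c(A →ₐ[ℝ] ℝ, ℝ) →ₗ[ℝ] ℝ}
    (hΛ : ∀ (a : A) (f : C_c(A →ₐ[ℝ] ℝ, ℝ)),
      (∀ α ∈ K, 0 ≤ α a + f α) → 0 ≤ L a + Λ f)
    {μ : Measure (A →ₐ[ℝ] ℝ)} [IsFiniteMeasureOnCompacts μ]
    (hμ : ∀ f : C_c(A →ₐ[ℝ] ℝ, ℝ), ∫ φ, f φ ∂μ = Λ f) (a : A) :
    Integrable (fun φ : A →ₐ[ℝ] ℝ => φ a) μ ∧ L a = ∫ φ : A →ₐ[ℝ] ℝ, φ a ∂μ := by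
  have hcint (n : ℕ) (b : A) : Integrable (fun φ => cutoff hp n b φ) μ :=
    (cutoff hp n b).continuous.integrable_of_hasCompactSupport
      (cutoff hp n b).hasCompactSupport
  have hcover : AECover μ atTop (fun n : ℕ => {φ : A →ₐ[ℝ] ℝ | φ p ≤ n}) :=
    { ae_eventually_mem := .of_forall fun φ => by
        obtain ⟨N, hN⟩ := exists_nat_ge (φ p)
        filter_upwards [eventually_ge_atTop N] with n hn
        exact hN.trans (by exact_mod_cast hn)
      measurableSet := fun n =>
        (isClosed_le (continuous_eval p) continuous_const).measurableSet }
  have hint : Integrable (fun φ : A →ₐ[ℝ] ℝ => φ a) μ := by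
    have hb (φ : A →ₐ[ℝ] ℝ) : φ (1 + a ^ 2) = 1 + φ a ^ 2 := by simp
    have hb0 (φ : A →ₐ[ℝ] ℝ) : 0 ≤ φ (1 + a ^ 2) := by rw [hb]; positivity
    have hion (n : ℕ) : IntegrableOn (fun φ : A →ₐ[ℝ] ℝ => φ a) {φ | φ p ≤ n} μ :=
      (continuous_eval a).continuousOn.integrableOn_compact (hp n)
    refine hcover.integrable_of_integral_norm_bounded (L (1 + a ^ 2)) hion
      (.of_forall fun n => ?_)
    calc ∫ φ in {φ : A →ₐ[ℝ] ℝ | φ p ≤ n}, ‖φ a‖ ∂μ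
        ≤ ∫ φ in {φ : A →ₐ[ℝ] ℝ | φ p ≤ n}, cutoff hp n (1 + a ^ 2) φ ∂μ := by
          refine setIntegral_mono_on (hion n).norm (hcint n _).integrableOn
            (hcover.measurableSet n) fun φ hφ => ?_
          rw [cutoff_apply_of_le hp _ hφ, hb, Real.norm_eq_abs]
          nlinarith [sq_nonneg (|φ a| - 1), sq_abs (φ a), abs_nonneg (φ a)]
      _ ≤ ∫ φ, cutoff hp n (1 + a ^ 2) φ ∂μ :=
          setIntegral_le_integral (hcint n _)
            (.of_forall fun φ => cutoff_nonneg hp n (hb0 φ))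
      _ = Λ (cutoff hp n (1 + a ^ 2)) := hμ _
      _ ≤ L (1 + a ^ 2) := by
          have := hΛ (1 + a ^ 2) (-cutoff hp n (1 + a ^ 2)) fun φ _ => by
            have := (le_abs_self _).trans (abs_cutoff_le hp n (1 + a ^ 2) φ)
            rw [abs_of_nonneg (hb0 φ)] at this
            rw [CompactlySupportedContinuousMap.neg_apply]
            linarith
          rw [map_neg] at this
          linarith
  refine ⟨hint, ?_⟩
  have hlim : Tendsto (fun n => Λ (cutoff hp n a)) atTop (𝓝 (∫ φ : A →ₐ[ℝ] ℝ, φ a ∂μ)) := by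
    simp_rw [← hμ]
    exact tendsto_integral_of_dominated_convergence (fun φ => |φ a|)
      (fun n => (hcint n a).aestronglyMeasurable) hint.abs
      (fun n => .of_forall fun φ => abs_cutoff_le hp n a φ)
      (.of_forall fun φ => tendsto_cutoff hp a φ)
  refine tendsto_nhds_unique (tendsto_iff_dist_tendsto_zero.2 ?_) hlim
  refine squeeze_zero' (.of_forall fun n => dist_nonneg) ?_
    (tendsto_const_div_atTop_nhds_zero_nat (L ((1 + a ^ 2) * p)))
  filter_upwards [eventually_gt_atTop 0] with n hn
  have hn' : (0 : ℝ) < n := by exact_mod_cast hn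
  rw [le_div_iff₀ hn', Real.dist_eq]
  have hupper := hΛ ((1 + a ^ 2) * p - (n : ℝ) • a) ((n : ℝ) • cutoff hp n a) fun φ _ => by
    have h := mul_sub_cutoff_le hp hp0 n a φ
    have := mul_le_mul_of_nonneg_left (le_abs_self (φ a - cutoff hp n a φ)) hn'.le
    simp only [map_sub, map_smul, CompactlySupportedContinuousMap.smul_apply, smul_eq_mul]
    linarith
  have hlower := hΛ ((1 + a ^ 2) * p + (n : ℝ) • a) (-(n : ℝ) • cutoff hp n a) fun φ _ => by
    have h := mul_sub_cutoff_le hp hp0 n a φ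
    have := mul_le_mul_of_nonneg_left (neg_abs_le (φ a - cutoff hp n a φ)) hn'.le
    rw [map_add, map_smul, CompactlySupportedContinuousMap.smul_apply, smul_eq_mul, smul_eq_mul]
    linarith
  simp only [map_sub, map_add, map_smul, smul_eq_mul] at hupper hlower
  rw [← Nat.abs_cast n, ← abs_mul]
  exact abs_le.2 ⟨by linarith, by linarith⟩

end CharacterSpace

/-- Riesz–Haviland theorem for a finitely generated algebra: if `L` is non-negative on
`Pos_A(K)`, then `L` has a `K`-representing Radon measure. -/
theorem riesz_haviland_finitely_generated
    (A : Type*) [CommRing A] [Algebra ℝ A] [Nonempty (A →ₐ[ℝ] ℝ)]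
    (hfg : (⊤ : Subalgebra ℝ A).FG)
    (L : A →ₗ[ℝ] ℝ) (hL1 : L 1 = 1)
    (K : Set (A →ₐ[ℝ] ℝ)) (hK : IsClosed K)
    (hpos : ∀ a : A, (∀ α ∈ K, 0 ≤ α a) → 0 ≤ L a) :
    ∃ ν : Measure (A →ₐ[ℝ] ℝ), IsRepr L K ν := by
  obtain ⟨p, hp0, hp⟩ := exists_nonneg_isCompact_sublevel hfg
  have := locallyCompactSpace_of_isCompact_sublevel hp
  obtain ⟨Λ, hΛ⟩ := exists_extension L K hpos
  let Λ' : C_c(A →ₐ[ℝ] ℝ, ℝ) →ₚ[ℝ] ℝ := .mk₀ Λ fun f hf => by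
    simpa using hΛ 0 f fun α _ => by simpa using hf α
  have hrep := integrable_and_eq_integral hp hp0 hΛ (RealRMK.integral_rieszMeasure Λ')
  have hfin : IsFiniteMeasure (RealRMK.rieszMeasure Λ') := by
    have h := (hrep 1).1
    simp only [map_one] at h
    exact (integrable_const_iff_isFiniteMeasure one_ne_zero).1 h
  refine ⟨RealRMK.rieszMeasure Λ', ⟨inferInstance, inferInstance⟩, ?_, hrep⟩
  rw [hK.isOpen_compl.measure_eq_iSup_isCompact]
  simp only [ENNReal.iSup_eq_zero]
  intro C hCK hC
  obtain ⟨f, hf1, hf0, hfc, hf01⟩ := exists_continuous_one_zero_of_isCompact hC hK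
    (Set.disjoint_left.2 fun x hx => hCK hx)
  have hΛf := hΛ 0 (-⟨f, hfc⟩) fun α hα => by simp [hf0 hα]
  rw [map_zero, zero_add, map_neg, Left.nonneg_neg_iff] at hΛf
  exact nonpos_iff_eq_zero.1 ((RealRMK.rieszMeasure_le_of_eq_one Λ' (f := ⟨f, hfc⟩)
    (fun φ => (hf01 φ).1) hC hf1).trans (ENNReal.ofReal_eq_zero.2 hΛf).le)

end Stmt15
end

section
/- Let A be a unital commutative real algebra with nonempty character space X(A), L : A → ℝ linear with L(1) = 1, I the set of all finitely generated unital subalgebras of A, and K ⊆ X(A) closed. Suppose L(a) ≥ 0 for every a ∈ A with â(α) ≥ 0 for all α ∈ K. Then: (i) for each S ∈ I there exists a closure(π_S(K))-representing Radon measure for L|_S on X(S); and (ii) there exists a K-representing Radon measure ν for L on the Borel σ-algebra of X(A) if and only if there exists a family {μ_S : S ∈ I}, with each μ_S a closure(π_S(K))-representing Radon measure for L|_S, that fulfills Prokhorov's condition: for every ε > 0 there exists a compact C_ε ⊆ X(A) with μ_S(π_S(C_ε)) ≥ 1 − ε for all S ∈ I. -/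
open MeasureTheory
open scoped ENNReal

namespace Stmt16

/-- The weak topology on the character space `B →ₐ[ℝ] ℝ`. -/
instance charTopology (B : Type*) [CommRing B] [Algebra ℝ B] :
    TopologicalSpace (B →ₐ[ℝ] ℝ) :=
  TopologicalSpace.induced (fun φ : B →ₐ[ℝ] ℝ => (φ : B → ℝ)) inferInstance

/-- The Borel σ-algebra of the weak topology on the character space. -/
instance charMeasurableSpace (B : Type*) [CommRing B] [Algebra ℝ B] :
    MeasurableSpace (B →ₐ[ℝ] ℝ) := borel _

instance charBorelSpace (B : Type*) [CommRing B] [Algebra ℝ B] :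
    BorelSpace (B →ₐ[ℝ] ℝ) := ⟨rfl⟩

/-- The restriction map `π_S : X(A) → X(S)` for a subalgebra `S` of `A`. -/
def resMap {A : Type*} [CommRing A] [Algebra ℝ A] (S : Subalgebra ℝ A) :
    (A →ₐ[ℝ] ℝ) → (S →ₐ[ℝ] ℝ) := fun φ => φ.comp S.val

/-- The restriction map `π_{S,T} : X(T) → X(S)` for subalgebras `S ≤ T` of `A`. -/
def resTrans {A : Type*} [CommRing A] [Algebra ℝ A] {S T : Subalgebra ℝ A} (h : S ≤ T) :
    (T →ₐ[ℝ] ℝ) → (S →ₐ[ℝ] ℝ) := fun φ => φ.comp (Subalgebra.inclusion h)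

/-- The restriction `L|_S` of a linear functional `L : A → ℝ` to a subalgebra `S`. -/
def resL {A : Type*} [CommRing A] [Algebra ℝ A] (L : A →ₗ[ℝ] ℝ) (S : Subalgebra ℝ A) :
    (↥S) →ₗ[ℝ] ℝ := L.comp (Subalgebra.val S).toLinearMap

/-- A Radon measure: locally finite and inner regular w.r.t. compact sets. -/
def IsRadon {α : Type*} [TopologicalSpace α] [MeasurableSpace α] (μ : Measure α) : Prop :=
  IsLocallyFiniteMeasure μ ∧ μ.InnerRegular

/-- `μ` is a `K`-representing Radon measure for the linear functional `L` on `B`. -/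
def IsRepr {B : Type*} [CommRing B] [Algebra ℝ B] (L : B →ₗ[ℝ] ℝ)
    (K : Set (B →ₐ[ℝ] ℝ)) (μ : Measure (B →ₐ[ℝ] ℝ)) : Prop :=
  IsRadon μ ∧ μ Kᶜ = 0 ∧
    ∀ b : B, Integrable (fun φ : B →ₐ[ℝ] ℝ => φ b) μ ∧
      L b = ∫ φ : B →ₐ[ℝ] ℝ, φ b ∂μ

/-- Prokhorov's condition for a family of measures indexed by the finitely generated
subalgebras of `A`. -/
def Prokh {A : Type*} [CommRing A] [Algebra ℝ A]
    (μf : ∀ S : Subalgebra ℝ A, Measure (↥S →ₐ[ℝ] ℝ)) : Prop :=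
  ∀ ε : ℝ≥0∞, 0 < ε → ∃ C : Set (A →ₐ[ℝ] ℝ), IsCompact C ∧
    ∀ S : Subalgebra ℝ A, S.FG → 1 - ε ≤ μf S (resMap S '' C)


open Filter Topology Set

/-- A positive unital functional on `C(Y, ℝ)`, with `Y` compact Hausdorff, that is concentrated on
compact subsets of an embedded space `X` is represented by an inner regular measure on `X`. -/
theorem exists_measure_of_concentrated {X Y : Type*} [TopologicalSpace X] [MeasurableSpace X]
    [BorelSpace X] [Nonempty X] [TopologicalSpace Y] [CompactSpace Y] [T2Space Y]
    {i : X → Y} (hi : IsEmbedding i) (Λ : C(Y, ℝ) →ₗ[ℝ] ℝ) (hΛ : ∀ f, 0 ≤ f → 0 ≤ Λ f)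
    (hΛ1 : Λ 1 = 1)
    (tight : ∀ ε : ℝ, 0 < ε → ∃ C : Set X, IsCompact C ∧
      ∀ f : C(Y, ℝ), 0 ≤ f → (∀ x ∈ C, f (i x) = 1) → 1 - ε ≤ Λ f) :
    ∃ ν : Measure X, IsProbabilityMeasure ν ∧ ν.InnerRegular ∧
      ∀ f : C(Y, ℝ), ∫ x, f (i x) ∂ν = Λ f := by
  let _ : MeasurableSpace Y := borel Y
  have : BorelSpace Y := ⟨rfl⟩
  let Λ' : CompactlySupportedContinuousMap Y ℝ →ₚ[ℝ] ℝ := PositiveLinearMap.mk₀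
    { toFun := fun f => Λ f.toContinuousMap
      map_add' := fun f g => Λ.map_add f.toContinuousMap g.toContinuousMap
      map_smul' := fun c f => Λ.map_smul c f.toContinuousMap }
    (fun f hf => hΛ f.toContinuousMap hf)
  let μ : Measure Y := RealRMK.rieszMeasure Λ'
  have hμ : ∀ f : C(Y, ℝ), ∫ y, f y ∂μ = Λ f := fun f =>
    RealRMK.integral_rieszMeasure Λ' (CompactlySupportedContinuousMap.continuousMapEquiv f)
  have hint : ∀ f : C(Y, ℝ), Integrable f μ := fun f =>
    f.continuous.integrable_of_hasCompactSupport (HasCompactSupport.of_compactSpace f)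
  have hprob : IsProbabilityMeasure μ := by
    have h := hμ 1
    rw [hΛ1] at h
    simp only [ContinuousMap.one_apply, integral_const, smul_eq_mul, mul_one] at h
    exact ⟨by rw [← ofReal_measureReal (measure_ne_top μ univ), h, ENNReal.ofReal_one]⟩
  choose C hC hCΛ using fun n : ℕ => tight (1 / (n + 1)) (by positivity)
  have hiC : ∀ n, IsCompact (i '' C n) := fun n => (hC n).image hi.continuous
  have hlarge : ∀ n : ℕ, ENNReal.ofReal (1 - 1 / (n + 1)) ≤ μ (i '' C n) := by
    intro n
    rw [Set.measure_eq_iInf_isOpen]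
    refine le_iInf fun U => le_iInf fun hU => le_iInf fun hUo => ?_
    obtain ⟨f, hf0, hf1, hf⟩ := exists_continuous_zero_one_of_isClosed hUo.isClosed_compl
      (hiC n).isClosed (disjoint_compl_left_iff_subset.2 hU)
    have h1 := hCΛ n f (fun y => (hf y).1) fun x hx => hf1 (mem_image_of_mem i hx)
    have h2 : ∫ y, f y ∂μ ≤ ∫ y, U.indicator 1 y ∂μ := by
      refine integral_mono (hint f) ((integrable_const 1).indicator hUo.measurableSet) fun y => ?_
      by_cases hy : y ∈ U
      · simpa [hy] using (hf y).2
      · simpa [hy] using (hf0 hy).le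
    rw [hμ, integral_indicator_one hUo.measurableSet] at h2
    exact ENNReal.ofReal_le_of_le_toReal (h1.trans h2)
  let Z : Set Y := ⋃ n, i '' C n
  have hZ : MeasurableSet Z := MeasurableSet.iUnion fun n => (hiC n).measurableSet
  have hZ0 : μ Zᶜ = 0 := by
    rw [prob_compl_eq_zero_iff hZ]
    refine le_antisymm prob_le_one ?_
    have hlim : Tendsto (fun n : ℕ => ENNReal.ofReal (1 - 1 / ((n : ℝ) + 1))) atTop (𝓝 1) := by
      simpa using ENNReal.tendsto_ofReal
        ((tendsto_one_div_add_atTop_nhds_zero_nat (𝕜 := ℝ)).const_sub 1)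
    exact le_of_tendsto' hlim fun n => (hlarge n).trans (measure_mono (subset_iUnion (fun n => i '' C n) n))
  have hZae : ∀ᵐ y ∂μ, y ∈ Z := measure_eq_zero_iff_ae_notMem.1 hZ0 |>.mono fun y => by simp
  have hZr : ∀ y ∈ Z, y ∈ range i := by
    rintro y hy
    obtain ⟨n, x, -, rfl⟩ := mem_iUnion.1 hy
    exact mem_range_self x
  classical
  let r : Y → X := Z.piecewise (Function.invFun i) fun _ => Classical.arbitrary X
  have hir : ∀ y ∈ Z, i (r y) = y := by
    intro y hy
    simp only [r, piecewise_eq_of_mem _ _ _ hy]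
    exact Function.invFun_eq (hZr y hy)
  have hinv : ContinuousOn (Function.invFun i) Z :=
    hi.isInducing.continuousOn_iff.2 <| continuousOn_id.congr fun y hy =>
      Function.invFun_eq (hZr y hy)
  have hrm : Measurable r := hinv.measurable_piecewise continuousOn_const hZ
  have hrc : ContinuousOn r Z := hinv.congr fun y hy => piecewise_eq_of_mem _ _ _ hy
  refine ⟨μ.map r, Measure.isProbabilityMeasure_map hrm.aemeasurable, ⟨?_⟩, fun f => ?_⟩
  · intro E hE t ht
    rw [Measure.map_apply hrm hE, ← measure_inter_conull (t := Z) hZ0] at ht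
    obtain ⟨D, hDE, hD, htD⟩ :=
      ((hrm hE).inter hZ).exists_lt_isCompact_of_ne_top (measure_ne_top _ _) ht
    refine ⟨r '' D, ?_, hD.image_of_continuousOn (hrc.mono fun y hy => (hDE hy).2), ?_⟩
    · rintro _ ⟨y, hy, rfl⟩
      exact (hDE hy).1
    · exact htD.trans_le ((measure_mono (subset_preimage_image r D)).trans
        (Measure.le_map_apply hrm.aemeasurable _))
  · rw [integral_map (f := fun x => f (i x)) hrm.aemeasurable
      (f.continuous.comp hi.continuous).measurable.aestronglyMeasurable, ← hμ f]
    exact integral_congr_ae (hZae.mono fun y hy => by simp only [hir y hy])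

theorem measure_compl_eq_zero_of_integral {X Y : Type*} [TopologicalSpace X] [MeasurableSpace X]
    [BorelSpace X] [TopologicalSpace Y] [CompactSpace Y] [T2Space Y]
    {i : X → Y} (hi : IsEmbedding i) {ν : Measure X} [IsProbabilityMeasure ν] [ν.InnerRegular]
    {K : Set X} (hK : IsClosed K)
    (h : ∀ f : C(Y, ℝ), 0 ≤ f → (∀ x ∈ K, f (i x) = 1) → 1 ≤ ∫ x, f (i x) ∂ν) :
    ν Kᶜ = 0 := by
  rw [hK.measurableSet.compl.measure_eq_iSup_isCompact]
  simp only [ENNReal.iSup_eq_zero]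
  intro D hDK hD
  have : T2Space X := hi.t2Space
  have hdisj : Disjoint (i '' D) (closure (i '' K)) := by
    rw [Set.disjoint_left]
    rintro _ ⟨x, hx, rfl⟩ hx'
    have : x ∈ closure K := by rwa [hi.isInducing.closure_eq_preimage_closure_image]
    exact hDK hx (hK.closure_eq ▸ this)
  obtain ⟨f, hf0, hf1, hf⟩ := exists_continuous_zero_one_of_isClosed
    (hD.image hi.continuous).isClosed isClosed_closure hdisj
  have h1 := h f (fun y => (hf y).1) fun x hx => hf1 (subset_closure (mem_image_of_mem i hx))
  have h2 : ∫ x, f (i x) ∂ν ≤ ∫ x, Dᶜ.indicator 1 x ∂ν := by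
    refine integral_mono_of_nonneg (ae_of_all _ fun x => (hf (i x)).1)
      ((integrable_const 1).indicator hD.measurableSet.compl) (ae_of_all _ fun x => ?_)
    by_cases hx : x ∈ D
    · simpa [hx] using (hf0 (mem_image_of_mem i hx)).le
    · simpa [hx] using (hf (i x)).2
  rw [integral_indicator_one hD.measurableSet.compl,
    probReal_compl_eq_one_sub hD.measurableSet] at h2
  have h3 : ν.real D = 0 := le_antisymm (by linarith) measureReal_nonneg
  exact (measureReal_eq_zero_iff).1 h3

theorem integrable_comp_of_continuous {X Y : Type*} [TopologicalSpace X] [MeasurableSpace X]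
    [BorelSpace X] [TopologicalSpace Y] [CompactSpace Y] {ν : Measure X} [IsFiniteMeasure ν]
    (f : C(Y, ℝ)) {j : X → Y} (hj : Continuous j) : Integrable (fun x => f (j x)) ν :=
  .of_bound (f.continuous.comp hj).aestronglyMeasurable ‖f‖
    (ae_of_all _ fun x => f.norm_coe_le_norm (j x))

/-- Truncation of an extended real at levels `-M` and `M`. -/
noncomputable def clip (M : ℝ) : C(EReal, ℝ) where
  toFun t := (max ((-|M| : ℝ) : EReal) (min t (|M| : ℝ))).toReal
  continuous_toFun := by
    refine EReal.continuousOn_toReal.comp_continuous (by fun_prop) fun t => ?_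
    have h1 : max ((-|M| : ℝ) : EReal) (min t (|M| : ℝ)) ≠ ⊥ :=
      ((EReal.bot_lt_coe _).trans_le (le_max_left _ _)).ne'
    have h2 : max ((-|M| : ℝ) : EReal) (min t (|M| : ℝ)) ≠ ⊤ :=
      (max_lt (EReal.coe_lt_top _) ((min_le_right _ _).trans_lt (EReal.coe_lt_top _))).ne
    exact not_or.2 ⟨h1, h2⟩

theorem clip_coe (M x : ℝ) : clip M x = max (-|M|) (min x |M|) := by
  change (max ((-|M| : ℝ) : EReal) (min (x : EReal) (|M| : ℝ))).toReal = _
  rw [← EReal.coe_strictMono.monotone.map_min, ← EReal.coe_strictMono.monotone.map_max,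
    EReal.toReal_coe]

theorem abs_clip_coe_le (M x : ℝ) : |clip M x| ≤ |x| := by
  rw [clip_coe]
  have := abs_nonneg M
  rcases max_cases (-|M|) (min x |M|) with h | h <;> rcases min_cases x |M| with h' | h' <;>
    rw [abs_le] <;> constructor <;> linarith [le_abs_self x, neg_abs_le x]

theorem abs_clip_coe_sub_le {M : ℝ} (hM : 0 < M) (x : ℝ) : |clip M x - x| ≤ x ^ 2 / M := by
  rw [clip_coe, abs_of_pos hM, le_div_iff₀ hM]
  rcases max_cases (-M) (min x M) with h | h <;> rcases min_cases x M with h' | h' <;>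
    rcases abs_cases (max (-M) (min x M) - x) with h'' | h'' <;> nlinarith

theorem clip_coe_of_abs_le {M x : ℝ} (h : |x| ≤ M) : clip M x = x := by
  rw [clip_coe, abs_of_nonneg ((abs_nonneg x).trans h), min_eq_left (abs_le.1 h).2,
    max_eq_right (abs_le.1 h).1]

/-- Evaluation at `a`, truncated at level `M`, as a continuous function on the compact space
`A → EReal`. -/
noncomputable def clipEval {A : Type*} (M : ℝ) (a : A) : C(A → EReal, ℝ) :=
  (clip M).comp ⟨fun y => y a, continuous_apply a⟩

/-- The embedding of the character space in the compact space of extended real functions. -/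
def charEmb {A : Type*} [CommRing A] [Algebra ℝ A] (φ : A →ₐ[ℝ] ℝ) : A → EReal :=
  fun a => (φ a : EReal)

theorem isInducing_coe_char (A : Type*) [CommRing A] [Algebra ℝ A] :
    IsInducing (fun φ : A →ₐ[ℝ] ℝ => (φ : A → ℝ)) := ⟨rfl⟩

theorem continuous_char_apply {A : Type*} [CommRing A] [Algebra ℝ A] (a : A) :
    Continuous fun φ : A →ₐ[ℝ] ℝ => φ a :=
  (continuous_apply a).comp (isInducing_coe_char A).continuous

theorem isEmbedding_charEmb (A : Type*) [CommRing A] [Algebra ℝ A] :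
    IsEmbedding (charEmb : (A →ₐ[ℝ] ℝ) → A → EReal) where
  toIsInducing := (IsInducing.piMap fun _ : A => EReal.isEmbedding_coe.isInducing).comp
    (isInducing_coe_char A)
  injective _ _ h := AlgHom.ext fun a => EReal.coe_injective (congrFun h a)

instance charT2Space (A : Type*) [CommRing A] [Algebra ℝ A] : T2Space (A →ₐ[ℝ] ℝ) :=
  (isEmbedding_charEmb A).t2Space

/-- A positive functional on `C(A → EReal, ℝ)` that is concentrated on compact subsets of the
character space, gives full mass to `K`, and approximates `L` on truncations, yields a
`K`-representing Radon measure for `L`. -/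
theorem exists_isRepr {A : Type*} [CommRing A] [Algebra ℝ A] [Nonempty (A →ₐ[ℝ] ℝ)]
    (L : A →ₗ[ℝ] ℝ) {K : Set (A →ₐ[ℝ] ℝ)} (hK : IsClosed K)
    (Λ : C(A → EReal, ℝ) →ₗ[ℝ] ℝ) (hΛ : ∀ f, 0 ≤ f → 0 ≤ Λ f) (hΛ1 : Λ 1 = 1)
    (tight : ∀ ε : ℝ, 0 < ε → ∃ C : Set (A →ₐ[ℝ] ℝ), IsCompact C ∧
      ∀ f : C(A → EReal, ℝ), 0 ≤ f → (∀ φ ∈ C, f (charEmb φ) = 1) → 1 - ε ≤ Λ f)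
    (supp : ∀ f : C(A → EReal, ℝ), 0 ≤ f → (∀ φ ∈ K, f (charEmb φ) = 1) → 1 ≤ Λ f)
    (hclip : ∀ (a : A) (M : ℝ), 0 < M → |Λ (clipEval M a) - L a| ≤ L (a ^ 2) / M)
    (hclip_sq : ∀ (a : A) (M : ℝ), 0 < M → Λ (clipEval M a ^ 2) ≤ L (a ^ 2)) :
    ∃ ν : Measure (A →ₐ[ℝ] ℝ), IsRepr L K ν := by
  obtain ⟨ν, hν, hreg, hint⟩ :=
    exists_measure_of_concentrated (isEmbedding_charEmb A) Λ hΛ hΛ1 tight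
  refine ⟨ν, ⟨inferInstance, hreg⟩,
    measure_compl_eq_zero_of_integral (isEmbedding_charEmb A) hK fun f hf hfK => by
      rw [hint]; exact supp f hf hfK, fun a => ?_⟩
  have hval : ∀ (n : ℕ) (φ : A →ₐ[ℝ] ℝ),
      clipEval ((n : ℝ) + 1) a (charEmb φ) = clip ((n : ℝ) + 1) (φ a) := fun _ _ => rfl
  have hmeas : ∀ f : C(A → EReal, ℝ), Continuous fun φ : A →ₐ[ℝ] ℝ => f (charEmb φ) := fun f =>
    f.continuous.comp (isEmbedding_charEmb A).continuous
  have hptw : ∀ φ : A →ₐ[ℝ] ℝ,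
      ∀ᶠ n : ℕ in atTop, clipEval ((n : ℝ) + 1) a (charEmb φ) = φ a := fun φ => by
    obtain ⟨N, hN⟩ := exists_nat_ge |φ a|
    filter_upwards [eventually_ge_atTop N] with n hn
    rw [hval, clip_coe_of_abs_le]
    have : (N : ℝ) ≤ n := by exact_mod_cast hn
    linarith
  have hsq : ∫⁻ φ, ENNReal.ofReal ((φ a) ^ 2) ∂ν ≤ ENNReal.ofReal (L (a ^ 2)) := by
    have hfatou := lintegral_liminf_le (μ := ν) (u := atTop)
      (f := fun (n : ℕ) (φ : A →ₐ[ℝ] ℝ) =>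
        ENNReal.ofReal ((clipEval ((n : ℝ) + 1) a ^ 2) (charEmb φ)))
      (fun n => (hmeas (clipEval ((n : ℝ) + 1) a ^ 2)).measurable.ennreal_ofReal)
    refine (lintegral_mono fun φ => ?_).trans (hfatou.trans ?_)
    · refine le_of_eq (Tendsto.liminf_eq ?_).symm
      refine tendsto_const_nhds.congr' ((hptw φ).mono fun n hn => ?_)
      simp [hn]
    · refine liminf_le_of_le (by isBoundedDefault) fun b hb => ?_
      obtain ⟨n, hn⟩ := hb.exists
      refine hn.trans ?_
      rw [← ofReal_integral_eq_lintegral_ofReal, hint]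
      · exact ENNReal.ofReal_le_ofReal (hclip_sq a _ (by positivity))
      · exact integrable_comp_of_continuous (clipEval ((n : ℝ) + 1) a ^ 2)
          (isEmbedding_charEmb A).continuous
      · exact ae_of_all _ fun φ => sq_nonneg (clipEval ((n : ℝ) + 1) a (charEmb φ))
  have hL2 : MemLp (fun φ : A →ₐ[ℝ] ℝ => φ a) 2 ν := by
    rw [memLp_two_iff_integrable_sq (continuous_char_apply a).aestronglyMeasurable]
    refine ⟨((continuous_char_apply a).pow 2).aestronglyMeasurable, ?_⟩
    rw [hasFiniteIntegral_iff_ofReal (ae_of_all _ fun φ : A →ₐ[ℝ] ℝ => sq_nonneg (φ a))]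
    exact hsq.trans_lt ENNReal.ofReal_lt_top
  have hI : Integrable (fun φ : A →ₐ[ℝ] ℝ => φ a) ν := hL2.integrable (by norm_num)
  refine ⟨hI, ?_⟩
  have hlim1 : Tendsto (fun n : ℕ => Λ (clipEval ((n : ℝ) + 1) a)) atTop (𝓝 (∫ φ, φ a ∂ν)) := by
    simp_rw [← hint]
    refine tendsto_integral_of_dominated_convergence (fun φ => |φ a|)
      (fun n => (hmeas _).aestronglyMeasurable) hI.abs
      (fun n => ae_of_all _ fun φ => ?_) (ae_of_all _ fun φ => ?_)
    · rw [hval]; exact abs_clip_coe_le _ _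
    · exact tendsto_const_nhds.congr' ((hptw φ).mono fun n hn => hn.symm)
  have hlim2 : Tendsto (fun n : ℕ => Λ (clipEval ((n : ℝ) + 1) a)) atTop (𝓝 (L a)) := by
    rw [tendsto_iff_dist_tendsto_zero]
    refine squeeze_zero (fun _ => dist_nonneg) (fun n => hclip a _ (by positivity)) ?_
    simpa [div_eq_mul_inv] using
      (tendsto_one_div_add_atTop_nhds_zero_nat (𝕜 := ℝ)).const_mul (L (a ^ 2))
  exact tendsto_nhds_unique hlim2 hlim1

/-- A functional that is nonnegative on `Pos(K)` extends, jointly with a functional on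
`C(A → EReal, ℝ)`, to a functional that is nonnegative on sums that are nonnegative on `K`. -/
theorem exists_positive_extension {A : Type*} [CommRing A] [Algebra ℝ A] (L : A →ₗ[ℝ] ℝ)
    {K : Set (A →ₐ[ℝ] ℝ)} (hpos : ∀ a : A, (∀ φ ∈ K, 0 ≤ φ a) → 0 ≤ L a) :
    ∃ Λ : C(A → EReal, ℝ) →ₗ[ℝ] ℝ, ∀ (a : A) (f : C(A → EReal, ℝ)),
      (∀ φ ∈ K, 0 ≤ φ a + f (charEmb φ)) → 0 ≤ L a + Λ f := by
  let s : PointedCone ℝ (A × C(A → EReal, ℝ)) :=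
    { carrier := {x | ∀ φ ∈ K, 0 ≤ φ x.1 + x.2 (charEmb φ)}
      add_mem' := fun {x y} hx hy φ hφ => by
        have h1 := hx φ hφ
        have h2 := hy φ hφ
        simp only [Prod.fst_add, Prod.snd_add, map_add, ContinuousMap.add_apply]
        linarith
      zero_mem' := fun φ _ => by simp
      smul_mem' := fun c x hx φ hφ => by
        have h := mul_nonneg c.2 (hx φ hφ)
        change 0 ≤ φ ((c : ℝ) • x.1) + ((c : ℝ) • x.2) (charEmb φ)
        rw [map_smul, ContinuousMap.smul_apply, smul_eq_mul, smul_eq_mul, ← mul_add]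
        exact h }
  let F : (A × C(A → EReal, ℝ)) →ₗ.[ℝ] ℝ :=
    ⟨LinearMap.range (LinearMap.inl ℝ A C(A → EReal, ℝ)),
      (L.comp (LinearMap.fst ℝ A C(A → EReal, ℝ))).domRestrict _⟩
  have hmem : ∀ a : A, (a, (0 : C(A → EReal, ℝ))) ∈ F.domain := fun a => ⟨a, rfl⟩
  obtain ⟨g, hgF, hgs⟩ := riesz_extension s F
    (by
      rintro ⟨_, a, rfl⟩ hx
      exact hpos a fun φ hφ => by simpa using hx φ hφ)
    (fun y => ⟨⟨(algebraMap ℝ A ‖y.2‖ - y.1, 0), hmem _⟩, fun φ _ => by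
      have := (abs_le.1 (y.2.norm_coe_le_norm (charEmb φ))).1
      simp only [Prod.fst_add, Prod.snd_add, sub_add_cancel, zero_add, AlgHom.commutes,
        Algebra.algebraMap_self, RingHom.id_apply]
      linarith⟩)
  refine ⟨g.comp (LinearMap.inr ℝ A C(A → EReal, ℝ)), fun a f h => ?_⟩
  have h1 : g (a, 0) = L a := hgF ⟨(a, 0), hmem a⟩
  have h2 := hgs (a, f) h
  have h3 : ((a, f) : A × C(A → EReal, ℝ)) = (a, 0) + (0, f) := by simp
  rwa [h3, map_add, h1] at h2

theorem isClosed_range_coe_char (A : Type*) [CommRing A] [Algebra ℝ A] :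
    IsClosed (range fun φ : A →ₐ[ℝ] ℝ => (φ : A → ℝ)) := by
  have h : (range fun φ : A →ₐ[ℝ] ℝ => (φ : A → ℝ)) =
      {f | f 1 = 1} ∩ (⋂ a, ⋂ b, {f | f (a * b) = f a * f b}) ∩
        (⋂ a, ⋂ b, {f | f (a + b) = f a + f b}) ∩
        ⋂ (c : ℝ), ⋂ a, {f : A → ℝ | f (c • a) = c • f a} := by
    ext f
    simp only [mem_range, mem_inter_iff, mem_iInter, mem_ofPred_eq]
    constructor
    · rintro ⟨φ, rfl⟩
      exact ⟨⟨⟨map_one φ, fun a b => map_mul φ a b⟩, fun a b => map_add φ a b⟩,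
        fun c a => map_smul φ c a⟩
    · rintro ⟨⟨⟨h1, hm⟩, ha⟩, hs⟩
      exact ⟨AlgHom.ofLinearMap ⟨⟨f, ha⟩, hs⟩ h1 hm, rfl⟩
  rw [h]
  refine ((IsClosed.inter ?_ ?_).inter ?_).inter ?_
  · exact isClosed_eq (continuous_apply _) continuous_const
  · exact isClosed_iInter fun a => isClosed_iInter fun b => isClosed_eq (by fun_prop) (by fun_prop)
  · exact isClosed_iInter fun a => isClosed_iInter fun b => isClosed_eq (by fun_prop) (by fun_prop)
  · exact isClosed_iInter fun a => isClosed_iInter fun b => isClosed_eq (by fun_prop) (by fun_prop)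

theorem isCompact_char_of_bounded {A : Type*} [CommRing A] [Algebra ℝ A] {C : Set (A →ₐ[ℝ] ℝ)}
    (hC : IsClosed C) (hb : ∀ a : A, ∃ M : ℝ, ∀ φ ∈ C, |φ a| ≤ M) : IsCompact C := by
  choose M hM using hb
  refine ((isInducing_coe_char A).isCompact_preimage (isClosed_range_coe_char A)
    (isCompact_univ_pi fun a => isCompact_Icc (a := -M a) (b := M a))).of_isClosed_subset hC ?_
  exact fun φ hφ a _ => abs_le.1 (hM a φ hφ)

/-- In a finitely generated algebra some element has compact sublevel sets. -/
theorem exists_isCompact_sublevel (A : Type*) [CommRing A] [Algebra ℝ A]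
    [hA : Algebra.FiniteType ℝ A] :
    ∃ p : A, (∀ φ : A →ₐ[ℝ] ℝ, 0 ≤ φ p) ∧ ∀ R : ℝ, IsCompact {φ : A →ₐ[ℝ] ℝ | φ p ≤ R} := by
  obtain ⟨t, ht⟩ := hA.out
  refine ⟨∑ b ∈ t, b ^ 2, fun φ => ?_, fun R => ?_⟩
  · simp only [map_sum, map_pow]
    positivity
  refine isCompact_char_of_bounded
    (isClosed_le (continuous_char_apply _) continuous_const) fun a => ?_
  have ha : a ∈ Algebra.adjoin ℝ (t : Set A) := ht ▸ Algebra.mem_top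
  induction ha using Algebra.adjoin_induction with
  | mem b hb =>
    refine ⟨√R, fun φ hφ => Real.abs_le_sqrt ?_⟩
    simp only [map_sum, map_pow, mem_ofPred_eq] at hφ
    exact (Finset.single_le_sum (f := fun b => φ b ^ 2) (fun _ _ => sq_nonneg _) hb).trans hφ
  | algebraMap r => exact ⟨|r|, fun φ _ => by simp⟩
  | add x y _ _ hx hy =>
    obtain ⟨M, hM⟩ := hx
    obtain ⟨N, hN⟩ := hy
    refine ⟨M + N, fun φ hφ => ?_⟩
    rw [map_add]
    exact (abs_add_le _ _).trans (add_le_add (hM φ hφ) (hN φ hφ))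
  | mul x y _ _ hx hy =>
    obtain ⟨M, hM⟩ := hx
    obtain ⟨N, hN⟩ := hy
    refine ⟨M * N, fun φ hφ => ?_⟩
    rw [map_mul, abs_mul]
    exact mul_le_mul (hM φ hφ) (hN φ hφ) (abs_nonneg _) ((abs_nonneg _).trans (hM φ hφ))

/-- The **Riesz–Haviland theorem** for finitely generated algebras. -/
theorem exists_isRepr_of_finiteType {A : Type*} [CommRing A] [Algebra ℝ A]
    [Nonempty (A →ₐ[ℝ] ℝ)] [Algebra.FiniteType ℝ A] (L : A →ₗ[ℝ] ℝ) (hL1 : L 1 = 1)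
    {K : Set (A →ₐ[ℝ] ℝ)} (hK : IsClosed K)
    (hpos : ∀ a : A, (∀ φ ∈ K, 0 ≤ φ a) → 0 ≤ L a) :
    ∃ ν : Measure (A →ₐ[ℝ] ℝ), IsRepr L K ν := by
  obtain ⟨Λ, hΛ⟩ := exists_positive_extension L hpos
  obtain ⟨p, hp0, hp⟩ := exists_isCompact_sublevel A
  have hΛ1 : Λ 1 = 1 := by
    have h1 := hΛ (-1) 1 fun φ _ => by simp
    have h2 := hΛ 1 (-1) fun φ _ => by simp
    rw [map_neg, hL1] at h1 h2
    linarith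
  refine exists_isRepr L hK Λ (fun f hf => ?_) hΛ1 (fun ε hε => ?_) (fun f hf hfK => ?_)
    (fun a M hM => ?_) (fun a M hM => ?_)
  · simpa using hΛ 0 f fun φ _ => by simpa using hf (charEmb φ)
  · have hLp : 0 ≤ L p := hpos p fun φ _ => hp0 φ
    have hR : 0 < L p / ε + 1 := by positivity
    refine ⟨_, hp (L p / ε + 1), fun f hf hf1 => ?_⟩
    have h := hΛ ((L p / ε + 1)⁻¹ • p - 1) f fun φ _ => by
      rw [map_sub, map_smul, map_one, smul_eq_mul]
      have h0 : 0 ≤ f (charEmb φ) := hf _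
      by_cases hφ : φ p ≤ L p / ε + 1
      · rw [hf1 φ hφ]
        have := mul_nonneg (inv_nonneg.2 hR.le) (hp0 φ)
        linarith
      · have : 1 ≤ (L p / ε + 1)⁻¹ * φ p := by
          rw [inv_mul_eq_div, one_le_div hR]
          exact (not_le.1 hφ).le
        linarith
    rw [map_sub, map_smul, hL1, smul_eq_mul] at h
    have : (L p / ε + 1)⁻¹ * L p ≤ ε := by
      rw [inv_mul_eq_div, div_le_iff₀ hR]
      have : ε * (L p / ε + 1) = L p + ε := by field_simp
      linarith
    linarith
  · have h := hΛ (-1) f fun φ hφ => by simp [hfK φ hφ]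
    rw [map_neg, hL1] at h
    linarith
  · have key : ∀ φ : A →ₐ[ℝ] ℝ, |clipEval M a (charEmb φ) - φ a| ≤ M⁻¹ * φ a ^ 2 := fun φ => by
      rw [inv_mul_eq_div]
      exact abs_clip_coe_sub_le hM (φ a)
    have h1 := hΛ (M⁻¹ • a ^ 2 - a) (clipEval M a) fun φ _ => by
      rw [map_sub, map_smul, map_pow, smul_eq_mul]
      linarith [(abs_le.1 (key φ)).1]
    have h2 := hΛ (M⁻¹ • a ^ 2 + a) (-clipEval M a) fun φ _ => by
      rw [map_add, map_smul, map_pow, smul_eq_mul, ContinuousMap.neg_apply]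
      linarith [(abs_le.1 (key φ)).2]
    rw [map_sub, map_smul, smul_eq_mul, inv_mul_eq_div] at h1
    rw [map_add, map_smul, map_neg, smul_eq_mul, inv_mul_eq_div] at h2
    rw [abs_le]
    constructor <;> linarith
  · have h := hΛ (a ^ 2) (-(clipEval M a ^ 2)) fun φ _ => by
      have : clipEval M a (charEmb φ) ^ 2 ≤ φ a ^ 2 := sq_le_sq.2 (abs_clip_coe_le M (φ a))
      simp only [map_pow, ContinuousMap.neg_apply, ContinuousMap.pow_apply]
      linarith
    rw [map_neg] at h
    linarith

theorem IsRepr.isProbabilityMeasure {A : Type*} [CommRing A] [Algebra ℝ A] {L : A →ₗ[ℝ] ℝ}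
    (hL1 : L 1 = 1) {K : Set (A →ₐ[ℝ] ℝ)} {μ : Measure (A →ₐ[ℝ] ℝ)} (h : IsRepr L K μ) :
    IsProbabilityMeasure μ := by
  obtain ⟨hi, he⟩ := h.2.2 1
  simp only [map_one] at hi he
  have : IsFiniteMeasure μ := (integrable_const_iff_isFiniteMeasure one_ne_zero).1 hi
  rw [hL1, integral_const, smul_eq_mul, mul_one] at he
  exact ⟨by rw [← ofReal_measureReal (measure_ne_top μ univ), ← he, ENNReal.ofReal_one]⟩

theorem continuous_resMap {A : Type*} [CommRing A] [Algebra ℝ A] (S : Subalgebra ℝ A) :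
    Continuous (resMap S) :=
  (isInducing_coe_char S).continuous_iff.2 <|
    continuous_pi fun a : S => continuous_char_apply (a : A)

theorem resL_one {A : Type*} [CommRing A] [Algebra ℝ A] {L : A →ₗ[ℝ] ℝ} (hL1 : L 1 = 1)
    (S : Subalgebra ℝ A) : resL L S 1 = 1 := hL1

/-- The push-forward of a representing measure represents the restricted functional. -/
theorem IsRepr.map_resMap {A : Type*} [CommRing A] [Algebra ℝ A] {L : A →ₗ[ℝ] ℝ}
    (hL1 : L 1 = 1) {K : Set (A →ₐ[ℝ] ℝ)} {ν : Measure (A →ₐ[ℝ] ℝ)} (h : IsRepr L K ν)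
    (S : Subalgebra ℝ A) : IsRepr (resL L S) (closure (resMap S '' K)) (ν.map (resMap S)) := by
  have := h.isProbabilityMeasure hL1
  have hc := continuous_resMap S
  have := h.1.2
  have hm := hc.measurable
  have := Measure.isProbabilityMeasure_map (μ := ν) hm.aemeasurable
  refine ⟨⟨IsFiniteMeasure.toIsLocallyFiniteMeasure _, Measure.InnerRegular.map_of_continuous hc⟩, ?_, fun b => ⟨?_, ?_⟩⟩
  · rw [Measure.map_apply hm isClosed_closure.measurableSet.compl]
    refine measure_mono_null (compl_subset_compl.2 fun φ hφ => ?_) h.2.1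
    exact subset_closure (mem_image_of_mem _ hφ)
  · rw [integrable_map_measure (continuous_char_apply b).aestronglyMeasurable hm.aemeasurable]
    exact (h.2.2 b).1
  · rw [integral_map hm.aemeasurable (continuous_char_apply b).aestronglyMeasurable]
    exact (h.2.2 b).2

theorem IsRepr.prokh_map_resMap {A : Type*} [CommRing A] [Algebra ℝ A] {L : A →ₗ[ℝ] ℝ}
    (hL1 : L 1 = 1) {K : Set (A →ₐ[ℝ] ℝ)} {ν : Measure (A →ₐ[ℝ] ℝ)} (h : IsRepr L K ν) :
    Prokh fun S : Subalgebra ℝ A => ν.map (resMap S) := by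
  have := h.isProbabilityMeasure hL1
  have := h.1.2
  intro ε hε
  obtain ⟨C, -, hC, hCε⟩ := MeasurableSet.univ.exists_lt_isCompact (μ := ν) (r := 1 - ε)
    (by rw [measure_univ]; exact ENNReal.sub_lt_self ENNReal.one_ne_top one_ne_zero hε.ne')
  refine ⟨C, hC, fun S _ => hCε.le.trans ?_⟩
  exact (measure_mono (subset_preimage_image (resMap S) C)).trans
    (Measure.le_map_apply (continuous_resMap S).measurable.aemeasurable _)

open Classical in
/-- Extension by zero of a character of a subalgebra to an extended real function. -/
noncomputable def extZero {A : Type*} [CommRing A] [Algebra ℝ A] (S : Subalgebra ℝ A)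
    (φ : S →ₐ[ℝ] ℝ) (a : A) : EReal :=
  if h : a ∈ S then (φ ⟨a, h⟩ : EReal) else 0

theorem extZero_of_mem {A : Type*} [CommRing A] [Algebra ℝ A] {S : Subalgebra ℝ A}
    (φ : S →ₐ[ℝ] ℝ) {a : A} (h : a ∈ S) : extZero S φ a = (φ ⟨a, h⟩ : EReal) := dif_pos h

theorem continuous_extZero {A : Type*} [CommRing A] [Algebra ℝ A] (S : Subalgebra ℝ A) :
    Continuous (extZero S) := by
  refine continuous_pi fun a => ?_
  by_cases h : a ∈ S
  · simp only [extZero, h, dif_pos]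
    exact continuous_coe_real_ereal.comp (continuous_char_apply (⟨a, h⟩ : S))
  · simpa only [extZero, h, dif_neg, not_false_iff] using continuous_const

/-- The characters of `S` that agree on `S` with some element of `C`. -/
def traceSet {A : Type*} [CommRing A] [Algebra ℝ A] (C : Set (A → EReal)) (S : Subalgebra ℝ A) :
    Set (S →ₐ[ℝ] ℝ) :=
  {φ | ∃ y ∈ C, ∀ a : S, y a = (φ a : EReal)}

theorem isClosed_traceSet {A : Type*} [CommRing A] [Algebra ℝ A] {C : Set (A → EReal)}
    (hC : IsCompact C) (S : Subalgebra ℝ A) : IsClosed (traceSet C S) := by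
  have h : IsClosed ((fun (y : A → EReal) (a : S) => y a) '' C) :=
    (hC.image (by fun_prop)).isClosed
  convert h.preimage (isEmbedding_charEmb S).continuous using 1
  ext φ
  simp only [traceSet, mem_ofPred_eq, mem_preimage, mem_image, funext_iff, charEmb]

theorem image_resMap_subset_traceSet {A : Type*} [CommRing A] [Algebra ℝ A]
    {C : Set (A → EReal)} {D : Set (A →ₐ[ℝ] ℝ)} (h : charEmb '' D ⊆ C) (S : Subalgebra ℝ A) :
    resMap S '' D ⊆ traceSet C S := by
  rintro _ ⟨φ, hφ, rfl⟩
  exact ⟨charEmb φ, h (mem_image_of_mem _ hφ), fun a => rfl⟩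

/-- A neighbourhood of a compact subset of a product contains all points that agree with some
point of the compact set on a suitable finite set of coordinates. -/
theorem IsCompact.exists_finset_forall_agree {ι : Type*} {X : ι → Type*}
    [∀ j, TopologicalSpace (X j)] {C W : Set (∀ j, X j)} (hC : IsCompact C) (hW : IsOpen W)
    (hCW : C ⊆ W) :
    ∃ F : Finset ι, ∀ y ∈ C, ∀ z : ∀ j, X j, (∀ j ∈ F, y j = z j) → z ∈ W := by
  classical
  refine hC.induction_on (p := fun C => ∃ F : Finset ι, ∀ y ∈ C, ∀ z : ∀ j, X j,
    (∀ j ∈ F, y j = z j) → z ∈ W) ⟨∅, by simp⟩ ?_ ?_ fun x hx => ?_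
  · rintro s t hst ⟨F, hF⟩
    exact ⟨F, fun y hy => hF y (hst hy)⟩
  · rintro s t ⟨F, hF⟩ ⟨G, hG⟩
    refine ⟨F ∪ G, fun y hy z hz => ?_⟩
    rcases hy with hy | hy
    · exact hF y hy z fun j hj => hz j (Finset.mem_union_left _ hj)
    · exact hG y hy z fun j hj => hz j (Finset.mem_union_right _ hj)
  · obtain ⟨F, u, hu, hFW⟩ := isOpen_pi_iff.1 hW x (hCW hx)
    refine ⟨(F : Set ι).pi u, mem_nhdsWithin_of_mem_nhds <|
      (isOpen_set_pi F.finite_toSet fun j hj => (hu j hj).1).mem_nhds fun j hj => (hu j hj).2,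
      F, fun y hy z hz => hFW fun j hj => ?_⟩
    rw [← hz j hj]
    exact hy j hj

theorem isDirectedOrder_fg (A : Type*) [CommRing A] [Algebra ℝ A] :
    IsDirectedOrder {S : Subalgebra ℝ A // S.FG} :=
  ⟨fun S T => ⟨⟨S.1 ⊔ T.1, S.2.sup T.2⟩, (le_sup_left : S.1 ≤ S.1 ⊔ T.1),
    (le_sup_right : T.1 ≤ S.1 ⊔ T.1)⟩⟩

theorem eventually_finset_subset {A : Type*} [CommRing A] [Algebra ℝ A] (F : Finset A) :
    ∀ᶠ S : {S : Subalgebra ℝ A // S.FG} in atTop, ∀ a ∈ F, a ∈ S.1 := by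
  filter_upwards [eventually_ge_atTop
    (⟨Algebra.adjoin ℝ (F : Set A), F, rfl⟩ : {S : Subalgebra ℝ A // S.FG})] with S hS a ha
  exact hS (Algebra.subset_adjoin ha)

/-- A linear functional that is a pointwise limit point of a net of probability measures. -/
theorem exists_linearMap_tendsto_integral {ι Y : Type*} [TopologicalSpace Y] [CompactSpace Y]
    {X : ι → Type*} [∀ k, TopologicalSpace (X k)] [∀ k, MeasurableSpace (X k)]
    [∀ k, BorelSpace (X k)] (μ : ∀ k, Measure (X k)) [∀ k, IsProbabilityMeasure (μ k)]
    (j : ∀ k, X k → Y) (hj : ∀ k, Continuous (j k)) (𝒰 : Ultrafilter ι) :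
    ∃ Λ : C(Y, ℝ) →ₗ[ℝ] ℝ, ∀ f, Tendsto (fun k => ∫ x, f (j k x) ∂μ k) 𝒰 (𝓝 (Λ f)) := by
  have hlim : ∀ f : C(Y, ℝ), ∃ l, Tendsto (fun k => ∫ x, f (j k x) ∂μ k) 𝒰 (𝓝 l) := by
    intro f
    obtain ⟨l, -, hl⟩ := (isCompact_Icc (a := -‖f‖) (b := ‖f‖)).ultrafilter_le_nhds
      (𝒰.map fun k => ∫ x, f (j k x) ∂μ k) (by
        refine le_principal_iff.2 (Eventually.of_forall (f := (𝒰 : Filter ι)) fun k => ?_)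
        refine abs_le.1 ?_
        simpa using norm_integral_le_of_norm_le_const (μ := μ k)
          (ae_of_all _ fun x => f.norm_coe_le_norm (j k x)))
    exact ⟨l, hl⟩
  choose Λ hΛ using hlim
  refine ⟨⟨⟨Λ, fun f g => ?_⟩, fun c f => ?_⟩, hΛ⟩
  · refine tendsto_nhds_unique (hΛ (f + g)) (((hΛ f).add (hΛ g)).congr fun k => ?_)
    exact (integral_add (integrable_comp_of_continuous f (hj k))
      (integrable_comp_of_continuous g (hj k))).symm
  · refine tendsto_nhds_unique (hΛ (c • f)) (((hΛ f).const_mul c).congr fun k => ?_)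
    exact (integral_const_mul c fun x => f (j k x)).symm

theorem le_of_forall_le_measureReal_traceSet {A : Type*} [CommRing A] [Algebra ℝ A]
    {μ : ∀ S : {S : Subalgebra ℝ A // S.FG}, Measure (S.1 →ₐ[ℝ] ℝ)}
    [∀ S, IsProbabilityMeasure (μ S)] {𝒰 : Filter {S : Subalgebra ℝ A // S.FG}} [𝒰.NeBot]
    (h𝒰 : 𝒰 ≤ atTop) {C : Set (A → EReal)} (hC : IsCompact C) {c : ℝ}
    (hc : ∀ S, c ≤ (μ S).real (traceSet C S.1)) {f : C(A → EReal, ℝ)} (hf : 0 ≤ f)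
    (hfC : ∀ y ∈ C, f y = 1) {l : ℝ}
    (hl : Tendsto (fun S => ∫ φ, f (extZero S.1 φ) ∂μ S) 𝒰 (𝓝 l)) : c ≤ l := by
  have key : ∀ δ ∈ Ioo (0 : ℝ) 1, (1 - δ) * c ≤ l := by
    intro δ hδ
    obtain ⟨F, hF⟩ := IsCompact.exists_finset_forall_agree hC
      (isOpen_lt continuous_const f.continuous : IsOpen {y | 1 - δ < f y})
      (fun y hy => by simp [hfC y hy, hδ.1])
    refine ge_of_tendsto hl (((eventually_finset_subset F).filter_mono h𝒰).mono fun S hS => ?_)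
    have h1 := mul_meas_ge_le_integral_of_nonneg (μ := μ S)
      (f := fun φ => f (extZero S.1 φ)) (ae_of_all _ fun φ => hf _)
      (integrable_comp_of_continuous f (continuous_extZero S.1)) (1 - δ)
    refine le_trans (mul_le_mul_of_nonneg_left ((hc S).trans ?_) (by linarith [hδ.2])) h1
    refine measureReal_mono ?_
    rintro φ ⟨y, hy, hyφ⟩
    refine le_of_lt (show _ < f (extZero S.1 φ) from hF y hy _ fun a ha => ?_)
    rw [extZero_of_mem φ (hS a ha)]
    exact hyφ ⟨a, hS a ha⟩
  have hlim : Tendsto (fun δ : ℝ => (1 - δ) * c) (𝓝[>] 0) (𝓝 c) := by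
    have : Tendsto (fun δ : ℝ => (1 - δ) * c) (𝓝 0) (𝓝 ((1 - 0) * c)) :=
      Continuous.tendsto (by fun_prop) 0
    simpa using this.mono_left nhdsWithin_le_nhds
  exact le_of_tendsto hlim ((Ioo_mem_nhdsGT one_pos) |> Filter.mem_of_superset <| key)

/-- Representing measures of the restrictions of `L` to finitely generated subalgebras that fulfil
Prokhorov's condition yield a representing measure of `L`. -/
theorem exists_isRepr_of_prokh {A : Type*} [CommRing A] [Algebra ℝ A] [Nonempty (A →ₐ[ℝ] ℝ)]
    (L : A →ₗ[ℝ] ℝ) (hL1 : L 1 = 1) {K : Set (A →ₐ[ℝ] ℝ)} (hK : IsClosed K)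
    (μf : ∀ S : Subalgebra ℝ A, Measure (S →ₐ[ℝ] ℝ))
    (hμ : ∀ S : Subalgebra ℝ A, S.FG → IsRepr (resL L S) (closure (resMap S '' K)) (μf S))
    (hP : Prokh μf) : ∃ ν : Measure (A →ₐ[ℝ] ℝ), IsRepr L K ν := by
  have := isDirectedOrder_fg A
  have : Nonempty {S : Subalgebra ℝ A // S.FG} := ⟨⟨⊥, Subalgebra.fg_bot⟩⟩
  have hprob : ∀ S : {S : Subalgebra ℝ A // S.FG}, IsProbabilityMeasure (μf S.1) := fun S =>
    (hμ S.1 S.2).isProbabilityMeasure (resL_one hL1 S.1)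
  let 𝒰 : Ultrafilter {S : Subalgebra ℝ A // S.FG} := Ultrafilter.of atTop
  have h𝒰 : (𝒰 : Filter {S : Subalgebra ℝ A // S.FG}) ≤ atTop := Ultrafilter.of_le atTop
  obtain ⟨Λ, hΛ⟩ := exists_linearMap_tendsto_integral
    (fun S : {S : Subalgebra ℝ A // S.FG} => μf S.1) (fun S => extZero S.1)
    (fun S => continuous_extZero S.1) 𝒰
  have hmem : ∀ a : A, ∀ᶠ S : {S : Subalgebra ℝ A // S.FG} in 𝒰, a ∈ S.1 := fun a =>
    ((eventually_finset_subset {a}).filter_mono h𝒰).mono fun S hS =>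
      hS a (Finset.mem_singleton_self a)
  have hext : ∀ (M : ℝ) {a : A} {S : Subalgebra ℝ A} (ha : a ∈ S) (φ : S →ₐ[ℝ] ℝ),
      clipEval M a (extZero S φ) = clip M (φ ⟨a, ha⟩) := fun M a S ha φ =>
    congrArg (clip M) (extZero_of_mem φ ha)
  have hsq : ∀ {a : A} (S : {S : Subalgebra ℝ A // S.FG}) (ha : a ∈ S.1),
      Integrable (fun φ : S.1 →ₐ[ℝ] ℝ => φ ⟨a, ha⟩ ^ 2) (μf S.1) ∧
        L (a ^ 2) = ∫ φ : S.1 →ₐ[ℝ] ℝ, φ ⟨a, ha⟩ ^ 2 ∂μf S.1 := fun S ha => by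
    have h := (hμ S.1 S.2).2.2 (⟨_, ha⟩ ^ 2)
    simp only [map_pow] at h
    exact h
  refine exists_isRepr L hK Λ (fun f hf => ?_) ?_ (fun ε hε => ?_) (fun f hf hfK => ?_)
    (fun a M hM => ?_) (fun a M hM => ?_)
  · exact ge_of_tendsto (hΛ f) (Eventually.of_forall fun S => integral_nonneg fun φ => hf _)
  · exact tendsto_nhds_unique (hΛ 1) (by simp)
  · obtain ⟨C, hC, hCμ⟩ := hP (ENNReal.ofReal ε) (ENNReal.ofReal_pos.2 hε)
    refine ⟨C, hC, fun f hf hfC => ?_⟩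
    refine le_of_forall_le_measureReal_traceSet h𝒰
      (hC.image (isEmbedding_charEmb A).continuous) (fun S => ?_) hf ?_ (hΛ f)
    · have h := (hCμ S.1 S.2).trans (measure_mono (image_resMap_subset_traceSet subset_rfl S.1))
      rw [← ENNReal.ofReal_one, ← ENNReal.ofReal_sub _ hε.le] at h
      exact (ENNReal.ofReal_le_iff_le_toReal (measure_ne_top _ _)).1 h
    · rintro _ ⟨φ, hφ, rfl⟩
      exact hfC φ hφ
  · refine le_of_forall_le_measureReal_traceSet h𝒰
      (isClosed_closure (s := charEmb '' K)).isCompact (fun S => ?_) hf ?_ (hΛ f)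
    · have h1 : closure (resMap S.1 '' K) ⊆ traceSet (closure (charEmb '' K)) S.1 :=
        closure_minimal (image_resMap_subset_traceSet subset_closure S.1)
          (isClosed_traceSet isClosed_closure.isCompact S.1)
      have h2 : (μf S.1).real (closure (resMap S.1 '' K)) = 1 := by
        rw [Measure.real, (prob_compl_eq_zero_iff isClosed_closure.measurableSet).1
          (hμ S.1 S.2).2.1, ENNReal.toReal_one]
      exact h2.symm.le.trans (measureReal_mono h1)
    · exact closure_minimal (t := {y | f y = 1}) (by rintro _ ⟨φ, hφ, rfl⟩; exact hfK φ hφ)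
        (isClosed_eq f.continuous continuous_const)
  · refine le_of_tendsto ((hΛ (clipEval M a)).sub_const (L a)).abs
      ((hmem a).mono fun S ha => ?_)
    obtain ⟨hi, he⟩ := (hμ S.1 S.2).2.2 ⟨a, ha⟩
    obtain ⟨hi2, he2⟩ := hsq S ha
    rw [show L a = _ from he, he2, ← integral_div, ← integral_sub
      (integrable_comp_of_continuous _ (continuous_extZero S.1)) hi]
    refine (abs_integral_le_integral_abs).trans (integral_mono_of_nonneg
      (ae_of_all _ fun φ => abs_nonneg _) (hi2.div_const M) (ae_of_all _ fun φ => ?_))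
    simp only [hext M ha]
    exact abs_clip_coe_sub_le hM _
  · refine le_of_tendsto (hΛ (clipEval M a ^ 2)) ((hmem a).mono fun S ha => ?_)
    obtain ⟨hi2, he2⟩ := hsq S ha
    rw [he2]
    refine integral_mono (integrable_comp_of_continuous _ (continuous_extZero S.1)) hi2
      fun φ => ?_
    simp only [ContinuousMap.pow_apply, hext M ha]
    exact sq_le_sq.2 (abs_clip_coe_le M _)

/-- Generalized Riesz–Haviland theorem: if `L` is non-negative on `Pos_A(K)`, then
(i) each `L|_S` has a `closure (π_S '' K)`-representing Radon measure; and
(ii) `L` has a `K`-representing Radon measure iff there is a family of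
`closure (π_S '' K)`-representing Radon measures fulfilling Prokhorov's condition. -/
theorem generalized_riesz_haviland
    (A : Type*) [CommRing A] [Algebra ℝ A] [Nonempty (A →ₐ[ℝ] ℝ)]
    (L : A →ₗ[ℝ] ℝ) (hL1 : L 1 = 1)
    (K : Set (A →ₐ[ℝ] ℝ)) (hK : IsClosed K)
    (hpos : ∀ a : A, (∀ α ∈ K, 0 ≤ α a) → 0 ≤ L a) :
    (∀ S : Subalgebra ℝ A, S.FG →
        ∃ μS : Measure (↥S →ₐ[ℝ] ℝ), IsRepr (resL L S) (closure (resMap S '' K)) μS) ∧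
      ((∃ ν : Measure (A →ₐ[ℝ] ℝ), IsRepr L K ν) ↔
        (∃ μf : ∀ S : Subalgebra ℝ A, Measure (↥S →ₐ[ℝ] ℝ),
          (∀ S : Subalgebra ℝ A, S.FG →
            IsRepr (resL L S) (closure (resMap S '' K)) (μf S)) ∧ Prokh μf)) := by
  refine ⟨fun S hS => ?_, fun ⟨ν, hν⟩ => ?_, fun ⟨μf, hμ, hP⟩ => ?_⟩
  · have : Algebra.FiniteType ℝ S := S.fg_iff_finiteType.1 hS
    have : Nonempty (S →ₐ[ℝ] ℝ) := ‹Nonempty (A →ₐ[ℝ] ℝ)›.map (resMap S)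
    refine exists_isRepr_of_finiteType (resL L S) (resL_one hL1 S) isClosed_closure
      fun a ha => hpos a fun α hα => ?_
    exact ha (resMap S α) (subset_closure (mem_image_of_mem _ hα))
  · exact ⟨fun S => ν.map (resMap S), fun S _ => hν.map_resMap hL1 S, hν.prokh_map_resMap hL1⟩
  · exact exists_isRepr_of_prokh L hL1 hK μf hμ hP

end Stmt16
end

section
/- Let A be a unital commutative real algebra, K ⊆ X(A) closed, and p ∈ A such that p̂ ≥ 0 on K and K_n := {α ∈ K : p̂(α) ≤ n} is compact for each n ∈ ℕ. Then for every linear L : A → ℝ with L(1) = 1 and L(a) ≥ 0 for every a ∈ A with â ≥ 0 on K, there exists a K-representing Radon measure ν for L on the Borel σ-algebra of X(A). -/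
open MeasureTheory
open scoped ENNReal

namespace Stmt17

/-- The weak topology on the character space `B →ₐ[ℝ] ℝ`. -/
instance charTopology (B : Type*) [CommRing B] [Algebra ℝ B] :
    TopologicalSpace (B →ₐ[ℝ] ℝ) :=
  TopologicalSpace.induced (fun φ : B →ₐ[ℝ] ℝ => (φ : B → ℝ)) inferInstance

/-- The Borel σ-algebra of the weak topology on the character space. -/
instance charMeasurableSpace (B : Type*) [CommRing B] [Algebra ℝ B] :
    MeasurableSpace (B →ₐ[ℝ] ℝ) := borel _

instance charBorelSpace (B : Type*) [CommRing B] [Algebra ℝ B] :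
    BorelSpace (B →ₐ[ℝ] ℝ) := ⟨rfl⟩

/-- The restriction map `π_S : X(A) → X(S)` for a subalgebra `S` of `A`. -/
def resMap {A : Type*} [CommRing A] [Algebra ℝ A] (S : Subalgebra ℝ A) :
    (A →ₐ[ℝ] ℝ) → (S →ₐ[ℝ] ℝ) := fun φ => φ.comp S.val

/-- The restriction map `π_{S,T} : X(T) → X(S)` for subalgebras `S ≤ T` of `A`. -/
def resTrans {A : Type*} [CommRing A] [Algebra ℝ A] {S T : Subalgebra ℝ A} (h : S ≤ T) :
    (T →ₐ[ℝ] ℝ) → (S →ₐ[ℝ] ℝ) := fun φ => φ.comp (Subalgebra.inclusion h)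

/-- The restriction `L|_S` of a linear functional `L : A → ℝ` to a subalgebra `S`. -/
def resL {A : Type*} [CommRing A] [Algebra ℝ A] (L : A →ₗ[ℝ] ℝ) (S : Subalgebra ℝ A) :
    (↥S) →ₗ[ℝ] ℝ := L.comp (Subalgebra.val S).toLinearMap

/-- A Radon measure: locally finite and inner regular w.r.t. compact sets. -/
def IsRadon {α : Type*} [TopologicalSpace α] [MeasurableSpace α] (μ : Measure α) : Prop :=
  IsLocallyFiniteMeasure μ ∧ μ.InnerRegular

/-- `μ` is a `K`-representing Radon measure for the linear functional `L` on `B`. -/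
def IsRepr {B : Type*} [CommRing B] [Algebra ℝ B] (L : B →ₗ[ℝ] ℝ)
    (K : Set (B →ₐ[ℝ] ℝ)) (μ : Measure (B →ₐ[ℝ] ℝ)) : Prop :=
  IsRadon μ ∧ μ Kᶜ = 0 ∧
    ∀ b : B, Integrable (fun φ : B →ₐ[ℝ] ℝ => φ b) μ ∧
      L b = ∫ φ : B →ₐ[ℝ] ℝ, φ b ∂μ

/-- Prokhorov's condition for a family of measures indexed by the finitely generated
subalgebras of `A`. -/
def Prokh {A : Type*} [CommRing A] [Algebra ℝ A]
    (μf : ∀ S : Subalgebra ℝ A, Measure (↥S →ₐ[ℝ] ℝ)) : Prop :=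
  ∀ ε : ℝ≥0∞, 0 < ε → ∃ C : Set (A →ₐ[ℝ] ℝ), IsCompact C ∧
    ∀ S : Subalgebra ℝ A, S.FG → 1 - ε ≤ μf S (resMap S '' C)

section Haviland

open Filter Topology CompactlySupported

variable {X A : Type*} [TopologicalSpace X] [CommRing A] [Algebra ℝ A]

/-- The extension of a linear functional that is positive with respect to an algebra homomorphism
`e : A → C(X, ℝ)` to a functional on `A × C_c(X, ℝ)` that is positive on the cone of all pairs
`(a, f)` with `e a + f ≥ 0`. -/
theorem exists_positive_extension (e : A →ₐ[ℝ] C(X, ℝ)) (L : A →ₗ[ℝ] ℝ)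
    (hL : ∀ a, (∀ x, 0 ≤ e a x) → 0 ≤ L a) :
    ∃ g : A × C_c(X, ℝ) →ₗ[ℝ] ℝ, (∀ a, g (a, 0) = L a) ∧
      ∀ a f, (∀ x, 0 ≤ e a x + f x) → 0 ≤ g (a, f) := by
  let s : PointedCone ℝ (A × C_c(X, ℝ)) :=
    { carrier := {q | ∀ x, 0 ≤ e q.1 x + q.2 x}
      zero_mem' := fun x => by simp
      add_mem' := fun {q r} hq hr x => by
        have h₁ := hq x
        have h₂ := hr x
        simp only [Prod.fst_add, Prod.snd_add, map_add, ContinuousMap.add_apply,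
          CompactlySupportedContinuousMap.coe_add, Pi.add_apply]
        linarith
      smul_mem' := fun c q hq x => by
        have h : 0 ≤ (c : ℝ) * (e q.1 x + q.2 x) := mul_nonneg c.2 (hq x)
        have h₁ : c • q = (c : ℝ) • q := rfl
        rw [h₁]
        simp only [Prod.smul_fst, Prod.smul_snd, map_smul, ContinuousMap.smul_apply,
          CompactlySupportedContinuousMap.coe_smul, Pi.smul_apply, smul_eq_mul]
        linarith }
  let f : A × C_c(X, ℝ) →ₗ.[ℝ] ℝ :=
    { domain := Submodule.prod ⊤ ⊥
      toFun := (L ∘ₗ LinearMap.fst ℝ A C_c(X, ℝ)) ∘ₗ Submodule.subtype _ }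
  have hdom : ∀ a : A, (a, (0 : C_c(X, ℝ))) ∈ f.domain := fun a =>
    ⟨Submodule.mem_top, Submodule.zero_mem _⟩
  have nonneg : ∀ x : f.domain, (x : A × C_c(X, ℝ)) ∈ s → 0 ≤ f x := by
    rintro ⟨⟨a, w⟩, _, hw⟩ h
    obtain rfl : w = 0 := hw
    refine hL a fun x => ?_
    simpa using h x
  have dense : ∀ y, ∃ x : f.domain, (x : A × C_c(X, ℝ)) + y ∈ s := by
    rintro ⟨a, w⟩
    obtain ⟨C, hC⟩ := w.hasCompactSupport.exists_bound_of_continuous w.continuous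
    refine ⟨⟨_, hdom (-a + algebraMap ℝ A C)⟩, fun x => ?_⟩
    have h := neg_le_of_abs_le (hC x)
    have h₁ : e (algebraMap ℝ A C) x = C := by rw [AlgHom.commutes]; simp
    have h₂ : e (-a + algebraMap ℝ A C + a) x = C := by
      rw [show -a + algebraMap ℝ A C + a = algebraMap ℝ A C by ring, h₁]
    simp only [Prod.mk_add_mk, zero_add]
    linarith
  obtain ⟨g, hg, hgs⟩ := riesz_extension s f nonneg dense
  exact ⟨g, fun a => hg ⟨_, hdom a⟩, fun a f h => hgs (a, f) h⟩

/-- The cutoff function `max 0 (1 - f / (n + 1))`. -/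
noncomputable def cutoff (f : C(X, ℝ)) (n : ℕ) : C(X, ℝ) :=
  ⟨fun x => max 0 (1 - f x / (n + 1)), by fun_prop⟩

theorem cutoff_apply (f : C(X, ℝ)) (n : ℕ) (x : X) :
    cutoff f n x = max 0 (1 - f x / (n + 1)) := rfl

theorem cutoff_nonneg (f : C(X, ℝ)) (n : ℕ) (x : X) : 0 ≤ cutoff f n x :=
  le_max_left _ _

theorem cutoff_le_one {f : C(X, ℝ)} {x : X} (hf : 0 ≤ f x) (n : ℕ) : cutoff f n x ≤ 1 := by
  have : 0 ≤ f x / (n + 1) := by positivity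
  exact max_le zero_le_one (by linarith)

theorem one_sub_cutoff_le (f : C(X, ℝ)) (n : ℕ) (x : X) :
    1 - cutoff f n x ≤ f x / (n + 1) := by
  have : 1 - f x / (n + 1) ≤ cutoff f n x := le_max_right _ _
  linarith

theorem tendsto_cutoff {f : C(X, ℝ)} {x : X} (hf : 0 ≤ f x) :
    Tendsto (fun n => cutoff f n x) atTop (𝓝 1) := by
  have h : Tendsto (fun n : ℕ => 1 - f x / ((n : ℝ) + 1)) atTop (𝓝 1) := by
    simpa [div_eq_mul_inv] using
      (tendsto_one_div_add_atTop_nhds_zero_nat.const_mul (f x)).const_sub (1 : ℝ)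
  exact tendsto_of_tendsto_of_tendsto_of_le_of_le h tendsto_const_nhds
    (fun n => le_max_right _ _) (fun n => cutoff_le_one hf n)

theorem hasCompactSupport_cutoff [T2Space X] {f : C(X, ℝ)}
    (hf : ∀ n : ℕ, IsCompact {x | f x ≤ n}) (n : ℕ) : HasCompactSupport (cutoff f n) := by
  refine HasCompactSupport.intro (hf (n + 1)) fun x hx => ?_
  have hx : (n : ℝ) + 1 < f x := by simpa using hx
  have : 1 ≤ f x / ((n : ℝ) + 1) := by
    rw [le_div_iff₀ (by positivity)]; linarith
  exact max_eq_left (by linarith)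

theorem locallyCompactSpace_of_isCompact_sublevel [T2Space X] {f : C(X, ℝ)}
    (hf : ∀ n : ℕ, IsCompact {x | f x ≤ n}) : LocallyCompactSpace X := by
  have : WeaklyLocallyCompactSpace X := ⟨fun x => by
    obtain ⟨n, hn⟩ := exists_nat_gt (f x)
    exact ⟨_, hf n, mem_of_superset
      ((isOpen_lt f.continuous continuous_const).mem_nhds hn) fun y (hy : f y < n) => hy.le⟩⟩
  infer_instance

/-- **Haviland's theorem** on a space with a proper function `e p`: a positive functional is
integration against a finite regular measure. -/
theorem exists_measure_of_isCompact_sublevel [T2Space X] [MeasurableSpace X] [BorelSpace X]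
    (e : A →ₐ[ℝ] C(X, ℝ)) (L : A →ₗ[ℝ] ℝ) (hL : ∀ a, (∀ x, 0 ≤ e a x) → 0 ≤ L a)
    (p : A) (hp : ∀ x, 0 ≤ e p x) (hc : ∀ n : ℕ, IsCompact {x | e p x ≤ n}) :
    ∃ μ : Measure X, IsFiniteMeasure μ ∧ μ.Regular ∧
      ∀ a, Integrable (e a) μ ∧ L a = ∫ x, e a x ∂μ := by
  have := locallyCompactSpace_of_isCompact_sublevel hc
  obtain ⟨g, hgL, hg⟩ := exists_positive_extension e L hL
  let Λ : C_c(X, ℝ) →ₚ[ℝ] ℝ := PositiveLinearMap.mk₀ (g ∘ₗ LinearMap.inr ℝ A C_c(X, ℝ))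
    fun f hf => hg 0 f fun x => by simpa using hf x
  have hΛ : ∀ f, Λ f = g (0, f) := fun f => rfl
  let μ := RealRMK.rieszMeasure Λ
  let t : A → ℕ → C_c(X, ℝ) := fun a n =>
    ⟨e a * cutoff (e p) n, (hasCompactSupport_cutoff hc n).mul_left⟩
  have ht : ∀ a n x, t a n x = e a x * cutoff (e p) n x := fun a n x => rfl
  have hint : ∀ a n, ∫ x, e a x * cutoff (e p) n x ∂μ = g (0, t a n) := fun a n =>
    RealRMK.integral_rieszMeasure Λ (t a n)
  have hti : ∀ a n, Integrable (fun x => e a x * cutoff (e p) n x) μ := fun a n =>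
    (t a n).continuous.integrable_of_hasCompactSupport (t a n).hasCompactSupport
  have hlim : ∀ a x, Tendsto (fun n => e a x * cutoff (e p) n x) atTop (𝓝 (e a x)) :=
    fun a x => by simpa using (tendsto_cutoff (hp x)).const_mul (e a x)
  have hsplit : ∀ a f, g (a, f) = L a + g (0, f) := fun a f => by
    rw [← hgL, ← map_add]; simp
  have hnonneg : ∀ a, (∀ x, 0 ≤ e a x) → Integrable (e a) μ := fun a ha => by
    refine ⟨(e a).continuous.aestronglyMeasurable, ?_⟩
    have hbound : ∀ n, ∫⁻ x, ‖e a x * cutoff (e p) n x‖ₑ ∂μ ≤ ENNReal.ofReal (L a) := fun n => by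
      rw [← ofReal_integral_norm_eq_lintegral_enorm (hti a n)]
      apply ENNReal.ofReal_le_ofReal
      simp_rw [Real.norm_of_nonneg (mul_nonneg (ha _) (cutoff_nonneg (e p) n _))]
      rw [hint]
      have h := hg a (-t a n) fun x => by
        have := mul_le_mul_of_nonneg_left (cutoff_le_one (hp x) n) (ha x)
        simp only [CompactlySupportedContinuousMap.coe_neg, Pi.neg_apply, ht]
        linarith
      have h₁ : g (0, -t a n) = -g (0, t a n) := by rw [← map_neg]; simp
      rw [hsplit, h₁] at h
      linarith
    calc ∫⁻ x, ‖e a x‖ₑ ∂μ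
        = ∫⁻ x, liminf (fun n => ‖e a x * cutoff (e p) n x‖ₑ) atTop ∂μ :=
          lintegral_congr fun x => ((hlim a x).enorm.liminf_eq).symm
      _ ≤ liminf (fun n => ∫⁻ x, ‖e a x * cutoff (e p) n x‖ₑ ∂μ) atTop :=
          lintegral_liminf_le' fun n => (hti a n).aestronglyMeasurable.aemeasurable.enorm
      _ ≤ ENNReal.ofReal (L a) :=
          (liminf_le_liminf (Eventually.of_forall hbound)).trans (by simp)
      _ < ∞ := ENNReal.ofReal_lt_top
  have hsq : ∀ a x, e (a * a + 1) x = e a x * e a x + 1 := fun a x => by simp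
  have habs : ∀ a x, |e a x| ≤ e (a * a + 1) x := fun a x => by
    rw [hsq, abs_le]; constructor <;> nlinarith [sq_nonneg (e a x - 1), sq_nonneg (e a x + 1)]
  have hdom : ∀ a, Integrable (e (a * a + 1)) μ := fun a =>
    hnonneg _ fun x => (abs_nonneg _).trans (habs a x)
  have hI : ∀ a, Integrable (e a) μ := fun a =>
    (hdom a).mono' (e a).continuous.aestronglyMeasurable (Eventually.of_forall (habs a))
  refine ⟨μ, ?_, RealRMK.regular_rieszMeasure Λ, fun a => ⟨hI a, ?_⟩⟩
  · have h : Integrable (fun _ : X => (1 : ℝ)) μ := by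
      have h₁ := hI 1
      rw [map_one] at h₁
      exact h₁
    exact (integrable_const_iff_isFiniteMeasure one_ne_zero).1 h
  have h₁ : Tendsto (fun n => g (0, t a n)) atTop (𝓝 (∫ x, e a x ∂μ)) := by
    simp_rw [← hint]
    refine tendsto_integral_of_dominated_convergence _ (fun n => (hti a n).aestronglyMeasurable)
      (hdom a) (fun n => Eventually.of_forall fun x => ?_) (Eventually.of_forall (hlim a))
    rw [norm_mul, Real.norm_of_nonneg (cutoff_nonneg (e p) n x)]
    exact (mul_le_of_le_one_right (norm_nonneg _) (cutoff_le_one (hp x) n)).trans (habs a x)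
  have hle : ∀ b n, L b - g (0, t b n) ≤ L ((b * b + 1) * p) * (1 / ((n : ℝ) + 1)) ∧
      g (0, t b n) - L b ≤ L ((b * b + 1) * p) * (1 / ((n : ℝ) + 1)) := fun b n => by
    have key : ∀ x, |e b x * (1 - cutoff (e p) n x)| ≤
        e ((1 / ((n : ℝ) + 1)) • ((b * b + 1) * p)) x := fun x => by
      rw [abs_mul, abs_of_nonneg (sub_nonneg.2 (cutoff_le_one (hp x) n))]
      refine (mul_le_mul (habs b x) (one_sub_cutoff_le (e p) n x)
        (sub_nonneg.2 (cutoff_le_one (hp x) n)) ((abs_nonneg _).trans (habs b x))).trans_eq ?_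
      rw [map_smul, map_mul e, ContinuousMap.smul_apply, ContinuousMap.mul_apply, smul_eq_mul]
      ring
    have h₁ := hg ((1 / ((n : ℝ) + 1)) • ((b * b + 1) * p) - b) (t b n) fun x => by
      have := (abs_le.1 (key x)).2
      rw [map_sub, ContinuousMap.sub_apply, ht]
      linarith
    have h₂ := hg ((1 / ((n : ℝ) + 1)) • ((b * b + 1) * p) + b) (-t b n) fun x => by
      have := (abs_le.1 (key x)).1
      rw [map_add, ContinuousMap.add_apply, CompactlySupportedContinuousMap.coe_neg,
        Pi.neg_apply, ht]
      linarith
    have h₃ : g (0, -t b n) = -g (0, t b n) := by rw [← map_neg]; simp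
    rw [hsplit, map_sub, map_smul, smul_eq_mul] at h₁
    rw [hsplit, map_add, map_smul, smul_eq_mul, h₃] at h₂
    constructor <;> linarith
  have h₂ : Tendsto (fun n => g (0, t a n)) atTop (𝓝 (L a)) := by
    rw [tendsto_iff_norm_sub_tendsto_zero]
    refine squeeze_zero (fun _ => norm_nonneg _)
      (fun n => abs_le.2 ⟨?_, (hle a n).2⟩) ?_
    · linarith [(hle a n).1]
    · simpa using tendsto_one_div_add_atTop_nhds_zero_nat.const_mul (L ((a * a + 1) * p))
  exact tendsto_nhds_unique h₂ h₁

end Haviland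

section CharacterSpace

variable {A : Type*} [CommRing A] [Algebra ℝ A]

theorem continuous_char_eval (a : A) : Continuous fun φ : A →ₐ[ℝ] ℝ => φ a :=
  (continuous_apply a).comp continuous_induced_dom

instance charT2Space : T2Space (A →ₐ[ℝ] ℝ) :=
  .of_injective_continuous (f := fun φ : A →ₐ[ℝ] ℝ => (φ : A → ℝ)) DFunLike.coe_injective
    continuous_induced_dom

/-- Evaluation `a ↦ â|_K` as an algebra homomorphism into the continuous functions on `K`. -/
def evalOn (K : Set (A →ₐ[ℝ] ℝ)) : A →ₐ[ℝ] C(K, ℝ) where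
  toFun a := ⟨fun φ => φ.1 a, (continuous_char_eval a).comp continuous_subtype_val⟩
  map_one' := by ext; simp
  map_mul' _ _ := by ext; simp
  map_zero' := by ext; simp
  map_add' _ _ := by ext; simp
  commutes' _ := by ext; simp

end CharacterSpace

/-- If `p̂ ≥ 0` on the closed set `K` and each `K_n = {α ∈ K : p̂(α) ≤ n}` is compact, then
every linear functional `L` with `L(1) = 1` that is non-negative on `Pos_A(K)` has a
`K`-representing Radon measure. -/
theorem representing_of_compact_sublevels
    (A : Type*) [CommRing A] [Algebra ℝ A] [Nonempty (A →ₐ[ℝ] ℝ)]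
    (K : Set (A →ₐ[ℝ] ℝ)) (hK : IsClosed K)
    (p : A) (hp : ∀ α ∈ K, 0 ≤ α p)
    (hKn : ∀ n : ℕ, IsCompact {α ∈ K | α p ≤ (n : ℝ)})
    (L : A →ₗ[ℝ] ℝ) (hL1 : L 1 = 1)
    (hpos : ∀ a : A, (∀ α ∈ K, 0 ≤ α a) → 0 ≤ L a) :
    ∃ ν : Measure (A →ₐ[ℝ] ℝ), IsRepr L K ν := by
  obtain ⟨μ, hfin, hreg, hμ⟩ := exists_measure_of_isCompact_sublevel (evalOn K) L
    (fun a ha => hpos a fun α hα => ha ⟨α, hα⟩) p (fun x => hp x x.2) fun n => by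
      rw [Subtype.isCompact_iff]
      convert hKn n using 1
      ext α
      exact ⟨fun ⟨x, hx, h⟩ => h ▸ ⟨x.2, hx⟩, fun h => ⟨⟨α, h.1⟩, h.2, rfl⟩⟩
  have hm : Measurable (Subtype.val : K → (A →ₐ[ℝ] ℝ)) := measurable_subtype_coe
  refine ⟨μ.map Subtype.val, ⟨inferInstance, ?_⟩, ?_, fun b => ?_⟩
  · exact Measure.InnerRegular.map_of_continuous continuous_subtype_val
  · rw [Measure.map_apply hm hK.measurableSet.compl]
    simp
  · have hb := (continuous_char_eval b).stronglyMeasurable.aestronglyMeasurable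
      (μ := μ.map Subtype.val)
    exact ⟨(integrable_map_measure hb hm.aemeasurable).2 (hμ b).1,
      (hμ b).2.trans (integral_map hm.aemeasurable hb).symm⟩

end Stmt17
end
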